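/- arXiv:2510.26073 — 2 statements merged into one kernel-verified Lean document; each statement's English description precedes it below -/
import Mathlib

section
/- Let A and B be right-orderable groups, G = A ∗ B, and let u ∈ G be an element such that no conjugate of u lies in the image of A or in the image of B, and u is not a proper power (there are no v ∈ G and integer j ≥ 2 with u = vʲ). Then for every integer k ≥ 2, the image of u in the quotient G/⟨⟨uᵏ⟩⟩ has order exactly k; equivalently, for every integer m, uᵐ lies in the normal closure ⟨⟨uᵏ⟩⟩ if and only if k divides m. -/
/-- A group is right-orderable if there is a strict total order on it invariant
under right multiplication. -/
def IsRightOrderable (H : Type*) [Group H] : Prop :=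
  ∃ lt : H → H → Prop, IsStrictTotalOrder H lt ∧ ∀ f g h : H, lt f g → lt (f * h) (g * h)

namespace FreeProductPower

section

/-- The `n`-th entry of the list (counted from `0`) satisfies `p i`, `p (!i)`, `p i`, … -/
def Alt {α : Type*} (p : Bool → α → Prop) : Bool → List α → Prop
  | _, [] => True
  | i, x :: xs => p i x ∧ Alt p (!i) xs

section Alt
variable {α β : Type*} {p : Bool → α → Prop}

@[simp] theorem alt_nil (i : Bool) : Alt p i [] := trivial

@[simp] theorem alt_cons (i : Bool) (x : α) (xs : List α) :
    Alt p i (x :: xs) ↔ p i x ∧ Alt p (!i) xs := Iff.rfl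

theorem alt_append (i : Bool) (l l' : List α) :
    Alt p i (l ++ l') ↔ Alt p i l ∧ Alt p (i ^^ l.length.bodd) l' := by
  induction l generalizing i with
  | nil => simp
  | cons x xs ih =>
    simp only [List.cons_append, alt_cons, ih, List.length_cons, Nat.bodd_succ, and_assoc]
    cases i <;> simp

theorem Alt.imp {q : Bool → β → Prop} {f : α → β} (h : ∀ i x, p i x → q i (f x)) {i : Bool}
    {l : List α} (hl : Alt p i l) : Alt q i (l.map f) := by
  induction l generalizing i with
  | nil => simp
  | cons x xs ih => exact ⟨h _ _ hl.1, ih hl.2⟩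

end Alt

variable {G : Type*} [Group G]

/-- `x` is a nontrivial element of `H i`. -/
def Letter (H : Bool → Subgroup G) (i : Bool) (x : G) : Prop := x ∈ H i ∧ x ≠ 1

theorem Letter.inv {H : Bool → Subgroup G} {i : Bool} {x : G} (h : Letter H i x) :
    Letter H i x⁻¹ := ⟨inv_mem h.1, by simpa using h.2⟩

/-- Words with letters alternately in `H i` and `H (!i)`. -/
abbrev Red (H : Bool → Subgroup G) (i : Bool) (l : List G) : Prop := Alt (Letter H) i l

/-- Every element has exactly one reduced word: `G` is the free product of
`H true` and `H false`. -/
structure IsFreeProduct (H : Bool → Subgroup G) : Prop where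
  exists_red : ∀ g, ∃ i l, Red H i l ∧ l.prod = g
  unique : ∀ i j l l', Red H i l → Red H j l' → l.prod = l'.prod → l = l'

section Coprod
open Monoid
variable {A B : Type*} [Group A] [Group B]

/-- The two factors of a free product, as subgroups. -/
def factor (A B : Type*) [Group A] [Group B] : Bool → Subgroup (Coprod A B)
  | true => (Coprod.inl : A →* Coprod A B).range
  | false => (Coprod.inr : B →* Coprod A B).range

theorem exists_word_of_red {i : Bool} {l : List G} {H : Bool → Subgroup G} (h : Red H i l) :
    ∃ w : CoprodI.Word (fun b => H b),
      w.toList.map (fun s => (s.2 : G)) = l ∧ (∀ s ∈ w.toList.head?, s.1 = i) := by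
  classical
  induction l generalizing i with
  | nil => exact ⟨CoprodI.Word.empty, by simp [CoprodI.Word.empty]⟩
  | cons x xs ih =>
    obtain ⟨w, hw, hi⟩ := ih h.2
    have hne : w.fstIdx ≠ some i := by
      rw [CoprodI.Word.fstIdx]
      intro hh
      rw [Option.map_eq_some_iff] at hh
      obtain ⟨s, hs, rfl⟩ := hh
      simpa using hi s hs
    refine ⟨CoprodI.Word.cons (i := i) ⟨x, h.1.1⟩ w hne ?_, ?_, ?_⟩
    · intro hx
      exact h.1.2 (congrArg Subtype.val hx)
    · simp [CoprodI.Word.cons, hw]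
    · simp [CoprodI.Word.cons]

theorem red_of_word {H : Bool → Subgroup G} (w : List (Σ b : Bool, H b))
    (h1 : ∀ l ∈ w, l.2 ≠ 1) (h2 : w.IsChain fun l l' => l.1 ≠ l'.1) (i : Bool)
    (hi : ∀ s ∈ w.head?, s.1 = i) : Red H i (w.map (fun s => (s.2 : G))) := by
  induction w generalizing i with
  | nil => trivial
  | cons s w ih =>
    have hs : s.1 = i := hi s (by simp)
    subst hs
    refine ⟨⟨s.2.2, ?_⟩, ih (fun l hl => h1 l (by simp [hl])) h2.tail _ ?_⟩
    · intro h
      exact h1 s (by simp) (Subtype.ext h)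
    · intro t ht
      cases w with
      | nil => simp at ht
      | cons t' w =>
        simp only [List.head?_cons, Option.mem_def, Option.some.injEq] at ht
        subst ht
        have := (List.isChain_cons_cons.1 h2).1
        revert this
        cases s.1 <;> cases t'.1 <;> simp

theorem isFreeProduct_factor : IsFreeProduct (factor A B) := by
  classical
  let φ : CoprodI (fun b => factor A B b) →* Coprod A B :=
    CoprodI.lift (fun b => (factor A B b).subtype)
  let ψ : Coprod A B →* CoprodI (fun b => factor A B b) :=
    Coprod.lift
      ((CoprodI.of (i := true)).comp
        ((Coprod.inl : A →* Coprod A B).codRestrict (factor A B true) fun a => ⟨a, rfl⟩))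
      ((CoprodI.of (i := false)).comp
        ((Coprod.inr : B →* Coprod A B).codRestrict (factor A B false) fun a => ⟨a, rfl⟩))
  have h1 : φ.comp ψ = MonoidHom.id _ := by
    apply Coprod.hom_ext <;> ext a <;> simp [φ, ψ] <;> rfl
  have h2 : ψ.comp φ = MonoidHom.id _ := by
    apply CoprodI.ext_hom
    intro b
    cases b <;> ext ⟨_, a, rfl⟩ <;> simp [φ, ψ] <;> rfl
  have hφ : Function.Injective φ := fun a b h => by
    have := congrArg ψ h
    rwa [← MonoidHom.comp_apply, ← MonoidHom.comp_apply, h2] at this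
  have hprod : ∀ w : CoprodI.Word (fun b => factor A B b),
      φ w.prod = (w.toList.map (fun s => (s.2 : Coprod A B))).prod := by
    intro w
    simp [CoprodI.Word.prod, map_list_prod, φ, Function.comp_def]
  refine ⟨fun g => ?_, fun i j l l' hl hl' h => ?_⟩
  · let w := CoprodI.Word.equiv (ψ g)
    have hw : φ w.prod = g := by
      have : w.prod = ψ g := CoprodI.Word.equiv.symm_apply_apply (ψ g)
      rw [this, ← MonoidHom.comp_apply, h1]; rfl
    cases hh : w.toList.head? with
    | none =>
      exact ⟨true, _, red_of_word w.toList w.ne_one w.chain_ne true (by simp [hh]),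
        by rw [← hprod, hw]⟩
    | some s =>
      exact ⟨s.1, _, red_of_word w.toList w.ne_one w.chain_ne s.1 (by simp [hh]),
        by rw [← hprod, hw]⟩
  · obtain ⟨w, rfl, -⟩ := exists_word_of_red hl
    obtain ⟨w', rfl, -⟩ := exists_word_of_red hl'
    rw [← hprod, ← hprod] at h
    have := hφ h
    have : w = w' := CoprodI.Word.equiv.symm.injective this
    rw [this]

end Coprod

theorem Red.inv_append {H : Bool → Subgroup G} {xs ys : List G} {i : Bool}
    (hx : Red H (!i) xs) (hy : Red H i ys) :
    ∃ j, Red H j ((xs.map (·⁻¹)).reverse ++ ys) := by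
  induction xs generalizing i ys with
  | nil => exact ⟨i, by simpa using hy⟩
  | cons x xs ih =>
    have := ih (i := !i) (ys := x⁻¹ :: ys) hx.2 ⟨hx.1.inv, by simpa using hy⟩
    simpa using this

theorem prod_map_inv_reverse (xs : List G) : (xs.map (·⁻¹)).reverse.prod = xs.prod⁻¹ := by
  rw [List.prod_inv_reverse]

/-- Twice the length of the common prefix, plus one if both words continue. -/
noncomputable def cp {α : Type*} : List α → List α → ℕ
  | x :: xs, y :: ys => open Classical in if x = y then 2 + cp xs ys else 1
  | _, _ => 0

section cp
variable {α : Type*}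

@[simp] theorem cp_nil_left (l : List α) : cp [] l = 0 := by cases l <;> rfl
@[simp] theorem cp_nil_right (l : List α) : cp l [] = 0 := by cases l <;> rfl

theorem cp_comm (l l' : List α) : cp l l' = cp l' l := by
  induction l generalizing l' with
  | nil => simp
  | cons x xs ih =>
    cases l' with
    | nil => simp
    | cons y ys =>
      by_cases h : x = y
      · simp [cp, h, ih]
      · simp [cp, h, Ne.symm h]

theorem cp_ultra (l l' l'' : List α) : min (cp l l') (cp l' l'') ≤ cp l l'' := by
  induction l generalizing l' l'' with
  | nil => simp
  | cons x xs ih =>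
    rcases l' with _ | ⟨y, ys⟩
    · simp
    rcases l'' with _ | ⟨z, zs⟩
    · simp
    have := ih ys zs
    by_cases h1 : x = y <;> by_cases h2 : y = z
    · subst h1; subst h2; simp [cp]; omega
    · subst h1; simp [cp, h2]
    · subst h2; simp [cp, h1]
    · simp only [cp, h1, h2, if_false]; split_ifs <;> omega

theorem cp_le (l l' : List α) : cp l l' ≤ 2 * l.length := by
  induction l generalizing l' with
  | nil => simp
  | cons x xs ih =>
    rcases l' with _ | ⟨y, ys⟩
    · simp
    have := ih ys
    simp only [cp, List.length_cons]; split_ifs <;> omega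

theorem take_eq_of_le_cp {l l' : List α} {n : ℕ} (h : 2 * n ≤ cp l l') :
    l.take n = l'.take n ∧ n ≤ l.length ∧ n ≤ l'.length := by
  induction n generalizing l l' with
  | zero => simp
  | succ n ih =>
    rcases l with _ | ⟨x, xs⟩
    · simp at h
    rcases l' with _ | ⟨y, ys⟩
    · simp at h
    simp only [cp] at h
    split_ifs at h with hxy
    · have := ih (l := xs) (l' := ys) (by omega)
      simp [hxy, this]
    · omega

end cp

namespace IsFreeProduct

variable {H : Bool → Subgroup G}

theorem disjoint (hH : IsFreeProduct H) {x : G} (h : x ∈ H true) (h' : x ∈ H false) : x = 1 := by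
  by_contra hx
  have := hH.unique true true [x, x⁻¹] [] ⟨⟨h, hx⟩, Letter.inv ⟨h', hx⟩, trivial⟩ trivial (by simp)
  simp at this

theorem letter_unique (hH : IsFreeProduct H)
    {i j : Bool} {x : G} (h : Letter H i x) (h' : x ∈ H j) : i = j := by
  cases i <;> cases j <;> first | rfl | exact absurd (hH.disjoint ‹_› h.1) h.2 |
    exact absurd (hH.disjoint h.1 ‹_›) h.2

end IsFreeProduct

open Classical in
/-- A reduced word, with the type of its first letter. -/
noncomputable def nfp (H : Bool → Subgroup G) (g : G) : Bool × List G :=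
  if h : ∃ p : Bool × List G, Red H p.1 p.2 ∧ p.2.prod = g then h.choose else (true, [])

/-- The reduced word of `g`. -/
noncomputable abbrev nf (H : Bool → Subgroup G) (g : G) : List G := (nfp H g).2

/-- The type of the first letter of `g`. -/
noncomputable abbrev fst (H : Bool → Subgroup G) (g : G) : Bool := (nfp H g).1

/-- The length of the reduced word of `g`. -/
noncomputable def len (H : Bool → Subgroup G) (g : G) : ℕ := (nf H g).length

/-- Twice the Gromov product. -/
noncomputable def gp (H : Bool → Subgroup G) (g h : G) : ℤ :=
  len H g + len H h - len H (g⁻¹ * h)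

namespace IsFreeProduct

variable {H : Bool → Subgroup G}

theorem nfp_spec (hH : IsFreeProduct H) (g : G) : Red H (fst H g) (nf H g) ∧ (nf H g).prod = g := by
  have h : ∃ p : Bool × List G, Red H p.1 p.2 ∧ p.2.prod = g := by
    obtain ⟨i, l, h⟩ := hH.exists_red g
    exact ⟨(i, l), h⟩
  simp only [fst, nf, nfp, dif_pos h]
  exact h.choose_spec

theorem red_nf (hH : IsFreeProduct H) (g : G) : Red H (fst H g) (nf H g) := (hH.nfp_spec g).1

theorem prod_nf (hH : IsFreeProduct H) (g : G) : (nf H g).prod = g := (hH.nfp_spec g).2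

theorem nf_eq (hH : IsFreeProduct H) {i : Bool} {l : List G} (h : Red H i l) : nf H l.prod = l :=
  hH.unique _ _ _ _ (hH.red_nf _) h (hH.prod_nf _)

theorem len_eq (hH : IsFreeProduct H)
    {i : Bool} {l : List G} (h : Red H i l) : len H l.prod = l.length := by
  rw [len, hH.nf_eq h]

theorem len_one (hH : IsFreeProduct H) : len H (1 : G) = 0 := by
  simpa using hH.len_eq (i := true) (l := []) trivial

theorem len_inv (hH : IsFreeProduct H) (g : G) : len H g⁻¹ = len H g := by
  obtain ⟨j, hj⟩ := Red.inv_append (H := H) (i := !fst H g) (ys := [])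
    (by simpa using hH.red_nf g) trivial
  have := hH.len_eq hj
  rw [List.append_nil, prod_map_inv_reverse, hH.prod_nf] at this
  simpa [len] using this

theorem len_inv_mul_of_ne (hH : IsFreeProduct H)
    {i : Bool} {xs ys : List G} (hx : Red H (!i) xs) (hy : Red H i ys) :
    len H (xs.prod⁻¹ * ys.prod) = xs.length + ys.length := by
  obtain ⟨j, hj⟩ := Red.inv_append hx hy
  have := hH.len_eq hj
  rw [List.prod_append, prod_map_inv_reverse] at this
  simpa using this

theorem len_inv_mul (hH : IsFreeProduct H)
    {i : Bool} {xs ys : List G} (hx : Red H i xs) (hy : Red H i ys) :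
    (len H (xs.prod⁻¹ * ys.prod) : ℤ) = xs.length + ys.length - cp xs ys := by
  induction xs generalizing i ys with
  | nil => simp [hH.len_eq hy]
  | cons x xs ih =>
    rcases ys with _ | ⟨y, ys⟩
    · have := hH.len_inv (x :: xs).prod
      rw [hH.len_eq hx] at this
      simp only [List.prod_nil, mul_one, this, cp_nil_right]
      simp
    by_cases hxy : x = y
    · subst hxy
      have := ih hx.2 hy.2
      have h2 : (x :: xs).prod⁻¹ * (x :: ys).prod = xs.prod⁻¹ * ys.prod := by
        simp [mul_assoc]
      rw [h2, this]
      simp [cp]; ring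
    · have h3 : Letter H i (x⁻¹ * y) :=
        ⟨mul_mem (inv_mem hx.1.1) hy.1.1, fun h => hxy (inv_mul_eq_one.1 h)⟩
      have := hH.len_inv_mul_of_ne hx.2 (show Red H i (x⁻¹ * y :: ys) from ⟨h3, hy.2⟩)
      have h2 : (x :: xs).prod⁻¹ * (y :: ys).prod = xs.prod⁻¹ * (x⁻¹ * y :: ys).prod := by
        simp [mul_assoc]
      rw [h2, this]
      simp [cp, hxy]; ring

theorem gp_eq (hH : IsFreeProduct H) (g h : G) :
    gp H g h = if fst H g = fst H h then (cp (nf H g) (nf H h) : ℤ) else 0 := by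
  have e : g⁻¹ * h = (nf H g).prod⁻¹ * (nf H h).prod := by rw [hH.prod_nf, hH.prod_nf]
  rw [gp, e]
  split_ifs with hf
  · rw [hH.len_inv_mul (hH.red_nf g) (hf ▸ hH.red_nf h)]
    simp [len]
  · have h1 : fst H g = !fst H h := by
      revert hf; cases fst H g <;> cases fst H h <;> simp
    rw [hH.len_inv_mul_of_ne (h1 ▸ hH.red_nf g) (hH.red_nf h)]
    simp [len]

theorem gp_ultra (hH : IsFreeProduct H) (g h k : G) : min (gp H g h) (gp H h k) ≤ gp H g k := by
  have := cp_ultra (nf H g) (nf H h) (nf H k)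
  simp only [hH.gp_eq]
  by_cases h1 : fst H g = fst H h <;> by_cases h2 : fst H h = fst H k
  · simp only [h1, h2, if_true]; omega
  · rw [if_neg h2]; split_ifs <;> omega
  · rw [if_neg h1]; split_ifs <;> omega
  · rw [if_neg h2]; split_ifs <;> omega

theorem gp_comm (hH : IsFreeProduct H) (g h : G) : gp H g h = gp H h g := by
  rw [hH.gp_eq, hH.gp_eq, cp_comm]
  simp [eq_comm]

theorem gp_nonneg (hH : IsFreeProduct H) (g h : G) : 0 ≤ gp H g h := by
  rw [hH.gp_eq]; split_ifs <;> omega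

theorem gp_le_left (hH : IsFreeProduct H) (g h : G) : gp H g h ≤ 2 * len H g := by
  rw [hH.gp_eq]
  have := cp_le (nf H g) (nf H h)
  split_ifs <;> simp only [len] <;> omega

end IsFreeProduct

end

section

theorem natCast_induction {L : ℕ} [NeZero L] {p : ZMod L → Prop} (h0 : p 0)
    (h : ∀ t, p t → p (t + 1)) (t : ZMod L) : p t := by
  have : ∀ n : ℕ, p (n : ZMod L) := by
    intro n
    induction n with
    | zero => simpa using h0
    | succ n ih => simpa using h _ ih
  simpa using this t.val

theorem exists_heights {L : ℕ} [NeZero L] (hL : Even L) (s : ZMod L → ℤ)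
    (hs : ∀ t, s t = 1 ∨ s t = -1) (hS : 0 ≤ ∑ n ∈ Finset.range L, s n) :
    ∃ v : ZMod L → ℤ, ∀ t, (v (t + 1) = v t + 1 ∨ v (t + 1) = v t - 1) ∧
      s t = (if 1 ≤ v (t + 1) then 1 else -1) * (v (t + 1) - v t) := by
  let P : ℕ → ℤ := fun n => ∑ i ∈ Finset.range n, s i
  have hP1 : ∀ n, P (n + 1) = P n + s n := fun n => Finset.sum_range_succ _ _
  have hPL : ∀ n, P (n + L) = P n + P L := by
    intro n
    induction n with
    | zero => simp [P]
    | succ n ih =>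
      rw [add_right_comm, hP1, hP1, ih]
      simp; ring
  have hpar : ∀ n : ℕ, (P n - n) % 2 = 0 := by
    intro n
    induction n with
    | zero => simp [P]
    | succ n ih =>
      rw [hP1]
      rcases hs n with h | h <;> rw [h] <;> push_cast <;> omega
  have hSe : P L % 2 = 0 := by
    have := hpar L
    obtain ⟨r, hr⟩ := hL
    omega
  have hS' : 0 ≤ P L := hS
  have hm : ∀ n, ∃ m, (∀ r, m ≤ P (n + r)) ∧ ∃ r, P (n + r) = m := by
    intro n
    obtain ⟨r, -, hr⟩ := Finset.exists_min_image (Finset.range L) (fun r => P (n + r))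
      ⟨0, Finset.mem_range.2 (Nat.pos_of_ne_zero (NeZero.ne L))⟩
    refine ⟨_, ?_, r, rfl⟩
    intro q
    induction q using Nat.strong_induction_on with
    | _ q ih =>
      by_cases hq : q < L
      · exact hr q (Finset.mem_range.2 hq)
      · have h1 := ih (q - L) (by have := Nat.pos_of_ne_zero (NeZero.ne L); omega)
        have h2 := hPL (n + (q - L))
        rw [show n + (q - L) + L = n + q by omega] at h2
        omega
  choose m hm1 hm2 using hm
  have hmL : ∀ n, m (n + L) = m n + P L := by
    intro n
    obtain ⟨r, hr⟩ := hm2 n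
    obtain ⟨r', hr'⟩ := hm2 (n + L)
    have h1 := hm1 (n + L) r
    have h2 := hm1 n r'
    rw [add_right_comm, hPL] at h1 hr'
    omega
  have hmP : ∀ n, m n ≤ P n := fun n => hm1 n 0
  have hmm : ∀ n, m n ≤ m (n + 1) := fun n => by
    obtain ⟨r, hr⟩ := hm2 (n + 1)
    rw [← hr, add_assoc]
    exact hm1 n _
  have hmo : ∀ n, m n = P n ∨ m n = m (n + 1) := fun n => by
    obtain ⟨r, hr⟩ := hm2 n
    rcases r with _ | r
    · exact Or.inl hr.symm
    · refine Or.inr (le_antisymm (hmm n) ?_)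
      rw [← hr, show n + (r + 1) = n + 1 + r by omega]
      exact hm1 _ _
  let w : ℕ → ℤ := fun n => if m n % 2 = 0 then 1 + (P n - m n) else -(P n - m n)
  have hwL : Function.Periodic w L := by
    intro n
    simp only [w, hmL, hPL]
    have h : (m n + P L) % 2 = m n % 2 := by omega
    rw [h]
    split_ifs <;> ring
  have hw : ∀ n, (w (n + 1) = w n + 1 ∨ w (n + 1) = w n - 1) ∧
      s n = (if 1 ≤ w (n + 1) then 1 else -1) * (w (n + 1) - w n) := by
    intro n
    have h1 := hmP n
    have h2 := hmP (n + 1)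
    have h3 := hmm n
    have h4 := hmo n
    have h5 := hP1 n
    simp only [w]
    rcases hs n with h | h <;> rw [h] at h5 ⊢ <;> split_ifs <;> omega
  refine ⟨fun t => w t.val, fun t => ?_⟩
  have hv : ∀ n : ℕ, w (n : ZMod L).val = w n := fun n => by
    rw [ZMod.val_natCast, hwL.map_mod_nat]
  have := hw t.val
  have e : (t.val : ZMod L) = t := by simp
  have e2 : t + 1 = ((t.val + 1 : ℕ) : ZMod L) := by simp
  rw [e2]
  simp only [hv]
  rwa [e] at this

variable {G : Type*} [Group G]

/-- `Pos i` is the set of positive elements of a left (and of a right) order of `H i`. -/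
structure Cone (H : Bool → Subgroup G) (Pos : Bool → G → Prop) : Prop where
  mul : ∀ i x y, Pos i x → Pos i y → Pos i (x * y)
  total : ∀ i x, Letter H i x → Pos i x ∨ Pos i x⁻¹
  asymm : ∀ i x, Pos i x → ¬ Pos i x⁻¹

theorem Cone.inv {H : Bool → Subgroup G} {Pos : Bool → G → Prop} (h : Cone H Pos) :
    Cone H (fun i x => Pos i x⁻¹) where
  mul i x y hx hy := by rw [mul_inv_rev]; exact h.mul _ _ _ hy hx
  total i x hx := h.total i _ hx.inv
  asymm i x hx := h.asymm i _ hx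

/-- A corner of a cell `(id, sgn)`, located at a position of the relator. -/
abbrev Corner (L : ℕ) := (ℕ × Bool) × ZMod L

namespace Corner
variable {L : ℕ}

/-- The position at which the corner is entered. -/
def inP (c : Corner L) : ZMod L := if c.1.2 then c.2 else c.2 + 1

/-- The position at which the corner is left. -/
def outP (c : Corner L) : ZMod L := if c.1.2 then c.2 + 1 else c.2

/-- The next corner of the cell. -/
def nx (c : Corner L) : Corner L := (c.1, if c.1.2 then c.2 + 1 else c.2 - 1)

/-- The previous corner of the cell. -/
def pv (c : Corner L) : Corner L := (c.1, if c.1.2 then c.2 - 1 else c.2 + 1)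

/-- The label of the corner. -/
def val (X : ZMod L → G) (c : Corner L) : G := if c.1.2 then X c.2 else (X c.2)⁻¹

@[simp] theorem pv_nx (c : Corner L) : c.nx.pv = c := by
  rcases c with ⟨⟨n, s⟩, t⟩; cases s <;> simp [nx, pv]

@[simp] theorem inP_nx (c : Corner L) : c.nx.inP = c.outP := by
  rcases c with ⟨⟨n, s⟩, t⟩; cases s <;> simp [nx, inP, outP]

end Corner

/-- Going from corner `c` to corner `d` the larger of the two positions is marked. -/
def Step {L : ℕ} (rank : ZMod L → ℕ) (T₁ T₂ : Corner L → Prop) (c d : Corner L) : Prop :=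
  (rank d.inP < rank c.outP ∧ T₁ c) ∨ (rank c.outP < rank d.inP ∧ T₂ d)

/-- In every closed chain of corners of one type some corner is marked on both sides. -/
def TopProperty {L : ℕ} (X : ZMod L → G) (τ : ZMod L → Bool) (rank : ZMod L → ℕ) : Prop :=
  ∀ (i : Bool) (T₁ T₂ : Corner L → Prop) (c : Corner L) (cs : List (Corner L)),
    (∀ e ∈ c :: cs, τ e.2 = i) → (c :: cs ++ [c]).IsChain (Step rank T₁ T₂) →
    ((c :: cs).map (Corner.val X)).prod = 1 → ∃ e ∈ c :: cs, T₁ e ∧ T₂ e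

section Top
variable {L : ℕ} {X : ZMod L → G} {τ : ZMod L → Bool} {rank : ZMod L → ℕ}
  {H : Bool → Subgroup G} {Y : Type*} {K : Y → Y → Prop} {φ : G → ZMod L → Y} {i : Bool}

theorem key_chain
    (mono : ∀ g ∈ H i, ∀ s t, rank s < rank t → K (φ g s) (φ g t))
    (trans : ∀ a b c, K a b → K b c → K a c)
    (shift : ∀ g t, τ t = i → φ g (t + 1) = φ (g * (X t)⁻¹) t)
    (hX : ∀ t, X t ∈ H (τ t)) {T₁ T₂ : Corner L → Prop} (c : Corner L) (cs : List (Corner L))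
    (hne : cs ≠ []) (hi : ∀ e ∈ c :: cs, τ e.2 = i)
    (hc : (c :: cs).IsChain (Step rank T₁ T₂))
    (hT : ∀ e ∈ c :: cs, ¬ (T₁ e ∧ T₂ e)) (g : G) (hg : g ∈ H i) :
    (¬ T₁ c → T₂ (cs.getLast hne) ∧
      K (φ g c.outP) (φ (g * (cs.map (Corner.val X)).prod) (cs.getLast hne).outP)) ∧
    (T₁ c → T₂ (cs.getLast hne) ∨
      K (φ (g * (cs.map (Corner.val X)).prod) (cs.getLast hne).outP) (φ g c.outP)) := by
  induction cs generalizing c g with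
  | nil => exact absurd rfl hne
  | cons d ds ih =>
    have hd : φ (g * d.val X) d.outP = φ g d.inP := by
      have h := hi d (by simp)
      rcases d with ⟨⟨n, s⟩, t⟩
      cases s
      · simp [Corner.val, Corner.inP, Corner.outP, shift _ _ h]
      · simp [Corner.val, Corner.inP, Corner.outP, shift _ _ h]
    have hvd : d.val X ∈ H i := by
      have h := hi d (by simp)
      rw [← h]
      unfold Corner.val
      split_ifs
      · exact hX _
      · exact inv_mem (hX _)
    have hgd := mul_mem hg hvd
    have hdT := hT d (by simp)
    rw [List.isChain_cons_cons] at hc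
    obtain ⟨hcd, hch⟩ := hc
    by_cases hds : ds = []
    · subst hds
      simp only [List.map_cons, List.map_nil, List.prod_cons, List.prod_nil, mul_one,
        List.getLast_singleton, hd]
      rcases hcd with ⟨h1, h2⟩ | ⟨h1, h2⟩
      · exact ⟨fun h => absurd h2 h, fun _ => Or.inr (mono g hg _ _ h1)⟩
      · exact ⟨fun _ => ⟨h2, mono g hg _ _ h1⟩, fun _ => Or.inl h2⟩
    · have := ih d hds (fun e he => hi e (by simp [he])) hch (fun e he => hT e (by simp [he]))
        _ hgd
      rw [hd] at this
      simp only [List.map_cons, List.prod_cons, List.getLast_cons hds, ← mul_assoc]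
      rcases hcd with ⟨h1, h2⟩ | ⟨h1, h2⟩
      · refine ⟨fun h => absurd h2 h, fun _ => ?_⟩
        by_cases hd1 : T₁ d
        · exact (this.2 hd1).imp id fun h => trans _ _ _ h (mono g hg _ _ h1)
        · exact Or.inl (this.1 hd1).1
      · have hd1 : ¬ T₁ d := fun h => hdT ⟨h, h2⟩
        have := this.1 hd1
        exact ⟨fun _ => ⟨this.1, trans _ _ _ (mono g hg _ _ h1) this.2⟩, fun _ => Or.inl this.1⟩

theorem topProperty_of_keys (hX : ∀ t, X t ∈ H (τ t))
    (hkeys : ∀ i, ∃ (K : Y → Y → Prop) (φ : G → ZMod L → Y),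
      (∀ g ∈ H i, ∀ s t, rank s < rank t → K (φ g s) (φ g t)) ∧
      (∀ a b c, K a b → K b c → K a c) ∧ (∀ a, ¬ K a a) ∧
      (∀ g t, τ t = i → φ g (t + 1) = φ (g * (X t)⁻¹) t)) : TopProperty X τ rank := by
  intro i T₁ T₂ c cs hi hc hp
  by_contra hT
  push Not at hT
  obtain ⟨K, φ, mono, trans, irr, shift⟩ := hkeys i
  have hp' : ((cs ++ [c]).map (Corner.val X)).prod = 1 := by
    rw [List.map_cons, List.prod_cons] at hp
    rw [List.map_append, List.prod_append]
    simpa using mul_eq_one_comm.1 hp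
  have hmem : ∀ e ∈ c :: (cs ++ [c]), e ∈ c :: cs := fun e he => by
    simp only [List.mem_cons, List.mem_append, List.not_mem_nil, or_false] at he ⊢
    tauto
  have := key_chain (H := H) mono trans shift hX c (cs ++ [c]) (by simp)
    (fun e he => hi e (hmem e he)) hc (fun e he h => hT e (hmem e he) h.1 h.2) 1 (one_mem _)
  rw [hp'] at this
  simp only [List.getLast_append_singleton, mul_one] at this
  by_cases h1 : T₁ c
  · rcases this.2 h1 with h | h
    · exact hT c (by simp) h1 h
    · exact irr _ h
  · exact irr _ (this.1 h1).2

end Top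

end

section

/-- The rank function of a strict order on a finite type. -/
theorem card_filter_lt_of_rel {J : Type*} [Fintype J] (r : J → J → Prop) [DecidableRel r]
    (trans : ∀ a b c, r a b → r b c → r a c) (irr : ∀ a, ¬ r a a) {s t : J} (h : r s t) :
    (Finset.univ.filter (r · s)).card < (Finset.univ.filter (r · t)).card := by
  apply Finset.card_lt_card
  rw [Finset.ssubset_iff_of_subset]
  · exact ⟨s, by simpa using h, by simpa using irr s⟩
  · intro a ha
    simp only [Finset.mem_filter, Finset.mem_univ, true_and] at ha ⊢
    exact trans _ _ _ ha h

variable {G : Type*} [Group G]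

theorem exists_rank_of_sum_nonneg {H : Bool → Subgroup G} {Pos : Bool → G → Prop} (hP : Cone H Pos)
    {L : ℕ} [NeZero L] (hL : Even L) (X : ZMod L → G) (τ : ZMod L → Bool)
    (hτ : ∀ t, τ (t + 1) = !τ t) (hX : ∀ t, Letter H (τ t) (X t))
    (hshift : ∀ s : ZMod L, (∀ t, X (t + s) = X t) → s = 0)
    (hS : 0 ≤ ∑ n ∈ Finset.range L, open Classical in
      if Pos (τ (n : ZMod L)) (X n) then (1 : ℤ) else -1) :
    ∃ rank : ZMod L → ℕ, Function.Injective rank ∧ TopProperty X τ rank := by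
  classical
  obtain ⟨v, hv⟩ := exists_heights hL (fun t => if Pos (τ t) (X t) then (1 : ℤ) else -1)
    (fun t => by split_ifs <;> simp) hS
  -- the order on letters that is used in window `w`
  let δ : Bool → ℤ → G → G → Prop := fun i w a b =>
    if 1 ≤ w then Pos i (b⁻¹ * a) else Pos i (a⁻¹ * b)
  have δ_inv : ∀ i w g a b, δ i w (g * a) (g * b) ↔ δ i w a b := by
    intro i w g a b; simp [δ, mul_assoc]
  have δ_trans : ∀ i w a b c, δ i w a b → δ i w b c → δ i w a c := by
    intro i w a b c hab hbc
    simp only [δ] at *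
    split_ifs at * with h
    · simpa [mul_assoc] using hP.mul _ _ _ hbc hab
    · simpa [mul_assoc] using hP.mul _ _ _ hab hbc
  have not_pos_one : ∀ i, ¬ Pos i 1 := fun i h => hP.asymm i 1 h (by simpa using h)
  have δ_irr : ∀ i w a, ¬ δ i w a a := by
    intro i w a h; simp [δ, not_pos_one] at h
  have δ_tri : ∀ i w a b, a ∈ H i → b ∈ H i → δ i w a b ∨ a = b ∨ δ i w b a := by
    intro i w a b ha hb
    by_cases hab : a = b
    · exact Or.inr (Or.inl hab)
    have hl : Letter H i (a⁻¹ * b) :=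
      ⟨mul_mem (inv_mem ha) hb, fun h => hab (inv_mul_eq_one.1 h)⟩
    have := hP.total _ _ hl
    simp only [mul_inv_rev, inv_inv] at this
    simp only [δ]
    split_ifs <;> tauto
  have ent_up : ∀ t, v (t + 1) = v t + 1 → δ (τ t) (v (t + 1)) (X t) 1 := by
    intro t h
    have := (hv t).2
    have e : v (t + 1) - v t = 1 := by rw [h]; ring
    rw [e] at this
    have tot := hP.total _ _ (hX t)
    simp only [δ, inv_one, one_mul, mul_one]
    by_cases h1 : 1 ≤ v (t + 1) <;> by_cases h2 : Pos (τ t) (X t) <;>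
      simp only [h1, h2, if_true, if_false] at this tot ⊢ <;> first | omega | tauto
  have ent_dn : ∀ t, v (t + 1) = v t - 1 → δ (τ t) (v (t + 1)) 1 (X t) := by
    intro t h
    have := (hv t).2
    have e : v (t + 1) - v t = -1 := by rw [h]; ring
    rw [e] at this
    have tot := hP.total _ _ (hX t)
    simp only [δ, inv_one, one_mul, mul_one]
    by_cases h1 : 1 ≤ v (t + 1) <;> by_cases h2 : Pos (τ t) (X t) <;>
      simp only [h1, h2, if_true, if_false] at this tot ⊢ <;> first | omega | tauto
  have parity : ∃ j, ∀ t, τ t = j ↔ v t % 2 = 0 := by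
    refine ⟨if v 0 % 2 = 0 then τ 0 else !τ 0, natCast_induction ?_ fun t ih => ?_⟩
    · split_ifs with h <;> simp [h]
    · rw [hτ]
      have := (hv t).1
      generalize (if v 0 % 2 = 0 then τ 0 else !τ 0) = j at ih
      have e : ((!τ t) = j) ↔ ¬ (τ t = j) := by cases τ t <;> cases j <;> simp
      rw [e, ih]
      omega
  obtain ⟨j, hj⟩ := parity
  have par : ∀ s t, τ s = τ t ↔ v s % 2 = v t % 2 := by
    intro s t
    have h1 := hj s
    have h2 := hj t
    have : τ s = τ t ↔ (τ s = j ↔ τ t = j) := by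
      cases τ s <;> cases τ t <;> cases j <;> simp
    rw [this, h1, h2]
    omega
  let loc : ZMod L → ℤ := fun t => v t + v (t + 1) - 1 + if v (t + 1) = v t + 1 then 0 else 1
  have hloc : ∀ t, (v (t + 1) = v t + 1 ∧ loc t = 2 * v t) ∨
      (v (t + 1) = v t - 1 ∧ loc t = 2 * v (t + 1) + 1) := by
    intro t
    simp only [loc]
    rcases (hv t).1 with h | h <;> rw [h] <;> split_ifs <;> omega
  let B : ZMod L → ZMod L → Prop := fun s t => loc s < loc t ∨
    (loc s = loc t ∧ δ (τ s) (v (s + 1)) (X s) (X t))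
  have loc_eq : ∀ s t, loc s = loc t → v s = v t ∧ v (s + 1) = v (t + 1) ∧ τ s = τ t := by
    intro s t h
    rw [par]
    rcases hloc s with h1 | h1 <;> rcases hloc t with h2 | h2 <;> omega
  have B_trans : ∀ a b c, B a b → B b c → B a c := by
    rintro a b c (h1 | ⟨h1, h1'⟩) (h2 | ⟨h2, h2'⟩)
    · exact Or.inl (h1.trans h2)
    · exact Or.inl (h2 ▸ h1)
    · exact Or.inl (h1 ▸ h2)
    · refine Or.inr ⟨h1.trans h2, ?_⟩
      obtain ⟨-, e, e'⟩ := loc_eq _ _ h1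
      rw [← e, ← e'] at h2'
      exact δ_trans _ _ _ _ _ h1' h2'
  have B_irr : ∀ a, ¬ B a a := by
    rintro a (h | ⟨-, h⟩)
    · exact lt_irrefl _ h
    · exact δ_irr _ _ _ h
  have B_tri : ∀ s t, B s t ∨ (loc s = loc t ∧ X s = X t) ∨ B t s := by
    intro s t
    rcases lt_trichotomy (loc s) (loc t) with h | h | h
    · exact Or.inl (Or.inl h)
    · obtain ⟨-, e, e'⟩ := loc_eq _ _ h
      rcases δ_tri (τ s) (v (s + 1)) (X s) (X t) (hX s).1 (e' ▸ (hX t).1) with h' | h' | h'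
      · exact Or.inl (Or.inr ⟨h, h'⟩)
      · exact Or.inr (Or.inl ⟨h, h'⟩)
      · exact Or.inr (Or.inr (Or.inr ⟨h.symm, e ▸ e' ▸ h'⟩))
    · exact Or.inr (Or.inr (Or.inl h))
  let b : ZMod L → ℕ := fun t => (Finset.univ.filter (B · t)).card
  have b_lt : ∀ {s t}, B s t → b s < b t := card_filter_lt_of_rel B B_trans B_irr
  have b_eq : ∀ {s t}, b s = b t → loc s = loc t ∧ X s = X t := by
    intro s t h
    rcases B_tri s t with h' | h' | h'
    · exact absurd h (b_lt h').ne
    · exact h'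
    · exact absurd h (b_lt h').ne'
  have b_lt' : ∀ {s t}, b s < b t → B s t := by
    intro s t h
    rcases B_tri s t with h' | h' | h'
    · exact h'
    · exfalso
      have : ∀ r, B r s ↔ B r t := by
        intro r
        simp only [B, h'.1, h'.2]
      simp only [b, this] at h
      exact lt_irrefl _ h
    · exact absurd h (b_lt h').asymm
  let q : ZMod L → Lex (ℕ → ℕ) := fun t => toLex fun r => b (t + r)
  have q_inj : Function.Injective q := by
    intro s t h
    have h1 : ∀ r : ZMod L, X (s + r) = X (t + r) := by
      intro r
      have : b (s + (r.val : ZMod L)) = b (t + (r.val : ZMod L)) := congrFun h r.val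
      simpa using (b_eq this).2
    have := hshift (t - s) (fun r => by
      have := h1 (r - s)
      rw [show s + (r - s) = r by ring] at this
      rw [this]; ring_nf)
    exact (sub_eq_zero.1 this).symm
  have q_step : ∀ {s t}, q s < q t →
      B s t ∨ (loc s = loc t ∧ X s = X t ∧ q (s + 1) < q (t + 1)) := by
    rintro s t ⟨r, hr1, hr2⟩
    rcases r with _ | r
    · left
      apply b_lt'
      simpa [q] using hr2
    · right
      have := hr1 0 (by simp)
      obtain ⟨h1, h2⟩ := b_eq (s := s) (t := t) (by simpa [q] using this)
      refine ⟨h1, h2, r, fun k hk => ?_, ?_⟩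
      · have := hr1 (k + 1) (by simpa using hk)
        simpa [q, add_assoc, add_comm, add_left_comm] using this
      · simpa [q, add_assoc, add_comm, add_left_comm] using hr2
  refine ⟨fun t => (Finset.univ.filter (q · < q t)).card, ?_, ?_⟩
  · intro s t h
    rcases lt_trichotomy (q s) (q t) with h' | h' | h'
    · exact absurd h (card_filter_lt_of_rel (fun a b => q a < q b) (fun _ _ _ => lt_trans)
        (fun _ => lt_irrefl _) h').ne
    · exact q_inj h'
    · exact absurd h (card_filter_lt_of_rel (fun a b => q a < q b) (fun _ _ _ => lt_trans)
        (fun _ => lt_irrefl _) h').ne'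
  · refine topProperty_of_keys (H := H) (Y := ℤ × G × ZMod L) (fun t => (hX t).1) fun i => ?_
    refine ⟨fun y z => y.1 < z.1 ∨ (y.1 = z.1 ∧ (δ i y.1 y.2.1 z.2.1 ∨
        (y.2.1 = z.2.1 ∧ q y.2.2 < q z.2.2))),
      fun g t => if τ t = i then (v (t + 1), g * X t, t + 1) else (v t, g, t), ?_, ?_, ?_, ?_⟩
    · intro g hg s t hst
      have hq : q s < q t := by
        by_contra h
        rcases (not_lt.1 h).lt_or_eq with h' | h'
        · exact hst.asymm (card_filter_lt_of_rel (fun a b => q a < q b) (fun _ _ _ => lt_trans)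
            (fun _ => lt_irrefl _) h')
        · rw [q_inj h'] at hst
          exact lt_irrefl _ hst
      have hps := par s t
      have hvs := hloc s
      have hvt := hloc t
      have inv1 : ∀ w x, δ i w (g * x) g ↔ δ i w x 1 := fun w x => by
        simpa using δ_inv i w g x 1
      have inv2 : ∀ w x, δ i w g (g * x) ↔ δ i w 1 x := fun w x => by
        simpa using δ_inv i w g 1 x
      rcases q_step hq with (h | ⟨h, h'⟩) | ⟨h, h', h''⟩
      · by_cases hs : τ s = i <;> by_cases ht : τ t = i
        · have hp := hps.1 (hs.trans ht.symm)
          simp only [hs, ht, if_true]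
          by_cases hw : v (s + 1) = v (t + 1)
          · refine Or.inr ⟨hw, Or.inl ?_⟩
            rw [δ_inv]
            have h1 : v (s + 1) = v s + 1 := by omega
            have h2 : v (t + 1) = v t - 1 := by omega
            have e1 := ent_up s h1
            have e2 := ent_dn t h2
            rw [hs] at e1
            rw [ht, ← hw] at e2
            exact δ_trans _ _ _ _ _ e1 e2
          · left; show v (s + 1) < v (t + 1); omega
        · have hp := mt hps.2 (by rw [hs]; exact fun h => ht h.symm)
          simp only [hs, ht, if_true, if_false]
          by_cases hw : v (s + 1) = v t
          · refine Or.inr ⟨hw, Or.inl ?_⟩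
            have h1 : v (s + 1) = v s + 1 := by omega
            have e1 := ent_up s h1
            rw [hs] at e1
            rwa [inv1]
          · left; show v (s + 1) < v t; omega
        · have hp := mt hps.2 (by rw [ht]; exact hs)
          simp only [hs, ht, if_true, if_false]
          by_cases hw : v s = v (t + 1)
          · refine Or.inr ⟨hw, Or.inl ?_⟩
            have h1 : v (t + 1) = v t - 1 := by omega
            have e1 := ent_dn t h1
            rw [ht, ← hw] at e1
            rwa [inv2]
          · left; show v s < v (t + 1); omega
        · have hp := hps.1 (by revert hs ht; cases τ s <;> cases τ t <;> cases i <;> simp)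
          simp only [hs, ht, if_false]
          by_cases hw : v s = v t
          · exact Or.inr ⟨hw, Or.inr ⟨by simp, hq⟩⟩
          · left; show v s < v t; omega
      · obtain ⟨e1, e2, e3⟩ := loc_eq _ _ h
        by_cases hs : τ s = i
        · have ht : τ t = i := e3 ▸ hs
          simp only [hs, ht, if_true]
          refine Or.inr ⟨e2, Or.inl ?_⟩
          rw [δ_inv]
          rwa [hs] at h'
        · have ht : ¬ τ t = i := e3 ▸ hs
          simp only [hs, ht, if_false]
          exact Or.inr ⟨e1, Or.inr ⟨by simp, hq⟩⟩
      · obtain ⟨e1, e2, e3⟩ := loc_eq _ _ h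
        by_cases hs : τ s = i
        · have ht : τ t = i := e3 ▸ hs
          simp only [hs, ht, if_true, h']
          exact Or.inr ⟨e2, Or.inr ⟨by simp, h''⟩⟩
        · have ht : ¬ τ t = i := e3 ▸ hs
          simp only [hs, ht, if_false]
          exact Or.inr ⟨e1, Or.inr ⟨by simp, hq⟩⟩
    · rintro ⟨w, g, t⟩ ⟨w', g', t'⟩ ⟨w'', g'', t''⟩ h1 h2
      dsimp only at *
      rcases h1 with h1 | ⟨rfl, h1⟩ <;> rcases h2 with h2 | ⟨rfl, h2⟩
      · exact Or.inl (h1.trans h2)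
      · exact Or.inl h1
      · exact Or.inl h2
      · refine Or.inr ⟨rfl, ?_⟩
        rcases h1 with h1 | ⟨rfl, h1⟩ <;> rcases h2 with h2 | ⟨rfl, h2⟩
        · exact Or.inl (δ_trans _ _ _ _ _ h1 h2)
        · exact Or.inl h1
        · exact Or.inl h2
        · exact Or.inr ⟨rfl, h1.trans h2⟩
    · rintro ⟨w, g, t⟩ (h | ⟨-, h | ⟨-, h⟩⟩)
      · exact lt_irrefl _ h
      · exact δ_irr _ _ _ h
      · exact lt_irrefl _ h
    · intro g t ht
      have : τ (t + 1) ≠ i := by rw [hτ, ht]; simp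
      simp [ht, this]

theorem exists_rank {H : Bool → Subgroup G} {Pos : Bool → G → Prop} (hP : Cone H Pos)
    {L : ℕ} [NeZero L] (hL : Even L) (X : ZMod L → G) (τ : ZMod L → Bool)
    (hτ : ∀ t, τ (t + 1) = !τ t) (hX : ∀ t, Letter H (τ t) (X t))
    (hshift : ∀ s : ZMod L, (∀ t, X (t + s) = X t) → s = 0) :
    ∃ rank : ZMod L → ℕ, Function.Injective rank ∧ TopProperty X τ rank := by
  classical
  rcases le_total 0 (∑ n ∈ Finset.range L,
    if Pos (τ (n : ZMod L)) (X n) then (1 : ℤ) else -1) with h | h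
  · exact exists_rank_of_sum_nonneg hP hL X τ hτ hX hshift (by convert h)
  · refine exists_rank_of_sum_nonneg hP.inv hL X τ hτ hX hshift ?_
    rw [← neg_nonneg, ← Finset.sum_neg_distrib] at h
    refine le_of_le_of_eq h (Finset.sum_congr rfl fun n _ => ?_)
    have h1 := hP.total _ _ (hX n)
    have h2 := hP.asymm (τ (n : ZMod L)) (X n)
    split_ifs <;> simp_all

end

section

variable {G : Type*} [Group G]

/-- Products of `n` conjugates of `u` and `u⁻¹`. -/
inductive ConjProd (u : G) : ℕ → G → Prop
  | one : ConjProd u 0 1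
  | mul (h x g : G) (n : ℕ) (hx : x = u ∨ x = u⁻¹) (hg : ConjProd u n g) :
      ConjProd u (n + 1) (h * x * h⁻¹ * g)

namespace ConjProd
variable {u : G}

theorem mul' {m n : ℕ} {a b : G} (ha : ConjProd u m a) (hb : ConjProd u n b) :
    ConjProd u (m + n) (a * b) := by
  induction ha with
  | one => simpa using hb
  | mul h x g k hx _ ih =>
    rw [show k + 1 + n = k + n + 1 by ring, mul_assoc _ g b]
    exact mul _ _ _ _ hx ih

theorem conj {n : ℕ} {a : G} (ha : ConjProd u n a) (g : G) : ConjProd u n (g * a * g⁻¹) := by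
  induction ha with
  | one => simpa using one
  | mul h x b k hx _ ih =>
    have := mul (g * h) x _ _ hx ih
    convert this using 1
    group

theorem conj' {n : ℕ} {a : G} (ha : ConjProd u n a) (g : G) : ConjProd u n (g⁻¹ * a * g) := by
  simpa using ha.conj g⁻¹

theorem exists_of_mem {x : G} (hx : x ∈ Subgroup.normalClosure {u}) : ∃ n, ConjProd u n x := by
  induction hx using Subgroup.closure_induction'' with
  | one => exact ⟨0, one⟩
  | mem x hx =>
    obtain ⟨y, hy, hc⟩ := Group.mem_conjugatesOfSet_iff.1 hx
    obtain rfl : y = u := hy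
    obtain ⟨g, rfl⟩ := isConj_iff.1 hc
    exact ⟨1, by simpa using mul g y 1 0 (Or.inl rfl) one⟩
  | inv_mem x hx =>
    obtain ⟨y, hy, hc⟩ := Group.mem_conjugatesOfSet_iff.1 hx
    obtain rfl : y = u := hy
    obtain ⟨g, rfl⟩ := isConj_iff.1 hc
    exact ⟨1, by simpa [mul_assoc] using mul g y⁻¹ 1 0 (Or.inr rfl) one⟩
  | mul x y _ _ hx hy =>
    obtain ⟨m, hm⟩ := hx
    obtain ⟨n, hn⟩ := hy
    exact ⟨_, hm.mul' hn⟩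

end ConjProd

section
variable {L : ℕ} (X : ZMod L → G)

/-- The product of `n` consecutive letters. -/
def seg (t : ZMod L) (n : ℕ) : G := ((List.range n).map fun r : ℕ => X (t + r)).prod

theorem seg_succ (t : ZMod L) (n : ℕ) : seg X t (n + 1) = seg X t n * X (t + n) := by
  simp [seg, List.range_succ]

theorem seg_succ' (t : ZMod L) (n : ℕ) : seg X t (n + 1) = X t * seg X (t + 1) n := by
  simp [seg, List.range_succ_eq_map, Function.comp_def, add_comm, add_left_comm]

/-- The cyclic conjugate of the relator starting at a position. -/
def rot (t : ZMod L) : G := seg X t L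

theorem rot_succ (t : ZMod L) : rot X (t + 1) = (X t)⁻¹ * rot X t * X t := by
  have h1 := seg_succ X t L
  have h2 := seg_succ' X t L
  simp only [CharP.cast_eq_zero, add_zero] at h1
  rw [h1] at h2
  simp [rot, mul_assoc, h2]

/-- The label of the cell of `c`, read from the end of `c`. -/
def Corner.lab (c : Corner L) : G := if c.1.2 then rot X c.outP else (rot X c.outP)⁻¹

theorem Corner.lab_nx (c : Corner L) :
    c.lab X = c.nx.val X * c.nx.lab X * (c.nx.val X)⁻¹ := by
  rcases c with ⟨⟨n, s⟩, t⟩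
  cases s
  · have := rot_succ X (t - 1)
    simp only [sub_add_cancel] at this
    simp [Corner.lab, Corner.val, Corner.nx, Corner.outP, this, mul_assoc]
  · simp [Corner.lab, Corner.val, Corner.nx, Corner.outP, rot_succ, mul_assoc]

theorem conjProd_rot [NeZero L] (t : ZMod L) : ∃ g, rot X t = g * rot X 0 * g⁻¹ := by
  induction t using natCast_induction with
  | h0 => exact ⟨1, by simp⟩
  | h t ih =>
    obtain ⟨g, hg⟩ := ih
    exact ⟨(X t)⁻¹ * g, by rw [rot_succ, hg]; group⟩

theorem Corner.conjProd_lab [NeZero L] (c : Corner L) : ConjProd (rot X 0) 1 (c.lab X) := by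
  obtain ⟨g, hg⟩ := conjProd_rot X c.outP
  unfold Corner.lab
  rw [hg]
  split_ifs
  · simpa using ConjProd.mul g _ 1 0 (Or.inl rfl) ConjProd.one
  · simpa [mul_assoc] using ConjProd.mul g _ 1 0 (Or.inr rfl) ConjProd.one

theorem Corner.lab_eq_inv {c d : Corner L} {τ : ZMod L → Bool} (h : c.outP = d.outP)
    (hτ : τ c.2 ≠ τ d.2) : c.1 ≠ d.1 ∧ c.lab X = (d.lab X)⁻¹ := by
  rcases c with ⟨⟨n, s⟩, t⟩
  rcases d with ⟨⟨n', s'⟩, t'⟩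
  cases s <;> cases s' <;> simp_all [Corner.outP, Corner.lab]

/-- Marked points `(a, c)` of the boundary of a diagram with `V` cells and boundary word `w`:
removing the cell of `c`, or the cells of two points, leaves fewer cells. -/
structure Inv (w : G) (Γ : List (G × Corner L)) (V : ℕ) : Prop where
  one : ∀ γ ∈ Γ, ∃ n p, n + 1 = V ∧ ConjProd (rot X 0) n p ∧
    w = γ.1 * γ.2.lab X * γ.1⁻¹ * p
  two : Γ.Pairwise fun γ γ' => γ.2.1 ≠ γ'.2.1 → ∃ n p, n + 2 = V ∧ ConjProd (rot X 0) n p ∧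
    w = γ'.1 * γ'.2.lab X * γ'.1⁻¹ * (γ.1 * γ.2.lab X * γ.1⁻¹) * p

variable {X}

theorem Inv.conjProd [NeZero L] {w : G} {Γ : List (G × Corner L)} {V : ℕ} (h : Inv X w Γ V)
    (hne : Γ ≠ []) : ConjProd (rot X 0) V w := by
  obtain ⟨γ, hγ⟩ := List.exists_mem_of_ne_nil _ hne
  obtain ⟨n, p, rfl, hp, rfl⟩ := h.one γ hγ
  rw [add_comm]
  exact ((γ.2.conjProd_lab X).conj γ.1).mul' hp

theorem Inv.sublist {w : G} {Γ Γ' : List (G × Corner L)} {V : ℕ} (h : Inv X w Γ V)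
    (hs : Γ'.Sublist Γ) : Inv X w Γ' V :=
  ⟨fun γ hγ => h.one γ (hs.subset hγ), h.two.sublist hs⟩

theorem Inv.rotate {w a : G} {c : Corner L} {Γ : List (G × Corner L)} {V : ℕ}
    (h : Inv X w ((a, c) :: Γ) V) :
    Inv X (a⁻¹ * w * a) (Γ.map (fun γ => (a⁻¹ * γ.1, γ.2)) ++ [(a⁻¹ * w * a, c)]) V where
  one γ hγ := by
    rw [List.mem_append, List.mem_map, List.mem_singleton] at hγ
    rcases hγ with ⟨γ, hγ, rfl⟩ | rfl
    · obtain ⟨n, p, hn, hp, rfl⟩ := h.one γ (by simp [hγ])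
      exact ⟨n, a⁻¹ * p * a, hn, hp.conj' a, by simp [mul_assoc]⟩
    · obtain ⟨n, p, hn, hp, hw⟩ := h.one (a, c) (by simp)
      refine ⟨n, _, hn, ((hp.conj' a).conj (c.lab X)), ?_⟩
      dsimp only at hw ⊢
      have : a⁻¹ * w * a = c.lab X * (a⁻¹ * p * a) := by rw [hw]; group
      rw [this]; group
  two := by
    have h2 := List.pairwise_cons.1 h.two
    refine List.pairwise_append.2 ⟨?_, List.pairwise_singleton _ _, ?_⟩
    · refine List.pairwise_map.2 (h2.2.imp fun {γ γ'} hγ hne => ?_)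
      obtain ⟨n, p, hn, hp, rfl⟩ := hγ hne
      exact ⟨n, _, hn, hp.conj' a, by group⟩
    · intro γ' hγ' γ'' hγ''
      obtain ⟨γ, hγ, rfl⟩ := List.mem_map.1 hγ'
      rw [List.mem_singleton] at hγ''
      subst hγ''
      intro hne
      obtain ⟨n, p, hn, hp, hw⟩ := h2.1 γ hγ (Ne.symm hne)
      refine ⟨n, _, hn, (hp.conj' a).conj (c.lab X), ?_⟩
      dsimp only at hw ⊢
      have : a⁻¹ * w * a = a⁻¹ * γ.1 * γ.2.lab X * γ.1⁻¹ * a * c.lab X * (a⁻¹ * p * a) := by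
        rw [hw]; group
      rw [this]; group

theorem Inv.mul [NeZero L] {w w' : G} {Γ Γ' : List (G × Corner L)} {V V' : ℕ} (h : Inv X w Γ V)
    (h' : Inv X w' Γ' V') (hne : Γ ≠ []) (hne' : Γ' ≠ []) :
    Inv X (w * w') (Γ ++ Γ'.map (fun γ => (w * γ.1, γ.2))) (V + V') where
  one γ hγ := by
    rw [List.mem_append, List.mem_map] at hγ
    rcases hγ with hγ | ⟨γ, hγ, rfl⟩
    · obtain ⟨n, p, rfl, hp, hw⟩ := h.one γ hγ
      exact ⟨_, _, by ring, hp.mul' (h'.conjProd hne'), by rw [← mul_assoc, ← hw]⟩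
    · obtain ⟨n, p, rfl, hp, hw'⟩ := h'.one γ hγ
      refine ⟨_, _, by ring, (h.conjProd hne).mul' hp, ?_⟩
      nth_rw 1 [hw']
      group
  two := by
    refine List.pairwise_append.2 ⟨?_, ?_, ?_⟩
    · refine h.two.imp fun {γ γ'} hγ hne => ?_
      obtain ⟨n, p, rfl, hp, hw⟩ := hγ hne
      exact ⟨_, _, by ring, hp.mul' (h'.conjProd hne'), by rw [← mul_assoc, ← hw]⟩
    · refine List.pairwise_map.2 (h'.two.imp fun {γ γ'} hγ hne => ?_)
      obtain ⟨n, p, rfl, hp, hw'⟩ := hγ hne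
      refine ⟨_, _, by ring, (h.conjProd ‹_›).mul' hp, ?_⟩
      nth_rw 1 [hw']
      group
    · intro γ hγ γ'' hγ'' _
      obtain ⟨γ', hγ', rfl⟩ := List.mem_map.1 hγ''
      obtain ⟨n, p, rfl, hp, hw⟩ := h.one γ hγ
      obtain ⟨n', p', rfl, hp', hw'⟩ := h'.one γ' hγ'
      refine ⟨_, _, by ring, hp.mul' hp', ?_⟩
      have e : w * w' = w * (γ'.1 * γ'.2.lab X * γ'.1⁻¹) * w⁻¹ * w * p' := by
        nth_rw 1 [hw']; group
      rw [e]
      nth_rw 3 [hw]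
      group

end

end

section

variable {G : Type*} [Group G]

/-- A nonempty list of corners, given by its initial part and its last element. -/
abbrev Face (L : ℕ) := List (Corner L) × Corner L

namespace Face
variable {L : ℕ}

/-- The corners of a face. -/
def cs (f : Face L) : List (Corner L) := f.1 ++ [f.2]

/-- Concatenation of faces. -/
def app (f g : Face L) : Face L := (f.cs ++ g.1, g.2)

/-- The label of a face. -/
def val (X : ZMod L → G) (f : Face L) : G := (f.cs.map (Corner.val X)).prod

/-- The face starts with the corner `c`. -/
def Starts (c : Corner L) (f : Face L) : Prop := f.cs.head? = some c

@[simp] theorem cs_app (f g : Face L) : (f.app g).cs = f.cs ++ g.cs := by simp [app, cs]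
@[simp] theorem app_snd (f g : Face L) : (f.app g).2 = g.2 := rfl

@[simp] theorem val_app (X : ZMod L → G) (f g : Face L) :
    (f.app g).val X = f.val X * g.val X := by simp [val]

theorem cs_ne_nil (f : Face L) : f.cs ≠ [] := by simp [cs]
@[simp] theorem snd_mem_cs (f : Face L) : f.2 ∈ f.cs := by simp [cs]
@[simp] theorem getLast?_cs (f : Face L) : f.cs.getLast? = some f.2 := by simp [cs]

theorem Starts.app {c : Corner L} {f : Face L} (h : f.Starts c) (g : Face L) :
    (f.app g).Starts c := by
  rw [Starts, cs_app, List.head?_append_of_ne_nil _ f.cs_ne_nil]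
  exact h

end Face

section
variable {L : ℕ}

/-- The last corner of the last face, starting the list with the corner `c`. -/
def endOf : Corner L → List (Face L) → Corner L
  | c, [] => c
  | _, f :: l => endOf f.2 l

/-- Every face starts with the corner following the last corner of the previous face. -/
def Link : Corner L → List (Face L) → Prop
  | _, [] => True
  | c, f :: l => f.Starts c.nx ∧ Link f.2 l

@[simp] theorem endOf_append (c : Corner L) (l l' : List (Face L)) :
    endOf c (l ++ l') = endOf (endOf c l) l' := by
  induction l generalizing c with
  | nil => rfl
  | cons f l ih => exact ih _

@[simp] theorem link_append (c : Corner L) (l l' : List (Face L)) :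
    Link c (l ++ l') ↔ Link c l ∧ Link (endOf c l) l' := by
  induction l generalizing c with
  | nil => simp [Link, endOf]
  | cons f l ih => simp [Link, endOf, ih, and_assoc]

/-- The end points of the faces of a boundary word starting at `a`. -/
def gaps (X : ZMod L → G) : G → List (Face L) → List (G × Corner L)
  | _, [] => []
  | a, f :: l => (a * f.val X, f.2) :: gaps X (a * f.val X) l

/-- The label of a list of faces. -/
def word (X : ZMod L → G) (B : List (Face L)) : G := (B.map (Face.val X)).prod

variable (X : ZMod L → G)

@[simp] theorem word_nil : word X [] = 1 := rfl
@[simp] theorem word_cons (f : Face L) (l : List (Face L)) :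
    word X (f :: l) = f.val X * word X l := by simp [word]
@[simp] theorem word_append (l l' : List (Face L)) :
    word X (l ++ l') = word X l * word X l' := by simp [word]

theorem gaps_append (a : G) (l l' : List (Face L)) :
    gaps X a (l ++ l') = gaps X a l ++ gaps X (a * word X l) l' := by
  induction l generalizing a with
  | nil => simp [gaps]
  | cons f l ih => simp [gaps, ih, mul_assoc]

theorem gaps_mul (b a : G) (l : List (Face L)) :
    gaps X (b * a) l = (gaps X a l).map fun γ => (b * γ.1, γ.2) := by
  induction l generalizing a with
  | nil => simp [gaps]
  | cons f l ih => simp [gaps, ← ih, mul_assoc]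

/-- All corners of a list of faces. -/
def flat (B : List (Face L)) : List (Corner L) := B.flatMap Face.cs

@[simp] theorem flat_nil : flat ([] : List (Face L)) = [] := rfl
@[simp] theorem flat_cons (f : Face L) (l : List (Face L)) : flat (f :: l) = f.cs ++ flat l := by
  simp [flat]
@[simp] theorem flat_append (l l' : List (Face L)) : flat (l ++ l') = flat l ++ flat l' := by
  simp [flat]

/-- The relator `X 0, X 1, …` alternates and its positions are ordered with the top property. -/
structure Relator (H : Bool → Subgroup G) {L : ℕ} (X : ZMod L → G) (τ : ZMod L → Bool)
    (rank : ZMod L → ℕ) : Prop where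
  even : Even L
  alt : ∀ t, τ (t + 1) = !τ t
  letter : ∀ t, Letter H (τ t) (X t)
  inj : Function.Injective rank
  top : TopProperty X τ rank

/-- Diagrams with boundary faces `B` and cells `C`; matched ends of corners are in `Top` or `Bot`
and the corners in `NB` lie in the interior between two ends from `Top`. -/
structure Diagram {L : ℕ} (X : ZMod L → G) (τ : ZMod L → Bool) (rank : ZMod L → ℕ) (N : ℕ)
    (C : Finset (ℕ × Bool)) (Top Bot NB : Finset (Corner L)) (i : Bool) (B : List (Face L)) :
    Prop where
  even : B.length.bodd = false
  ids : ∀ c ∈ C, N ≤ c.1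
  alt : Alt (fun i f => ∀ c ∈ Face.cs f, τ c.2 = i) i B
  link : ∀ e, Link (endOf e B) B
  step : ∀ f ∈ B, f.cs.IsChain (Step rank (· ∈ Top) (·.pv ∈ Top))
  nodup : (flat B).Nodup
  cells : ∀ c ∈ flat B, c.1 ∈ C
  top : ∀ c ∈ Top, c.1 ∈ C ∧ ∃ t, rank t < rank c.outP
  bot : ∀ c ∈ Bot, ∃ t, rank c.outP < rank t
  cover : ∀ c : Corner L, c.1 ∈ C → c ∈ Top ∨ c ∈ Bot ∨ ∃ f ∈ B, f.2 = c
  nb : ∀ c ∈ NB, c ∈ Top ∧ c.pv ∈ Top ∧ c ∉ flat B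
  count : Top.card + 1 ≤ NB.card + C.card
  inv : Inv X (word X B) (gaps X 1 B) C.card

variable {X} {τ : ZMod L → Bool} {rank : ZMod L → ℕ}

theorem Step.mono {T T' : Finset (Corner L)} (h : T ⊆ T') {c d : Corner L}
    (hs : Step rank (· ∈ T) (·.pv ∈ T) c d) : Step rank (· ∈ T') (·.pv ∈ T') c d :=
  hs.imp (And.imp_right fun x => h x) (And.imp_right fun x => h x)

theorem match_ends (Top Bot : Finset (Corner L)) (c d : Corner L)
    (h : rank c.outP ≠ rank d.outP) : ∃ Top' Bot' : Finset (Corner L), Top ⊆ Top' ∧ Bot ⊆ Bot' ∧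
      Top'.card ≤ Top.card + 1 ∧ (c ∈ Top' ∨ c ∈ Bot') ∧ (d ∈ Top' ∨ d ∈ Bot') ∧
      Step rank (· ∈ Top') (·.pv ∈ Top') c d.nx ∧ Step rank (· ∈ Top') (·.pv ∈ Top') d c.nx ∧
      (∀ x ∈ Top', x ∈ Top ∨ ((x = c ∨ x = d) ∧ ∃ t, rank t < rank x.outP)) ∧
      (∀ x ∈ Bot', x ∈ Bot ∨ ∃ t, rank x.outP < rank t) := by
  classical
  rcases h.lt_or_gt with h | h
  · refine ⟨insert d Top, insert c Bot, Finset.subset_insert _ _, Finset.subset_insert _ _,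
      Finset.card_insert_le _ _, by simp, by simp, ?_, ?_, ?_, ?_⟩
    · exact Or.inr ⟨by simpa using h, by simp⟩
    · exact Or.inl ⟨by simpa using h, by simp⟩
    · intro x hx
      rcases Finset.mem_insert.1 hx with rfl | hx
      · exact Or.inr ⟨Or.inr rfl, _, h⟩
      · exact Or.inl hx
    · intro x hx
      rcases Finset.mem_insert.1 hx with rfl | hx
      · exact Or.inr ⟨_, h⟩
      · exact Or.inl hx
  · refine ⟨insert c Top, insert d Bot, Finset.subset_insert _ _, Finset.subset_insert _ _,
      Finset.card_insert_le _ _, by simp, by simp, ?_, ?_, ?_, ?_⟩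
    · exact Or.inl ⟨by simpa using h, by simp⟩
    · exact Or.inr ⟨by simpa using h, by simp⟩
    · intro x hx
      rcases Finset.mem_insert.1 hx with rfl | hx
      · exact Or.inr ⟨Or.inl rfl, _, h⟩
      · exact Or.inl hx
    · intro x hx
      rcases Finset.mem_insert.1 hx with rfl | hx
      · exact Or.inr ⟨_, h⟩
      · exact Or.inl hx

/-- A diagram cannot be closed up to a sphere. -/
theorem false_of_closed [NeZero L] {C : Finset (ℕ × Bool)} {Top Bot NB : Finset (Corner L)}
    (top : ∀ c ∈ Top, ∃ t, rank t < rank c.outP) (bot : ∀ c ∈ Bot, ∃ t, rank c.outP < rank t)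
    (cover : ∀ c : Corner L, c.1 ∈ C → c ∈ Top ∨ c ∈ Bot)
    (nb : ∀ c ∈ NB, c ∈ Top ∧ c.pv ∈ Top) (count : Top.card + 1 ≤ NB.card + C.card) : False := by
  classical
  have key : ∀ x ∈ C, ∃ c : Corner L, c.1 = x ∧ c ∈ Top ∧ c.pv ∉ Top := by
    intro x hx
    by_contra! hcon
    obtain ⟨tM, -, hM⟩ := Finset.exists_max_image Finset.univ rank ⟨0, Finset.mem_univ _⟩
    obtain ⟨tm, -, hm⟩ := Finset.exists_min_image Finset.univ rank ⟨0, Finset.mem_univ _⟩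
    rcases x with ⟨n, s⟩
    let a : ZMod L → Corner L := fun t => ((n, s), if s then t - 1 else t)
    have ha : ∀ t, (a t).outP = t := by intro t; cases s <;> simp [a, Corner.outP]
    have h0 : a tM ∈ Top := by
      refine (cover (a tM) hx).resolve_right fun h => ?_
      obtain ⟨t, ht⟩ := bot _ h
      rw [ha] at ht
      exact absurd (hM t (Finset.mem_univ _)) (not_le.2 ht)
    have hall : ∀ r : ZMod L, a (if s then tM - r else tM + r) ∈ Top := by
      intro r
      induction r using natCast_induction with
      | h0 => simpa using h0
      | h r ih =>
        have := hcon _ rfl ih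
        convert this using 1
        cases s <;> simp [a, Corner.pv] <;> ring
    have : a tm ∈ Top := by
      have := hall (if s then tM - tm else tm - tM)
      cases s <;> simpa using this
    obtain ⟨t, ht⟩ := top _ this
    rw [ha] at ht
    exact absurd (hm t (Finset.mem_univ _)) (not_le.2 ht)
  choose! c hc1 hc2 hc3 using key
  have h1 : C.card ≤ (Top \ NB).card := by
    refine Finset.card_le_card_of_injOn c ?_ ?_
    · intro x hx
      simp only [Finset.coe_sdiff, Set.mem_sdiff, Finset.mem_coe]
      exact ⟨hc2 x hx, fun h => hc3 x hx (nb _ h).2⟩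
    · intro x hx y hy hxy
      rw [← hc1 x hx, ← hc1 y hy]
      exact congrArg Prod.fst hxy
  have h2 : (Top \ NB).card + NB.card = Top.card :=
    Finset.card_sdiff_add_card_eq_card fun c hc => (nb c hc).1
  omega

namespace Diagram
variable {N : ℕ} {C : Finset (ℕ × Bool)} {Top Bot NB : Finset (Corner L)} {i : Bool}

theorem rotate {f : Face L} {B : List (Face L)}
    (h : Diagram X τ rank N C Top Bot NB i (f :: B)) :
    Diagram X τ rank N C Top Bot NB (!i) (B ++ [f]) where
  even := by simpa using h.even
  ids := h.ids
  alt := by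
    have h1 := h.alt
    have h2 := h.even
    have hb : B.length.bodd = true := by simpa using h2
    have e : ((!i) ^^ true) = i := by cases i <;> rfl
    rw [alt_append, hb, e]
    exact ⟨h1.2, h1.1, trivial⟩
  link e := by
    have := h.link e
    simp only [Link, endOf] at this
    simp [Link, endOf, this]
  step g hg := h.step g (by simpa [or_comm] using hg)
  nodup := by
    have := h.nodup
    simp only [flat_cons, flat_append, flat_nil, List.append_nil] at this ⊢
    exact List.perm_append_comm.nodup_iff.1 this
  cells c hc := h.cells c (by simpa [or_comm] using hc)
  top := h.top
  bot := h.bot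
  cover c hc := by
    have := h.cover c hc
    simpa [or_comm] using this
  nb c hc := by
    have := h.nb c hc
    simpa [and_comm] using this
  count := h.count
  inv := by
    have := h.inv
    simp only [gaps, one_mul] at this
    have := this.rotate
    rw [← gaps_mul] at this
    simpa [gaps_append, gaps, mul_assoc] using this

theorem conjProd [NeZero L] {B : List (Face L)} (h : Diagram X τ rank N C Top Bot NB i B)
    (hB : B ≠ []) : ConjProd (rot X 0) C.card (word X B) := by
  apply h.inv.conjProd
  cases B <;> simp_all [gaps]

end Diagram

end

end

section

variable {G : Type*} [Group G]
section
variable {L : ℕ} {X : ZMod L → G} {τ : ZMod L → Bool} {rank : ZMod L → ℕ}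
  {H : Bool → Subgroup G} {N N' : ℕ} {C C' : Finset (ℕ × Bool)}
  {Top Bot NB Top' Bot' NB' : Finset (Corner L)} {i : Bool}

theorem Step.chain_mono {T T' : Finset (Corner L)} (h : T ⊆ T') {l : List (Corner L)}
    (hs : l.IsChain (Step rank (· ∈ T) (·.pv ∈ T))) :
    l.IsChain (Step rank (· ∈ T') (·.pv ∈ T')) :=
  hs.imp fun _ _ => Step.mono h

theorem Face.chain_app {T : Finset (Corner L)} {f g : Face L} {c : Corner L}
    (hf : f.cs.IsChain (Step rank (· ∈ T) (·.pv ∈ T)))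
    (hg : g.cs.IsChain (Step rank (· ∈ T) (·.pv ∈ T))) (hs : g.Starts c)
    (h : Step rank (· ∈ T) (·.pv ∈ T) f.2 c) :
    (f.app g).cs.IsChain (Step rank (· ∈ T) (·.pv ∈ T)) := by
  rw [Face.cs_app, List.isChain_append]
  refine ⟨hf, hg, ?_⟩
  intro x hx y hy
  rw [Face.getLast?_cs] at hx
  rw [Face.Starts] at hs
  rw [hs] at hy
  simp only [Option.mem_def, Option.some.injEq] at hx hy
  rwa [← hx, ← hy]

theorem eq_mul_of_eq_conj_mul {w l q : G} (h : w = w * l * w⁻¹ * q) : w = q * l := by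
  have : l * (w⁻¹ * q) = 1 := mul_left_cancel (a := w) (by simpa [mul_assoc] using h.symm)
  rw [← mul_right_inj w⁻¹, ← mul_assoc, eq_inv_of_mul_eq_one_right this]
  simp

namespace Diagram
variable [NeZero L]

/-- Gluing two diagrams along the ends at their base points. -/
theorem glue (hR : Relator H X τ rank) {f p f' p' : Face L} {M M' : List (Face L)}
    (h : Diagram X τ rank N C Top Bot NB i (f :: M ++ [p]))
    (h' : Diagram X τ rank N' C' Top' Bot' NB' (!i) (f' :: M' ++ [p']))
    (hN : N ≤ N') (hC : Disjoint C C') :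
    (∃ n, n + 2 = C.card + C'.card ∧
      ConjProd (rot X 0) n (word X (f :: M ++ [p]) * word X (f' :: M' ++ [p']))) ∨
    ∃ (C₀ : Finset (ℕ × Bool)) (Top₀ Bot₀ NB₀ : Finset (Corner L)), C₀.card = C.card + C'.card ∧
      Diagram X τ rank N C₀ Top₀ Bot₀ NB₀ (!i) (M ++ p.app f' :: M' ++ [p'.app f]) := by
  classical
  have hMe : M.length.bodd = false := by simpa using h.even
  have hMe' : M'.length.bodd = false := by simpa using h'.even
  have halt := h.alt
  have halt' := h'.alt
  rw [alt_append, alt_cons, alt_cons] at halt halt'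
  simp only [List.length_cons, Nat.bodd_succ, hMe, hMe', Bool.not_false, Bool.xor_true,
    Bool.not_not] at halt halt'
  have hty : τ p.2.2 ≠ τ p'.2.2 := by
    rw [halt.2.1 _ p.snd_mem_cs, halt'.2.1 _ p'.snd_mem_cs]
    cases i <;> simp
  have hinv := h.inv
  have hinv' := h'.inv
  rw [gaps_append] at hinv hinv'
  by_cases hr : rank p.2.outP = rank p'.2.outP
  · left
    obtain ⟨-, hlab⟩ := Corner.lab_eq_inv X (hR.inj hr) hty
    obtain ⟨n, q, hn, hq, hw⟩ := hinv.one _ (List.mem_append_right _ (by simp [gaps]; rfl))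
    obtain ⟨n', q', hn', hq', hw'⟩ := hinv'.one _ (List.mem_append_right _ (by simp [gaps]; rfl))
    refine ⟨n + n', by omega, ?_⟩
    have e1 : word X (f :: M ++ [p]) = q * p.2.lab X := by
      simp only [word_append, word_cons, word_nil, mul_one, List.cons_append] at hw ⊢
      exact eq_mul_of_eq_conj_mul (by simpa only [mul_assoc] using hw)
    have e2 : word X (f' :: M' ++ [p']) = q' * p'.2.lab X := by
      simp only [word_append, word_cons, word_nil, mul_one, List.cons_append] at hw' ⊢
      exact eq_mul_of_eq_conj_mul (by simpa only [mul_assoc] using hw')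
    rw [e1, e2, hlab]
    have := hq.mul' (hq'.conj (p'.2.lab X)⁻¹)
    simpa [mul_assoc] using this
  · right
    obtain ⟨T, Bt, hT, hB, hTc, hc, hd, hs1, hs2, hTm, hBm⟩ :=
      match_ends (Top ∪ Top') (Bot ∪ Bot') _ _ hr
    have hT1 : Top ⊆ T := Finset.subset_union_left.trans hT
    have hT2 : Top' ⊆ T := Finset.subset_union_right.trans hT
    have hB1 : Bot ⊆ Bt := Finset.subset_union_left.trans hB
    have hB2 : Bot' ⊆ Bt := Finset.subset_union_right.trans hB
    have hl := h.link p.2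
    have hl' := h'.link p.2
    simp only [List.cons_append, endOf, endOf_append, Link, link_append] at hl hl'
    have hperm : (flat (M ++ p.app f' :: M' ++ [p'.app f])).Perm
        (flat (f :: M ++ [p]) ++ flat (f' :: M' ++ [p'])) := by
      simp only [flat_append, flat_cons, flat_nil, Face.cs_app, List.append_nil, List.append_assoc]
      refine (List.perm_append_comm (l₁ := f.cs)).trans ?_ |>.symm
      simp only [List.append_assoc]
      exact List.Perm.refl _
    have hcells : ∀ x ∈ flat (f :: M ++ [p]), x.1 ∈ C := h.cells
    have hcells' : ∀ x ∈ flat (f' :: M' ++ [p']), x.1 ∈ C' := h'.cells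
    have hdisj : ∀ x : ℕ × Bool, x ∈ C → x ∈ C' → False := fun x h1 h2 =>
      Finset.disjoint_left.1 hC h1 h2
    refine ⟨C ∪ C', T, Bt, NB ∪ NB', Finset.card_union_of_disjoint hC,
      { even := ?_, ids := ?_, alt := ?_, link := ?_, step := ?_, nodup := ?_, cells := ?_,
        top := ?_, bot := ?_, cover := ?_, nb := ?_, count := ?_, inv := ?_ }⟩
    · simp [hMe, hMe']
    · intro c hc
      rcases Finset.mem_union.1 hc with hc | hc
      · exact h.ids c hc
      · exact hN.trans (h'.ids c hc)
    · rw [alt_append, alt_append, alt_cons]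
      simp only [List.length_append, List.length_cons, Nat.bodd_succ, Nat.bodd_add, hMe, hMe',
        Bool.xor_false, Bool.not_false, Bool.not_not, Bool.xor_true]
      refine ⟨⟨halt.1.2, ?_, by simpa using halt'.1.2⟩, ?_, trivial⟩
      · intro c hc
        rw [Face.cs_app, List.mem_append] at hc
        exact hc.elim (halt.2.1 c) (halt'.1.1 c)
      · intro c hc
        rw [Face.cs_app, List.mem_append] at hc
        exact hc.elim (by simpa using halt'.2.1 c) (halt.1.1 c)
    · intro e
      simp only [endOf, endOf_append, Link, link_append, Face.app_snd]
      exact ⟨⟨hl.2.1, hl.2.2.1.app _, hl'.2.1⟩, hl'.2.2.1.app _, trivial⟩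
    · intro g hg
      have hp := Step.chain_mono hT1 (h.step p (by simp))
      have hf := Step.chain_mono hT1 (h.step f (by simp))
      have hp' := Step.chain_mono hT2 (h'.step p' (by simp))
      have hf' := Step.chain_mono hT2 (h'.step f' (by simp))
      simp only [List.mem_append, List.mem_cons, List.not_mem_nil, or_false] at hg
      rcases hg with (hg | rfl | hg) | rfl
      · exact Step.chain_mono hT1 (h.step g (by simp [hg]))
      · exact Face.chain_app hp hf' hl'.1 hs1
      · exact Step.chain_mono hT2 (h'.step g (by simp [hg]))
      · exact Face.chain_app hp' hf hl.1 hs2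
    · refine hperm.nodup_iff.2 (List.nodup_append'.2 ⟨h.nodup, h'.nodup, ?_⟩)
      intro x hx hx'
      exact hdisj _ (hcells x hx) (hcells' x hx')
    · intro c hc
      rw [hperm.mem_iff, List.mem_append] at hc
      exact Finset.mem_union.2 (hc.imp (hcells c) (hcells' c))
    · intro x hx
      rcases hTm x hx with hx | ⟨rfl | rfl, ht⟩
      · rcases Finset.mem_union.1 hx with hx | hx
        · exact ⟨Finset.mem_union_left _ (h.top x hx).1, (h.top x hx).2⟩
        · exact ⟨Finset.mem_union_right _ (h'.top x hx).1, (h'.top x hx).2⟩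
      · exact ⟨Finset.mem_union_left _ (hcells _ (by simp [flat])), ht⟩
      · exact ⟨Finset.mem_union_right _ (hcells' _ (by simp [flat])), ht⟩
    · intro x hx
      rcases hBm x hx with hx | ht
      · exact (Finset.mem_union.1 hx).elim (h.bot x) (h'.bot x)
      · exact ht
    · intro x hx
      rcases Finset.mem_union.1 hx with hx | hx
      · rcases h.cover x hx with hx | hx | ⟨g, hg, rfl⟩
        · exact Or.inl (hT1 hx)
        · exact Or.inr (Or.inl (hB1 hx))
        · simp only [List.mem_append, List.mem_cons, List.not_mem_nil, or_false] at hg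
          rcases hg with (rfl | hg) | rfl
          · exact Or.inr (Or.inr ⟨p'.app g, by simp, rfl⟩)
          · exact Or.inr (Or.inr ⟨g, by simp [hg], rfl⟩)
          · exact hc.imp id Or.inl
      · rcases h'.cover x hx with hx | hx | ⟨g, hg, rfl⟩
        · exact Or.inl (hT2 hx)
        · exact Or.inr (Or.inl (hB2 hx))
        · simp only [List.mem_append, List.mem_cons, List.not_mem_nil, or_false] at hg
          rcases hg with (rfl | hg) | rfl
          · exact Or.inr (Or.inr ⟨p.app g, by simp, rfl⟩)
          · exact Or.inr (Or.inr ⟨g, by simp [hg], rfl⟩)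
          · exact hd.imp id Or.inl
    · intro x hx
      rw [hperm.mem_iff, List.mem_append]
      rcases Finset.mem_union.1 hx with hx | hx
      · obtain ⟨h1, h2, h3⟩ := h.nb x hx
        refine ⟨hT1 h1, hT1 h2, ?_⟩
        rintro (h4 | h4)
        · exact h3 h4
        · exact hdisj _ (h.top x h1).1 (hcells' _ h4)
      · obtain ⟨h1, h2, h3⟩ := h'.nb x hx
        refine ⟨hT2 h1, hT2 h2, ?_⟩
        rintro (h4 | h4)
        · exact hdisj _ (hcells _ h4) (h'.top x h1).1
        · exact h3 h4
    · have hd1 : Disjoint NB NB' := Finset.disjoint_left.2 fun x h1 h2 =>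
        hdisj _ (h.top x (h.nb x h1).1).1 (h'.top x (h'.nb x h2).1).1
      rw [Finset.card_union_of_disjoint hC, Finset.card_union_of_disjoint hd1]
      have := Finset.card_union_le Top Top'
      have h1 := h.count
      have h2 := h'.count
      omega
    · rw [Finset.card_union_of_disjoint hC]
      have h1 := hinv.sublist (List.sublist_append_left _ _)
      have h2 := hinv'.sublist (List.sublist_append_left _ _)
      have h3 := h1.mul h2 (by simp [gaps]) (by simp [gaps])
      simp only [gaps, one_mul, List.cons_append] at h3
      have h4 := h3.rotate
      convert h4 using 1
      · simp [mul_assoc]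
      · have e := gaps_mul X (f.val X) 1 M
        rw [mul_one] at e
        simp [gaps_append, gaps, gaps_mul, mul_assoc, e, Function.comp_def]

/-- Gluing the two ends of a boundary face with trivial label. -/
theorem close (hR : Relator H X τ rank) {f : Face L} {B : List (Face L)}
    (h : Diagram X τ rank N C Top Bot NB i (f :: B)) (hf : f.val X = 1) :
    (∃ n, n + 2 = C.card ∧ ConjProd (rot X 0) n (word X (f :: B))) ∨
    ∃ (Top₀ Bot₀ NB₀ : Finset (Corner L)) (B₀ : List (Face L)) (g : G), B₀ ≠ [] ∧
      B₀.length < (f :: B).length ∧ word X B₀ = g⁻¹ * word X (f :: B) * g ∧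
      Diagram X τ rank N C Top₀ Bot₀ NB₀ i B₀ := by
  classical
  have hBe : B.length.bodd = true := by simpa using h.even
  obtain ⟨R, p, rfl⟩ : ∃ R p, B = R ++ [p] := by
    rcases List.eq_nil_or_concat B with rfl | ⟨R, p, rfl⟩
    · simp at hBe
    · exact ⟨R, p, by simp⟩
  have hRe : R.length.bodd = false := by simpa using hBe
  have halt := h.alt
  rw [alt_cons, alt_append, hRe] at halt
  have hty : τ p.2.2 ≠ τ f.2.2 := by
    rw [halt.1 _ f.snd_mem_cs, halt.2.2.1 _ p.snd_mem_cs]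
    cases i <;> simp
  have hinv := h.inv
  by_cases hr : rank p.2.outP = rank f.2.outP
  · left
    obtain ⟨hne, hlab⟩ := Corner.lab_eq_inv X (hR.inj hr) hty
    have := hinv.two
    simp only [gaps, List.pairwise_cons] at this
    obtain ⟨n, q, hn, hq, hw⟩ := this.1 (word X (f :: R ++ [p]), p.2)
      (by simp [gaps_append, gaps, mul_assoc]) (Ne.symm hne)
    refine ⟨n, hn, ?_⟩
    rw [hf, hlab] at hw
    have hw' : word X (f :: R ++ [p]) = f.2.lab X * q * (f.2.lab X)⁻¹ := by
      rw [mul_assoc]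
      have e := eq_mul_of_eq_conj_mul (w := word X (f :: R ++ [p])) (l := (f.2.lab X)⁻¹)
        (q := f.2.lab X * q) (by simpa [mul_assoc] using hw)
      simpa [mul_assoc] using e
    rw [← List.cons_append, hw']
    exact hq.conj _
  · right
    obtain ⟨T, Bt, hT, hB, hTc, hc, hd, hs1, hs2, hTm, hBm⟩ := match_ends Top Bot _ _ hr
    have hl := h.link p.2
    simp only [endOf, endOf_append, Link, link_append] at hl
    obtain ⟨e, es, hes⟩ : ∃ e es, f.cs = e :: es := List.exists_cons_of_ne_nil f.cs_ne_nil
    have he : e = p.2.nx := by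
      have := hl.1
      rw [Face.Starts, hes] at this
      simpa using this
    have hchain := Step.chain_mono hT (h.step f (by simp))
    obtain ⟨x, hxf, hx1, hx2⟩ := hR.top i (· ∈ T) (·.pv ∈ T) e es (by rw [← hes]; exact halt.1)
      (by
        rw [← hes, List.isChain_append]
        refine ⟨hchain, by simp, ?_⟩
        intro a ha b hb
        rw [Face.getLast?_cs] at ha
        simp only [Option.mem_def, Option.some.injEq, List.head?_cons] at ha hb
        rw [← ha, ← hb, he]
        exact hs2) (by rw [← hes]; exact hf)
    rw [← hes] at hxf
    have hxNB : x ∉ NB := fun hx => (h.nb x hx).2.2 (by simp [hxf])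
    have hnd := h.nodup
    rw [flat_cons, List.nodup_append'] at hnd
    have top : ∀ c ∈ T, c.1 ∈ C ∧ ∃ t, rank t < rank c.outP := by
      intro c hc
      rcases hTm c hc with hc | ⟨rfl | rfl, ht⟩
      · exact h.top c hc
      · exact ⟨h.cells _ (by simp [flat]), ht⟩
      · exact ⟨h.cells _ (by simp [flat]), ht⟩
    have bot : ∀ c ∈ Bt, ∃ t, rank c.outP < rank t := fun c hc => (hBm c hc).elim (h.bot c) id
    have nb : ∀ c ∈ insert x NB, c ∈ T ∧ c.pv ∈ T ∧ c ∉ flat (R ++ [p]) := by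
      intro c hc
      rcases Finset.mem_insert.1 hc with rfl | hc
      · exact ⟨hx1, hx2, fun h => hnd.2.2 hxf h⟩
      · obtain ⟨h1, h2, h3⟩ := h.nb c hc
        exact ⟨hT h1, hT h2, fun h => h3 (by rw [flat_cons]; exact List.mem_append_right _ h)⟩
    have count : T.card + 1 ≤ (insert x NB).card + C.card := by
      rw [Finset.card_insert_of_notMem hxNB]
      have := h.count
      omega
    rcases R with _ | ⟨g, M⟩
    · refine (false_of_closed (fun c hc => (top c hc).2) bot ?_
        (fun c hc => ⟨(nb c hc).1, (nb c hc).2.1⟩) count).elim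
      intro c hcC
      rcases h.cover c hcC with h1 | h1 | ⟨g, hg, rfl⟩
      · exact Or.inl (hT h1)
      · exact Or.inr (hB h1)
      · simp only [List.nil_append, List.mem_cons, List.not_mem_nil, or_false] at hg
        rcases hg with rfl | rfl
        · exact hd
        · exact hc
    · have hMo : M.length.bodd = true := by simpa using hRe
      have hperm : (flat (M ++ [p.app g])).Perm (flat (g :: M ++ [p])) := by
        simp only [flat_append, flat_cons, flat_nil, Face.cs_app, List.append_nil,
          List.append_assoc]
        refine (List.perm_append_comm (l₁ := g.cs)).trans ?_ |>.symm
        simp only [List.append_assoc]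
        exact List.Perm.refl _
      simp only [endOf, Link] at hl
      have hal := halt.2
      rw [alt_cons] at hal
      refine ⟨T, Bt,
        insert x NB, M ++ [p.app g], g.val X, by simp, by simp, by simp [hf, mul_assoc],
        { even := ?_, ids := h.ids, alt := ?_, link := ?_, step := ?_, nodup := ?_, cells := ?_,
          top := top, bot := bot, cover := ?_, nb := ?_, count := count, inv := ?_ }⟩
      · simp [hMo]
      · rw [alt_append, hMo]
        refine ⟨by simpa using hal.1.2, ?_, trivial⟩
        intro c hc
        rw [Face.cs_app, List.mem_append] at hc
        have := hc.elim (by simpa using hal.2.1 c) (hal.1.1 c)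
        simpa using this
      · intro e
        simp only [endOf, endOf_append, Link, link_append, Face.app_snd]
        exact ⟨hl.2.1.2, hl.2.2.1.app _, trivial⟩
      · intro k hk
        simp only [List.mem_append, List.mem_cons, List.not_mem_nil, or_false] at hk
        rcases hk with hk | rfl
        · exact Step.chain_mono hT (h.step k (by simp [hk]))
        · exact Face.chain_app (Step.chain_mono hT (h.step p (by simp)))
            (Step.chain_mono hT (h.step g (by simp))) hl.2.1.1 hs1
      · exact hperm.nodup_iff.2 hnd.2.1
      · intro c hc
        rw [hperm.mem_iff] at hc
        exact h.cells c (by rw [flat_cons]; exact List.mem_append_right _ hc)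
      · intro c hcC
        rcases h.cover c hcC with h1 | h1 | ⟨k, hk, rfl⟩
        · exact Or.inl (hT h1)
        · exact Or.inr (Or.inl (hB h1))
        · simp only [List.mem_append, List.mem_cons, List.not_mem_nil, or_false] at hk
          rcases hk with rfl | (rfl | hk) | rfl
          · exact hd.imp id Or.inl
          · exact Or.inr (Or.inr ⟨p.app k, by simp, rfl⟩)
          · exact Or.inr (Or.inr ⟨k, by simp [hk], rfl⟩)
          · exact hc.imp id Or.inl
      · intro c hc
        rw [hperm.mem_iff]
        exact nb c hc
      · have h1 := h.rotate.rotate (f := g) (B := M ++ [p] ++ [f])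
        have h2 := h1.inv
        have e : word X (M ++ [p.app g]) = word X (M ++ [p] ++ [f] ++ [g]) := by
          simp [hf]
        rw [e]
        refine h2.sublist ?_
        simp only [gaps_append, gaps, Face.val_app, hf, mul_one,
          Face.app_snd, List.append_assoc, mul_assoc, List.cons_append, List.nil_append, one_mul]
        refine List.Sublist.append_left ?_ _
        exact ((List.Sublist.refl _).cons _).cons _

end Diagram
end

end

section

variable {G : Type*} [Group G]
section
variable {L : ℕ} (X : ZMod L → G) {τ : ZMod L → Bool} {rank : ZMod L → ℕ}
  {H : Bool → Subgroup G} {N : ℕ} {C : Finset (ℕ × Bool)}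
  {Top Bot NB : Finset (Corner L)} {i : Bool}

/-- The one-corner faces following the corner `e` around its cell. -/
def orbit : Corner L → ℕ → List (Face L)
  | _, 0 => []
  | e, n + 1 => ([], e.nx) :: orbit e.nx n

theorem length_orbit (e : Corner L) (n : ℕ) : (orbit e n).length = n := by
  induction n generalizing e with
  | zero => rfl
  | succ n ih => simp [orbit, ih]

theorem endOf_orbit (e c : Corner L) (n : ℕ) (hn : n ≠ 0) :
    endOf c (orbit e n) = Corner.nx^[n] e := by
  induction n generalizing e c with
  | zero => exact absurd rfl hn
  | succ n ih =>
    cases n with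
    | zero => rfl
    | succ n => exact ih e.nx e.nx (by simp)

theorem link_orbit (e : Corner L) (n : ℕ) : Link e (orbit e n) := by
  induction n generalizing e with
  | zero => trivial
  | succ n ih => exact ⟨by simp [Face.Starts, Face.cs], ih _⟩

theorem flat_orbit (e : Corner L) (n : ℕ) :
    flat (orbit e n) = (List.range n).map fun k => Corner.nx^[k + 1] e := by
  induction n generalizing e with
  | zero => rfl
  | succ n ih =>
    simp [orbit, ih, Face.cs, List.range_succ_eq_map, Function.comp_def]

theorem Corner.iterate_nx (e : Corner L) (k : ℕ) :
    Corner.nx^[k] e = (e.1, if e.1.2 then e.2 + k else e.2 - k) := by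
  induction k with
  | zero => simp
  | succ k ih =>
    rw [Function.iterate_succ_apply', ih]
    rcases e with ⟨⟨n, s⟩, t⟩
    cases s <;> simp [Corner.nx] <;> ring

theorem mem_orbit {e : Corner L} {n : ℕ} {f : Face L} (hf : f ∈ orbit e n) :
    ∃ c : Corner L, f = ([], c) ∧ c.1 = e.1 := by
  induction n generalizing e with
  | zero => simp [orbit] at hf
  | succ n ih =>
    rw [orbit, List.mem_cons] at hf
    rcases hf with rfl | hf
    · exact ⟨_, rfl, rfl⟩
    · exact ih (e := e.nx) hf

theorem word_orbit_true (m : ℕ) (t : ZMod L) (n : ℕ) :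
    word X (orbit ((m, true), t) n) = seg X (t + 1) n := by
  induction n generalizing t with
  | zero => simp [orbit, seg]
  | succ n ih =>
    rw [seg_succ', ← ih]
    simp [orbit, Corner.nx, Face.val, Face.cs, Corner.val]

theorem word_orbit_false (m : ℕ) (t : ZMod L) (n : ℕ) :
    word X (orbit ((m, false), t) n) = (seg X (t - n) n)⁻¹ := by
  induction n generalizing t with
  | zero => simp [orbit, seg]
  | succ n ih =>
    have h1 : t - ((n + 1 : ℕ) : ZMod L) = t - 1 - n := by push_cast; ring
    rw [seg_succ, h1, sub_add_cancel, mul_inv_rev, ← ih]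
    simp [orbit, Corner.nx, Face.val, Face.cs, Corner.val]

theorem word_orbit (e : Corner L) : word X (orbit e L) = e.lab X := by
  rcases e with ⟨⟨m, s⟩, t⟩
  cases s
  · simp [word_orbit_false, Corner.lab, Corner.outP, rot]
  · simp [word_orbit_true, Corner.lab, Corner.outP, rot]

theorem lab_of_mem_gaps_orbit (a : G) (e : Corner L) (n : ℕ) :
    ∀ γ ∈ gaps X a (orbit e n), γ.2.1 = e.1 ∧ γ.1 * γ.2.lab X * γ.1⁻¹ = a * e.lab X * a⁻¹ := by
  induction n generalizing e a with
  | zero => simp [orbit, gaps]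
  | succ n ih =>
    have h0 : (a * e.nx.val X) * e.nx.lab X * (a * e.nx.val X)⁻¹ = a * e.lab X * a⁻¹ := by
      rw [e.lab_nx]; group
    intro γ hγ
    simp only [orbit, gaps, List.mem_cons] at hγ
    have hv : Face.val X ([], e.nx) = e.nx.val X := by simp [Face.val, Face.cs]
    rw [hv] at hγ
    rcases hγ with rfl | hγ
    · exact ⟨rfl, h0⟩
    · obtain ⟨h1, h2⟩ := ih _ _ γ hγ
      exact ⟨h1, h2.trans h0⟩

variable {X}

theorem alt_orbit (hR : Relator H X τ rank) (e : Corner L) (n : ℕ) :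
    Alt (fun i f => ∀ c ∈ Face.cs f, τ c.2 = i) (τ e.nx.2) (orbit e n) := by
  induction n generalizing e with
  | zero => simp [orbit, alt_nil]
  | succ n ih =>
    have h : τ e.nx.nx.2 = !τ e.nx.2 := by
      rcases e with ⟨⟨m, s⟩, t⟩
      cases s
      · have := hR.alt (t - 1 - 1)
        rw [sub_add_cancel] at this
        simp [Corner.nx, this]
      · simp [Corner.nx, hR.alt]
    rw [orbit, alt_cons, ← h]
    exact ⟨by simp [Face.cs], ih _⟩

/-- The diagram consisting of a single cell. -/
theorem Diagram.single [NeZero L] (hR : Relator H X τ rank) (e : Corner L) (hN : N ≤ e.1.1) :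
    Diagram X τ rank N {e.1} ∅ ∅ ∅ (τ e.nx.2) (orbit e L) where
  even := by
    rw [length_orbit]
    obtain ⟨k, hk⟩ := hR.even
    rw [hk]
    simp
  ids c hc := by
    rw [Finset.mem_singleton.1 hc]
    exact hN
  alt := alt_orbit hR e L
  link c := by
    rw [endOf_orbit _ _ _ (NeZero.ne L), Corner.iterate_nx]
    convert link_orbit e L
    simp
  step f hf := by
    obtain ⟨c, rfl, -⟩ := mem_orbit hf
    simp [Face.cs]
  nodup := by
    rw [flat_orbit]
    refine List.Nodup.map_on ?_ List.nodup_range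
    intro x hx y hy h
    rw [List.mem_range] at hx hy
    rw [Corner.iterate_nx, Corner.iterate_nx, Prod.mk.injEq] at h
    have : (x : ZMod L) = y := by
      have h2 := h.2
      split_ifs at h2 <;> simpa using h2
    rw [← ZMod.val_cast_of_lt hx, ← ZMod.val_cast_of_lt hy, this]
  cells c hc := by
    rw [flat_orbit, List.mem_map] at hc
    obtain ⟨k, -, rfl⟩ := hc
    rw [Corner.iterate_nx]
    simp
  top := by simp
  bot := by simp
  cover c hc := by
    right; right
    have hc := Finset.mem_singleton.1 hc
    have : c ∈ flat (orbit e L) := by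
      rw [flat_orbit, List.mem_map]
      refine ⟨(if e.1.2 then c.2 - e.2 - 1 else e.2 - c.2 - 1).val,
        List.mem_range.2 (ZMod.val_lt _), ?_⟩
      rw [Corner.iterate_nx]
      ext1
      · exact hc.symm
      · split_ifs <;> simp
    rw [flat, List.mem_flatMap] at this
    obtain ⟨f, hf, hcf⟩ := this
    obtain ⟨d, rfl, -⟩ := mem_orbit hf
    exact ⟨_, hf, by simpa [Face.cs, eq_comm] using hcf⟩
  nb := by simp
  count := by simp
  inv := by
    have hg := lab_of_mem_gaps_orbit X 1 e L
    refine ⟨fun γ hγ => ⟨0, 1, by simp, ConjProd.one, ?_⟩, ?_⟩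
    · rw [(hg γ hγ).2, word_orbit]; simp
    · refine List.pairwise_of_forall_mem_list fun γ hγ γ' hγ' hne => ?_
      exact absurd ((hg γ hγ).1.trans (hg γ' hγ').1.symm) hne

theorem Diagram.rotate_append {B B' : List (Face L)}
    (h : Diagram X τ rank N C Top Bot NB i (B ++ B')) :
    ∃ i', Diagram X τ rank N C Top Bot NB i' (B' ++ B) := by
  induction B generalizing B' i with
  | nil => exact ⟨i, by simpa using h⟩
  | cons f B ih =>
    have := h.rotate (f := f) (B := B ++ B')
    rw [List.append_assoc] at this
    obtain ⟨j, hj⟩ := ih this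
    exact ⟨j, by simpa using hj⟩

/-- Diagrams can be modified until no boundary face has trivial label. -/
theorem Diagram.reduce [NeZero L] (hR : Relator H X τ rank) {B : List (Face L)} (hB : B ≠ [])
    (h : Diagram X τ rank N C Top Bot NB i B) :
    (∃ n, n + 2 = C.card ∧ ConjProd (rot X 0) n (word X B)) ∨
    ∃ (Top₀ Bot₀ NB₀ : Finset (Corner L)) (i₀ : Bool) (B₀ : List (Face L)) (g : G), B₀ ≠ [] ∧
      (∀ f ∈ B₀, f.val X ≠ 1) ∧ word X B₀ = g⁻¹ * word X B * g ∧
      Diagram X τ rank N C Top₀ Bot₀ NB₀ i₀ B₀ := by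
  induction hn : B.length using Nat.strong_induction_on generalizing B Top Bot NB i with
  | _ n ih =>
  subst hn
  by_cases hf : ∀ f ∈ B, f.val X ≠ 1
  · exact Or.inr ⟨_, _, _, _, B, 1, hB, hf, by simp, h⟩
  · push Not at hf
    obtain ⟨f, hfB, hf⟩ := hf
    obtain ⟨B₁, B₂, rfl⟩ := List.append_of_mem hfB
    obtain ⟨i', h'⟩ := h.rotate_append
    rw [List.cons_append] at h'
    have e : word X (f :: (B₂ ++ B₁)) = (word X B₁)⁻¹ * word X (B₁ ++ f :: B₂) * word X B₁ := by
      simp [mul_assoc]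
    have e' : word X (B₁ ++ f :: B₂) = word X B₁ * word X (f :: (B₂ ++ B₁)) * (word X B₁)⁻¹ := by
      rw [e]; group
    rcases h'.close hR hf with ⟨n, hn, hc⟩ | ⟨Top₀, Bot₀, NB₀, B₀, g, hB₀, hlen, hw, hD⟩
    · exact Or.inl ⟨n, hn, e' ▸ hc.conj _⟩
    · rcases ih B₀.length (by simp at hlen ⊢; omega) hB₀ hD rfl with
        ⟨n, hn, hc⟩ | ⟨T, Bt, Nb, i₁, B₁', g', h1, h2, h3, h4⟩
      · refine Or.inl ⟨n, hn, ?_⟩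
        rw [hw] at hc
        have := (hc.conj g).conj (word X B₁)
        rw [e']
        convert this using 1
        group
      · refine Or.inr ⟨T, Bt, Nb, i₁, B₁', word X B₁ * g * g', h1, h2, ?_, h4⟩
        rw [h3, hw, e]
        group

end

end

section

variable {G : Type*} [Group G]

theorem Alt.reverse {α : Type*} {p : Bool → α → Prop} {i : Bool} {l : List α} (h : Alt p i l) :
    Alt p (i ^^ !l.length.bodd) l.reverse := by
  induction l generalizing i with
  | nil => trivial
  | cons x xs ih =>
    have h' := ih h.2
    have e : (!i ^^ !xs.length.bodd) = (i ^^ !(x :: xs).length.bodd) := by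
      cases i <;> simp
    rw [List.reverse_cons, alt_append, ← e]
    refine ⟨h', ?_⟩
    have e' : ((!i ^^ !xs.length.bodd) ^^ xs.reverse.length.bodd) = i := by
      cases i <;> cases h : xs.length.bodd <;> simp [h]
    rw [e']
    exact ⟨h.1, trivial⟩

theorem Red.inv {H : Bool → Subgroup G} {i : Bool} {l : List G} (h : Red H i l) :
    Red H (i ^^ !l.length.bodd) (l.map (·⁻¹)).reverse := by
  simpa using Alt.reverse (Alt.imp (q := Letter H) (f := (·⁻¹)) (fun _ _ => Letter.inv) h)

theorem cp_parity {α : Type*} (l l' : List α) :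
    cp l l' % 2 = 1 ∨ cp l l' = 2 * l.length ∨ cp l l' = 2 * l'.length := by
  induction l generalizing l' with
  | nil => simp
  | cons x xs ih =>
    cases l' with
    | nil => simp
    | cons y ys =>
      rw [cp]
      split_ifs
      · have := ih ys
        simp only [List.length_cons]
        omega
      · simp

theorem cp_pos {α : Type*} {l l' : List α} (h : l ≠ []) (h' : l' ≠ []) : 0 < cp l l' := by
  cases l <;> cases l' <;> simp_all [cp]
  split_ifs <;> omega

theorem Red.conj_cases {H : Bool → Subgroup G} {i : Bool} {l : List G} (hl : Red H i l)
    (he : l.length.bodd = false) (hne : l ≠ []) {j : Bool} {xs : List G} (hx : Red H j xs) :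
    (∃ i' l', Red H i' l' ∧ l ~r l' ∧ l'.prod = xs.prod⁻¹ * l.prod * xs.prod) ∨
    ∃ (j' : Bool) (t : List G) (y : G) (s : List G) (z : G), Red H j' (y :: s ++ z :: t) ∧
      s.length.bodd = true ∧ z * y ≠ 1 ∧
      xs.prod⁻¹ * l.prod * xs.prod = t.prod⁻¹ * (y :: s ++ z :: t).prod := by
  induction xs generalizing i j l with
  | nil => exact Or.inl ⟨i, l, hl, List.IsRotated.refl _, by simp⟩
  | cons x t ih =>
    rw [Red, alt_cons] at hx
    by_cases hij : j = i
    · subst hij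
      obtain ⟨a, s, rfl⟩ := List.exists_cons_of_ne_nil hne
      have hs : s.length.bodd = true := by simpa using he
      rw [Red, alt_cons] at hl
      by_cases hxa : x = a
      · subst hxa
        have hl' : Red H (!j) (s ++ [x]) := by
          rw [Red, alt_append, hs]
          exact ⟨hl.2, by simpa using hl.1, trivial⟩
        have e : (x :: t).prod⁻¹ * (x :: s).prod * (x :: t).prod
            = t.prod⁻¹ * (s ++ [x]).prod * t.prod := by simp [mul_assoc]
        rw [e]
        have hrot : (x :: s) ~r (s ++ [x]) := ⟨1, by simp⟩
        rcases ih hl' (by simp [hs]) (by simp) hx.2 with ⟨i', l', h1, h2, h3⟩ | h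
        · exact Or.inl ⟨i', l', h1, hrot.trans h2, h3⟩
        · exact Or.inr h
      · refine Or.inr ⟨j, t, x⁻¹ * a, s, x, ?_, hs, by simpa using hl.1.2, by simp [mul_assoc]⟩
        rw [Red, alt_append, alt_cons, alt_cons]
        refine ⟨⟨⟨mul_mem (inv_mem hx.1.1) hl.1.1, ?_⟩, hl.2⟩, ?_⟩
        · rw [Ne, inv_mul_eq_one]; exact hxa
        · simpa [hs] using hx
    · obtain rfl : j = !i := by cases i <;> cases j <;> simp_all
      obtain ⟨s, b, rfl⟩ : ∃ s b, l = s ++ [b] := by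
        rcases List.eq_nil_or_concat l with rfl | ⟨s, b, rfl⟩
        · exact absurd rfl hne
        · exact ⟨s, b, by simp⟩
      have hs : s.length.bodd = true := by simpa using he
      rw [Red, alt_append, hs, alt_cons] at hl
      have hb : Letter H (!i) b := by simpa using hl.2.1
      by_cases hbx : b * x = 1
      · have hl' : Red H (!i) (b :: s) := ⟨hb, by simpa using hl.1⟩
        have e : (x :: t).prod⁻¹ * (s ++ [b]).prod * (x :: t).prod
            = t.prod⁻¹ * (b :: s).prod * t.prod := by
          have : x = b⁻¹ := eq_inv_of_mul_eq_one_right hbx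
          simp [this, mul_assoc]
        rw [e]
        have hrot : (s ++ [b]) ~r (b :: s) := List.isRotated_append
        rcases ih hl' (by simp [hs]) (by simp) hx.2 with ⟨i', l', h1, h2, h3⟩ | h
        · exact Or.inl ⟨i', l', h1, hrot.trans h2, h3⟩
        · exact Or.inr h
      · refine Or.inr ⟨!i, t, x⁻¹, s, b * x, ?_, hs, by simpa using hb.2, by simp [mul_assoc]⟩
        rw [Red, alt_append, alt_cons, alt_cons]
        refine ⟨⟨hx.1.inv, by simpa using hl.1⟩, ?_⟩
        have : (!i ^^ (x⁻¹ :: s).length.bodd) = !i := by simp [hs]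
        rw [this]
        exact ⟨⟨mul_mem hb.1 hx.1.1, hbx⟩, hx.2⟩

namespace IsFreeProduct
variable {H : Bool → Subgroup G}

theorem fst_eq (hH : IsFreeProduct H)
    {i : Bool} {l : List G} (h : Red H i l) (hl : l ≠ []) : fst H l.prod = i := by
  have h1 := hH.red_nf l.prod
  rw [hH.nf_eq h] at h1
  obtain ⟨x, xs, rfl⟩ := List.exists_cons_of_ne_nil hl
  exact hH.letter_unique h1.1 h.1.1

theorem gp_self_inv_eq (hH : IsFreeProduct H)
    (g : G) : gp H g g⁻¹ = 2 * len H g - len H (g * g) := by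
  rw [gp, hH.len_inv, ← mul_inv_rev, hH.len_inv]
  ring

/-- Conjugates of cyclically reduced words of even length. -/
theorem conj_even (hH : IsFreeProduct H)
    {i : Bool} {l : List G} (hl : Red H i l) (he : l.length.bodd = false)
    (hne : l ≠ []) (g : G) :
    gp H (g⁻¹ * l.prod * g) (g⁻¹ * l.prod * g)⁻¹ < len H (g⁻¹ * l.prod * g) ∧
    (gp H (g⁻¹ * l.prod * g) (g⁻¹ * l.prod * g)⁻¹ = 0 → l ~r nf H (g⁻¹ * l.prod * g)) := by
  have hc := hl.conj_cases he hne (hH.red_nf g)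
  rw [hH.prod_nf] at hc
  rw [hH.gp_self_inv_eq]
  rcases hc with ⟨i', l', h1, h2, h3⟩ | ⟨j, t, y, s, z, h1, h2, h3, h4⟩
  · have hlen := h2.perm.length_eq
    have hpos : 0 < l.length := List.length_pos_iff.2 hne
    have e : Red H i' (l' ++ l') := by
      rw [Red, alt_append, ← hlen, he]
      exact ⟨h1, by simpa using h1⟩
    rw [← h3, hH.nf_eq h1, ← List.prod_append, hH.len_eq h1, hH.len_eq e, List.length_append]
    exact ⟨by push_cast; omega, fun _ => h2⟩
  · rw [h4]
    have h1' := h1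
    rw [Red, alt_append, alt_cons, alt_cons] at h1'
    simp only [List.length_cons, Nat.bodd_succ, h2, Bool.not_true, Bool.xor_false] at h1'
    obtain ⟨⟨hy, hs⟩, hz, ht⟩ := h1'
    have e : Red H j (y :: s ++ (z * y) :: (s ++ z :: t)) := by
      rw [Red, alt_append, alt_cons, alt_cons, alt_append, alt_cons]
      simp only [List.length_cons, Nat.bodd_succ, h2, Bool.not_true, Bool.xor_false, Bool.xor_true,
        Bool.not_not]
      exact ⟨⟨hy, hs⟩, ⟨mul_mem hz.1 hy.1, h3⟩, hs, hz, ht⟩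
    have e1 := hH.len_inv_mul_of_ne ht h1
    have e2 := hH.len_inv_mul_of_ne ht e
    have e3 : t.prod⁻¹ * (y :: s ++ z :: t).prod * (t.prod⁻¹ * (y :: s ++ z :: t).prod) =
        t.prod⁻¹ * (y :: s ++ (z * y) :: (s ++ z :: t)).prod := by simp [mul_assoc]
    rw [e3, e1, e2]
    simp only [List.cons_append, List.length_cons, List.length_append]
    push_cast
    constructor
    · omega
    · intro h; omega

theorem gp_parity (hH : IsFreeProduct H)
    (g h : G) : gp H g h = 0 ∨ gp H g h % 2 = 1 ∨ gp H g h = 2 * len H g ∨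
    gp H g h = 2 * len H h := by
  rw [hH.gp_eq]
  split_ifs
  · have := cp_parity (nf H g) (nf H h)
    simp only [len]
    omega
  · simp

theorem fst_eq_of_gp_pos (hH : IsFreeProduct H)
    {g h : G} (hg : 0 < gp H g h) : fst H g = fst H h := by
  rw [hH.gp_eq] at hg
  by_contra hne
  simp [hne] at hg

theorem fst_ne_of_gp_eq_zero (hH : IsFreeProduct H)
    {g h : G} (h0 : gp H g h = 0) (hg : 0 < len H g) (hh : 0 < len H h) :
    fst H g ≠ fst H h := by
  intro he
  rw [hH.gp_eq, if_pos he] at h0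
  have := cp_pos (List.length_pos_iff.1 hg) (List.length_pos_iff.1 hh)
  omega

theorem gp_self_inv_parity (hH : IsFreeProduct H) {g : G} (hg : gp H g g⁻¹ < len H g) :
    (gp H g g⁻¹ = 0 ∧ len H g % 2 = 0) ∨ (gp H g g⁻¹ % 2 = 1 ∧ len H g % 2 = 1) := by
  have h0 := hH.gp_nonneg g g⁻¹
  have hpos : 0 < len H g := by omega
  have hp := hH.gp_parity g g⁻¹
  rw [hH.len_inv] at hp
  have hi := (hH.red_nf g).inv
  have hne : ((nf H g).map (·⁻¹)).reverse ≠ [] := by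
    simpa using List.length_pos_iff.1 hpos
  have hf := hH.fst_eq hi hne
  rw [prod_map_inv_reverse, hH.prod_nf] at hf
  have hb : (nf H g).length.bodd = decide (len H g % 2 = 1) := by
    rw [Nat.mod_two_of_bodd, len]
    cases (nf H g).length.bodd <;> rfl
  by_cases hpz : gp H g g⁻¹ = 0
  · left
    refine ⟨hpz, ?_⟩
    have := hH.fst_ne_of_gp_eq_zero hpz hpos (by rwa [hH.len_inv])
    rw [hf, hb] at this
    by_contra hodd
    have : len H g % 2 = 1 := by omega
    simp_all
  · right
    refine ⟨by omega, ?_⟩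
    have := hH.fst_eq_of_gp_pos (by omega : 0 < gp H g g⁻¹)
    rw [hf, hb] at this
    by_contra hodd
    simp [hodd] at this

theorem exists_split (hH : IsFreeProduct H) {g h : G} {t : ℕ} (ht : (2 * t : ℤ) ≤ gp H g h) :
    ∃ p, len H p = t ∧ gp H p g = 2 * t ∧ gp H p h = 2 * t := by
  have key : ∀ k : G, t ≤ len H k → gp H ((nf H k).take t).prod k = 2 * t ∧
      len H ((nf H k).take t).prod = t := by
    intro k hk
    have hr := hH.red_nf k
    rw [← List.take_append_drop t (nf H k), Red, alt_append] at hr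
    have h1 := hH.len_eq hr.1
    rw [List.length_take, min_eq_left (show t ≤ (nf H k).length from hk)] at h1
    refine ⟨?_, h1⟩
    have e : ((nf H k).take t).prod⁻¹ * k = ((nf H k).drop t).prod := by
      rw [inv_mul_eq_iff_eq_mul, ← List.prod_append, List.take_append_drop, hH.prod_nf]
    rw [gp, h1, e, hH.len_eq hr.2, List.length_drop]
    simp only [len] at hk ⊢
    omega
  rcases Nat.eq_zero_or_pos t with rfl | hpos
  · refine ⟨1, hH.len_one, ?_, ?_⟩ <;> simp [gp, hH.len_one]
  · have hf := hH.fst_eq_of_gp_pos (by omega : 0 < gp H g h)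
    rw [hH.gp_eq, if_pos hf] at ht
    obtain ⟨h1, h2, h3⟩ := take_eq_of_le_cp (n := t) (by exact_mod_cast ht)
    have k1 := key g h2
    have k2 := key h h3
    exact ⟨_, k1.2, k1.1, by rw [h1]; exact k2.1⟩

end IsFreeProduct

end

section

variable {G : Type*} [Group G]
namespace IsFreeProduct
variable {H : Bool → Subgroup G}

theorem len_conj (hH : IsFreeProduct H)
    {S h : G} (h1 : gp H h S = 2 * len H h) (h2 : gp H S S⁻¹ ≤ 2 * len H h)
    (h3 : 2 * len H h + gp H S S⁻¹ ≤ 2 * len H S) :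
    (len H (S * h) : ℤ) = len H S + len H h - gp H S S⁻¹ ∧
    (len H (h⁻¹ * S * h) : ℤ) = len H S - gp H S S⁻¹ := by
  have e1 : gp H S⁻¹ h = len H S + len H h - len H (S * h) := by simp [gp, hH.len_inv]
  have e2 : gp H S (S * h) = len H S + len H (S * h) - len H h := by simp [gp]
  have e3 : gp H h (S * h) = len H h + len H (S * h) - len H (h⁻¹ * S * h) := by
    simp [gp, mul_assoc]
  have u1 := hH.gp_ultra S⁻¹ S h
  have u2 := hH.gp_ultra S⁻¹ h S
  have u3 := hH.gp_ultra h S (S * h)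
  have c1 := hH.gp_comm S h
  have c2 := hH.gp_comm S⁻¹ S
  have l1 := hH.gp_le_left h S⁻¹
  have c3 := hH.gp_comm S⁻¹ h
  have l2 := hH.gp_le_left h (S * h)
  omega

/-- Conjugating to a point on the axis. -/
theorem conj_axis (hH : IsFreeProduct H)
    {S h : G} (hS : gp H S S⁻¹ < len H S) (h1 : gp H h S = 2 * len H h)
    (h2 : gp H S S⁻¹ ≤ 2 * len H h) (h3 : 2 * len H h + gp H S S⁻¹ ≤ 2 * len H S) :
    gp H (h⁻¹ * S * h) (h⁻¹ * S * h)⁻¹ = 0 ∧ 0 < len H (h⁻¹ * S * h) := by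
  obtain ⟨-, a2⟩ := hH.len_conj h1 h2 h3
  have s1 := hH.gp_self_inv_eq S
  have e1 : gp H S (S * S) = len H (S * S) := by simp [gp]
  have e2 : gp H S⁻¹ (S * S)⁻¹ = len H (S * S) := by
    have : S * (S⁻¹ * S⁻¹) = S⁻¹ := by group
    rw [gp, hH.len_inv, hH.len_inv, mul_inv_rev, inv_inv, this, hH.len_inv]
    ring
  have u1 := hH.gp_ultra (S * S) S (S * S)⁻¹
  have u2 := hH.gp_ultra S S⁻¹ (S * S)⁻¹
  have u3 := hH.gp_ultra S (S * S) S⁻¹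
  have u4 := hH.gp_ultra (S * S) (S * S)⁻¹ S⁻¹
  have c1 := hH.gp_comm (S * S) S
  have c2 := hH.gp_comm (S * S)⁻¹ S⁻¹
  have u5 := hH.gp_ultra h S (S * S)
  have l5 := hH.gp_le_left h (S * S)
  have hc : gp H (S * S) (S * S)⁻¹ = gp H S S⁻¹ := by omega
  obtain ⟨-, b2⟩ := hH.len_conj (S := S * S) (h := h) (by omega) (by omega) (by omega)
  have e3 : h⁻¹ * S * h * (h⁻¹ * S * h) = h⁻¹ * (S * S) * h := by group
  rw [hH.gp_self_inv_eq, e3]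
  have := hH.gp_nonneg S S⁻¹
  omega

/-- Two translations with a common point on their axes and the same initial type there. -/
theorem conj_axis_pair (hH : IsFreeProduct H) {S S' : G} {t : ℕ} (hS : gp H S S⁻¹ < len H S)
    (hS' : gp H S' S'⁻¹ < len H S') (h1 : gp H S S⁻¹ ≤ 2 * t) (h2 : gp H S' S'⁻¹ ≤ 2 * t)
    (h3 : 2 * t + gp H S S⁻¹ < 2 * len H S) (h4 : 2 * t + gp H S' S'⁻¹ < 2 * len H S')
    (h5 : 2 * t < gp H S S') :
    ∃ h, gp H (h⁻¹ * S * h) (h⁻¹ * S * h)⁻¹ = 0 ∧ 0 < len H (h⁻¹ * S * h) ∧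
      gp H (h⁻¹ * S' * h) (h⁻¹ * S' * h)⁻¹ = 0 ∧ 0 < len H (h⁻¹ * S' * h) ∧
      0 < gp H (h⁻¹ * S * h) (h⁻¹ * S' * h) := by
  obtain ⟨h, ht, p1, p2⟩ := hH.exists_split h5.le
  have ht' : (len H h : ℤ) = t := by exact_mod_cast ht
  rw [← ht'] at p1 p2 h1 h2 h3 h4 h5
  obtain ⟨a1, a2⟩ := hH.len_conj p1 h1 h3.le
  obtain ⟨b1, b2⟩ := hH.len_conj p2 h2 h4.le
  obtain ⟨a3, a4⟩ := hH.conj_axis hS p1 h1 h3.le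
  obtain ⟨b3, b4⟩ := hH.conj_axis hS' p2 h2 h4.le
  refine ⟨h, a3, a4, b3, b4, ?_⟩
  have e1 : gp H S (S * h) = len H S + len H (S * h) - len H h := by simp [gp]
  have e2 : gp H S' (S' * h) = len H S' + len H (S' * h) - len H h := by simp [gp]
  have e3 : gp H (S * h) (S' * h) = gp H (h⁻¹ * S * h) (h⁻¹ * S' * h) + 2 * len H h := by
    have : (h⁻¹ * S * h)⁻¹ * (h⁻¹ * S' * h) = (S * h)⁻¹ * (S' * h) := by group
    rw [gp, gp, this]
    omega
  have u1 := hH.gp_ultra (S * h) S S'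
  have u2 := hH.gp_ultra (S * h) S' (S' * h)
  have c1 := hH.gp_comm (S * h) S
  omega

theorem overlap_left (hH : IsFreeProduct H) {S S' N : G} (hl : len H S < len H S')
    (hN : len H (S⁻¹ * N) < len H N) (hN' : len H (S'⁻¹ * N) ≤ len H N)
    (hm : len H N ≤ len H (S⁻¹ * (S'⁻¹ * N))) :
    (len H S : ℤ) + 1 ≤ gp H S S' ∧ gp H S' S'⁻¹ ≤ len H S := by
  have f1 : gp H S S'⁻¹ ≤ len H S := by
    have e3 : gp H S (S'⁻¹ * N) = len H S + len H (S'⁻¹ * N) - len H (S⁻¹ * (S'⁻¹ * N)) := rfl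
    have e5 : gp H S'⁻¹ (S'⁻¹ * N) = len H S' + len H (S'⁻¹ * N) - len H N := by
      simp [gp, hH.len_inv]
    have u2 := hH.gp_ultra S S'⁻¹ (S'⁻¹ * N)
    rw [min_le_iff] at u2
    omega
  have f2 : (len H S : ℤ) + 1 ≤ gp H S S' := by
    have e1 : gp H S N = len H S + len H N - len H (S⁻¹ * N) := rfl
    have e2 : gp H S' N = len H S' + len H N - len H (S'⁻¹ * N) := rfl
    have u1 := hH.gp_ultra S N S'
    rw [hH.gp_comm N, min_le_iff] at u1
    omega
  have u4 := hH.gp_ultra S S' S'⁻¹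
  rw [min_le_iff] at u4
  omega

theorem overlap_right (hH : IsFreeProduct H)
    {S S' N : G} (hl : len H S' ≤ len H S) (h : gp H S S⁻¹ < len H S)
    (hN : len H (S⁻¹ * N) < len H N) (hN' : len H (S'⁻¹ * N) ≤ len H N)
    (hm : len H N ≤ len H (S'⁻¹ * (S⁻¹ * N))) :
    (len H S' : ℤ) ≤ gp H S S' ∧ gp H S S⁻¹ < len H S' := by
  have f2 : (len H S' : ℤ) ≤ gp H S S' := by
    have e1 : gp H S N = len H S + len H N - len H (S⁻¹ * N) := rfl
    have e2 : gp H S' N = len H S' + len H N - len H (S'⁻¹ * N) := rfl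
    have u1 := hH.gp_ultra S N S'
    rw [hH.gp_comm N, min_le_iff] at u1
    omega
  have f1 : gp H S' S⁻¹ < len H S' := by
    by_contra hh
    have e4 : gp H S' (S⁻¹ * N) = len H S' + len H (S⁻¹ * N) - len H (S'⁻¹ * (S⁻¹ * N)) := rfl
    have e6 : gp H S⁻¹ (S⁻¹ * N) = len H S + len H (S⁻¹ * N) - len H N := by
      simp [gp, hH.len_inv]
    have u3 := hH.gp_ultra S' S⁻¹ (S⁻¹ * N)
    have u5 := hH.gp_ultra S S' S⁻¹
    rw [min_le_iff] at u3 u5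
    omega
  have u4 := hH.gp_ultra S' S S⁻¹
  rw [hH.gp_comm S' S, min_le_iff] at u4
  omega

/-- A local maximum of the lengths of the partial products of hyperbolic elements can be
lowered by a Hurwitz move, unless the two factors have overlapping axes. -/
theorem hurwitz (hH : IsFreeProduct H)
    {S S' N : G} (hS : gp H S S⁻¹ < len H S) (hS' : gp H S' S'⁻¹ < len H S')
    (hN : len H (S⁻¹ * N) < len H N) (hN' : len H (S'⁻¹ * N) ≤ len H N) :
    len H (S⁻¹ * (S'⁻¹ * N)) < len H N ∨ len H (S'⁻¹ * (S⁻¹ * N)) < len H N ∨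
    ∃ h, gp H (h⁻¹ * S * h) (h⁻¹ * S * h)⁻¹ = 0 ∧ 0 < len H (h⁻¹ * S * h) ∧
      gp H (h⁻¹ * S' * h) (h⁻¹ * S' * h)⁻¹ = 0 ∧ 0 < len H (h⁻¹ * S' * h) ∧
      0 < gp H (h⁻¹ * S * h) (h⁻¹ * S' * h) := by
  by_contra! hcon
  obtain ⟨n1, n2, n3⟩ := hcon
  have p1 := hH.gp_self_inv_parity hS
  have p2 := hH.gp_self_inv_parity hS'
  have p3 := hH.gp_parity S S'
  have key : ∃ t : ℕ, gp H S S⁻¹ ≤ 2 * t ∧ gp H S' S'⁻¹ ≤ 2 * t ∧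
      2 * t + gp H S S⁻¹ < 2 * len H S ∧ 2 * t + gp H S' S'⁻¹ < 2 * len H S' ∧
      2 * t < gp H S S' := by
    have z1 := hH.gp_nonneg S S⁻¹
    have z2 := hH.gp_nonneg S' S'⁻¹
    have f : (len H S < len H S' ∧ (len H S : ℤ) + 1 ≤ gp H S S' ∧ gp H S' S'⁻¹ ≤ len H S) ∨
        (len H S' ≤ len H S ∧ (len H S' : ℤ) ≤ gp H S S' ∧ gp H S S⁻¹ < len H S') := by
      rcases lt_or_ge (len H S) (len H S') with hl | hl
      · exact Or.inl ⟨hl, hH.overlap_left hl hN hN' n1⟩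
      · exact Or.inr ⟨hl, hH.overlap_right hl hS hN hN' n2⟩
    clear n1 n2 n3 hN hN'
    generalize gp H S S⁻¹ = a at *
    generalize gp H S' S'⁻¹ = a' at *
    generalize gp H S S' = g at *
    generalize len H S = s at *
    generalize len H S' = s' at *
    rcases le_total a a' with h | h
    · refine ⟨((a' + 1) / 2).toNat, ?_⟩
      have ht : 2 * (((a' + 1) / 2).toNat : ℤ) = a' ∨ 2 * (((a' + 1) / 2).toNat : ℤ) = a' + 1 := by
        omega
      generalize ((a' + 1) / 2).toNat = t at *
      rcases f with f | f <;> refine ⟨?_, ?_, ?_, ?_, ?_⟩ <;> omega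
    · refine ⟨((a + 1) / 2).toNat, ?_⟩
      have ht : 2 * (((a + 1) / 2).toNat : ℤ) = a ∨ 2 * (((a + 1) / 2).toNat : ℤ) = a + 1 := by
        omega
      generalize ((a + 1) / 2).toNat = t at *
      rcases f with f | f <;> refine ⟨?_, ?_, ?_, ?_, ?_⟩ <;> omega
  obtain ⟨t, k1, k2, k3, k4, k5⟩ := key
  obtain ⟨h, a1, a2, a3, a4, a5⟩ := hH.conj_axis_pair hS hS' k1 k2 k3 k4 k5
  exact absurd a5 (not_lt.2 (n3 h a1 a2 a3 a4))

end IsFreeProduct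

end

section

variable {G : Type*} [Group G]

section
variable {H : Bool → Subgroup G} {L : ℕ} {X : ZMod L → G} {τ : ZMod L → Bool} {rank : ZMod L → ℕ}

/-- A diagram with `v` cells, with names from `N` on, starting type `i`, and nontrivial face
labels spelling `w`. -/
def Spells (X : ZMod L → G) (τ : ZMod L → Bool) (rank : ZMod L → ℕ) (v N : ℕ) (i : Bool)
    (B : List (Face L)) : Prop :=
  B ≠ [] ∧ (∀ f ∈ B, f.val X ≠ 1) ∧ ∃ (C : Finset (ℕ × Bool)) (Top Bot NB : Finset (Corner L)),
    C.card = v ∧ Diagram X τ rank N C Top Bot NB i B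

/-- Some conjugate of `R` is spelled by a reduced diagram with `v` cells. -/
def Good (X : ZMod L → G) (τ : ZMod L → Bool) (rank : ZMod L → ℕ) (v : ℕ) (R : G) : Prop :=
  ∀ N, ∃ i B, Spells X τ rank v N i B ∧ ∃ g, word X B = g⁻¹ * R * g

theorem Spells.rotate_append {v N : ℕ} {i : Bool} {B B' : List (Face L)}
    (h : Spells X τ rank v N i (B ++ B')) : ∃ i', Spells X τ rank v N i' (B' ++ B) := by
  obtain ⟨h1, h2, C, Top, Bot, NB, h3, h4⟩ := h
  obtain ⟨i', h5⟩ := h4.rotate_append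
  refine ⟨i', by simpa [and_comm] using h1, fun f hf => h2 f ?_, C, Top, Bot, NB, h3, h5⟩
  simpa [or_comm] using hf

theorem red_of_alt (hR : Relator H X τ rank) {i : Bool} {B : List (Face L)}
    (h : Alt (fun i f => ∀ c ∈ Face.cs f, τ c.2 = i) i B) (h1 : ∀ f ∈ B, f.val X ≠ 1) :
    Red H i (B.map (Face.val X)) := by
  induction B generalizing i with
  | nil => trivial
  | cons f B ih =>
    refine ⟨⟨?_, h1 f (by simp)⟩, ih h.2 fun g hg => h1 g (by simp [hg])⟩
    refine Subgroup.list_prod_mem _ fun x hx => ?_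
    obtain ⟨c, hc, rfl⟩ := List.mem_map.1 hx
    have hl := (hR.letter c.2).1
    rw [h.1 c hc] at hl
    unfold Corner.val
    split_ifs
    · exact hl
    · exact inv_mem hl

theorem Spells.red (hR : Relator H X τ rank) {v N : ℕ} {i : Bool} {B : List (Face L)}
    (h : Spells X τ rank v N i B) :
    Red H i (B.map (Face.val X)) ∧ (B.map (Face.val X)).length.bodd = false ∧
      B.map (Face.val X) ≠ [] := by
  obtain ⟨h1, h2, C, Top, Bot, NB, h3, h4⟩ := h
  exact ⟨red_of_alt hR h4.alt h2, by simpa using h4.even, by simpa using h1⟩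

namespace Good
variable {v v' : ℕ} {R R' : G}

theorem conj (h : Good X τ rank v R) (g : G) : Good X τ rank v (g⁻¹ * R * g) := by
  intro N
  obtain ⟨i, B, hB, g', hg'⟩ := h N
  exact ⟨i, B, hB, g⁻¹ * g', by rw [hg']; group⟩

theorem conjProd [NeZero L] (h : Good X τ rank v R) : ConjProd (rot X 0) v R := by
  obtain ⟨i, B, ⟨h1, h2, C, Top, Bot, NB, h3, h4⟩, g, hg⟩ := h 0
  have := (h4.conjProd h1).conj g
  rw [hg, h3] at this
  simpa [mul_assoc] using this

theorem hyperbolic (hH : IsFreeProduct H) (hR : Relator H X τ rank) (h : Good X τ rank v R) :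
    gp H R R⁻¹ < len H R := by
  obtain ⟨i, B, hB, g, hg⟩ := h 0
  obtain ⟨h1, h2, h3⟩ := hB.red hR
  have := (hH.conj_even h1 h2 h3 g⁻¹).1
  rw [show (B.map (Face.val X)).prod = g⁻¹ * R * g from hg] at this
  simpa [mul_assoc] using this

theorem spells_of_axis (hH : IsFreeProduct H) (hR : Relator H X τ rank)
    (h : Good X τ rank v R) (h0 : gp H R R⁻¹ = 0) (N : ℕ) :
    ∃ B, Spells X τ rank v N (fst H R) B ∧ word X B = R := by
  obtain ⟨i, B, hB, g, hg⟩ := h N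
  obtain ⟨h1, h2, h3⟩ := hB.red hR
  have := (hH.conj_even h1 h2 h3 g⁻¹).2
  rw [show (B.map (Face.val X)).prod = g⁻¹ * R * g from hg] at this
  have e : g⁻¹⁻¹ * (g⁻¹ * R * g) * g⁻¹ = R := by group
  rw [e] at this
  obtain ⟨n, hn⟩ := this h0
  rw [← List.map_rotate] at hn
  obtain ⟨i', hi'⟩ : ∃ i', Spells X τ rank v N i' (B.rotate n) := by
    rw [← List.rotate_mod]
    rw [List.rotate_eq_drop_append_take (Nat.mod_lt _ (List.length_pos_iff.2 hB.1)).le]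
    exact Spells.rotate_append (i := i) (by rwa [List.take_append_drop])
  have hw : word X (B.rotate n) = R := by
    rw [word, hn, hH.prod_nf]
  obtain ⟨k1, k2, k3⟩ := hi'.red hR
  have hf := hH.fst_eq k1 k3
  rw [show ((B.rotate n).map (Face.val X)).prod = R from hw] at hf
  exact ⟨_, hf ▸ hi', hw⟩

end Good

theorem Good.lab [NeZero L] (hR : Relator H X τ rank) (s : Bool) (R g : G)
    (hRg : R = g⁻¹ * Corner.lab X ((0, s), 0) * g) : Good X τ rank 1 R := by
  intro N
  have h := Diagram.single (N := N) hR ((N, s), (0 : ZMod L)) le_rfl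
  refine ⟨_, _, ⟨?_, ?_, _, _, _, _, ?_, h⟩, g⁻¹, ?_⟩
  · have := length_orbit ((N, s), (0 : ZMod L)) L
    intro h0
    rw [h0] at this
    exact NeZero.ne L this.symm
  · intro f hf
    obtain ⟨c, rfl, -⟩ := mem_orbit hf
    simp only [Face.val, Face.cs, List.nil_append, List.map_cons, List.map_nil, List.prod_cons,
      List.prod_nil, mul_one, Corner.val]
    split_ifs
    · exact (hR.letter _).2
    · simpa using (hR.letter _).2
  · simp
  · rw [word_orbit, hRg]
    have : Corner.lab X ((N, s), (0 : ZMod L)) = Corner.lab X ((0, s), (0 : ZMod L)) := rfl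
    rw [this]
    group

theorem ConjProd.exists_good [NeZero L] (hR : Relator H X τ rank) {V : ℕ} {x : G}
    (h : ConjProd (rot X 0) V x) : ∃ l : List (ℕ × G), (∀ p ∈ l, Good X τ rank p.1 p.2) ∧
      (l.map Prod.fst).sum = V ∧ (l.map Prod.snd).prod = x := by
  induction h with
  | one => exact ⟨[], by simp, rfl, rfl⟩
  | mul h x g n hx _ ih =>
    obtain ⟨l, h1, h2, h3⟩ := ih
    refine ⟨(1, h * x * h⁻¹) :: l, ?_, by simp [h2, add_comm], by simp [h3]⟩
    intro p hp
    rcases List.mem_cons.1 hp with rfl | hp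
    · have e : ∀ s, Good X τ rank 1 (Corner.lab X ((0, s), (0 : ZMod L))) :=
        fun s => Good.lab hR s _ 1 (by simp)
      obtain ⟨g, hg⟩ := conjProd_rot X (Corner.outP ((0, false), (0 : ZMod L)))
      obtain ⟨g', hg'⟩ := conjProd_rot X (Corner.outP ((0, true), (0 : ZMod L)))
      rcases hx with rfl | rfl
      · have := ((e true).conj g').conj h⁻¹
        simp only [Corner.lab, if_true, hg'] at this
        simpa [mul_assoc] using this
      · have := ((e false).conj g).conj h⁻¹
        simp only [Corner.lab, hg] at this
        simpa [mul_assoc] using this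
    · exact h1 p hp

theorem exists_ends {α : Type*} {B : List α} (h : B ≠ []) (he : B.length.bodd = false) :
    ∃ f M p, B = f :: M ++ [p] := by
  rcases List.eq_nil_or_concat B with rfl | ⟨l, p, rfl⟩
  · exact absurd rfl h
  · cases l with
    | nil => simp at he
    | cons f M => exact ⟨f, M, p, by simp⟩

/-- Two diagrams whose axes overlap can be merged. -/
theorem Good.merge [NeZero L] (hH : IsFreeProduct H) (hR : Relator H X τ rank) {v v' : ℕ}
    {R R' h : G} (hg : Good X τ rank v R) (hg' : Good X τ rank v' R')
    (h0 : gp H (h⁻¹ * R * h) (h⁻¹ * R * h)⁻¹ = 0) (h1 : 0 < len H (h⁻¹ * R * h))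
    (h0' : gp H (h⁻¹ * R' * h) (h⁻¹ * R' * h)⁻¹ = 0)
    (h2 : 0 < gp H (h⁻¹ * R * h)⁻¹ (h⁻¹ * R' * h)) :
    (∃ n, n + 2 = v + v' ∧ ConjProd (rot X 0) n (R * R')) ∨ Good X τ rank (v + v') (R * R') := by
  by_cases hn : ∃ n, n + 2 = v + v' ∧ ConjProd (rot X 0) n (R * R')
  · exact Or.inl hn
  refine Or.inr fun N => ?_
  have t1 := hH.fst_ne_of_gp_eq_zero h0 h1 (by rwa [hH.len_inv])
  rw [hH.fst_eq_of_gp_pos h2] at t1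
  have t2 : fst H (h⁻¹ * R' * h) = !fst H (h⁻¹ * R * h) := Bool.eq_not.2 (Ne.symm t1)
  obtain ⟨B, ⟨hB, -, C, Top, Bot, NB, hC, hD⟩, hw⟩ := (hg.conj h).spells_of_axis hH hR h0 N
  obtain ⟨N', hN'⟩ : ∃ N', N ≤ N' ∧ ∀ c ∈ C, c.1 < N' :=
    ⟨N + (C.sup Prod.fst + 1), by omega, fun c hc => by
      have := Finset.le_sup (f := Prod.fst) hc
      omega⟩
  obtain ⟨B', ⟨hB', -, C', Top', Bot', NB', hC', hD'⟩, hw'⟩ :=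
    (hg'.conj h).spells_of_axis hH hR h0' N'
  rw [t2] at hD'
  have hdisj : Disjoint C C' := by
    rw [Finset.disjoint_left]
    intro c hc hc'
    have := hN'.2 c hc
    have := hD'.ids c hc'
    omega
  obtain ⟨f, M, p, rfl⟩ := exists_ends hB hD.even
  obtain ⟨f', M', p', rfl⟩ := exists_ends hB' hD'.even
  have hpr : h⁻¹ * R * h * (h⁻¹ * R' * h) = h⁻¹ * (R * R') * h := by group
  rcases hD.glue hR hD' hN'.1 hdisj with ⟨n, h3, h4⟩ | ⟨C₀, Top₀, Bot₀, NB₀, h3, h4⟩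
  · rw [hw, hw', hpr] at h4
    refine absurd ⟨n, by omega, ?_⟩ hn
    simpa [mul_assoc] using h4.conj h
  · have hw0 : word X (M ++ p.app f' :: M' ++ [p'.app f]) =
        (h * f.val X)⁻¹ * (R * R') * (h * f.val X) := by
      have : word X (M ++ p.app f' :: M' ++ [p'.app f]) = (f.val X)⁻¹ *
          (word X (f :: M ++ [p]) * word X (f' :: M' ++ [p'])) * f.val X := by
        simp [mul_assoc]
      rw [this, hw, hw', hpr]
      group
    rcases h4.reduce hR (by simp) with ⟨n, h5, h6⟩ | ⟨_, _, _, i, B₀, g, h5, h6, h7, h8⟩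
    · rw [hw0] at h6
      refine absurd ⟨n, by omega, ?_⟩ hn
      simpa [mul_assoc] using h6.conj (h * f.val X)
    · refine ⟨i, B₀, ⟨h5, h6, _, _, _, _, by omega, h8⟩, h * f.val X * g, ?_⟩
      rw [h7, hw0]
      group

end

end

section

variable {G : Type*} [Group G]

theorem IsFreeProduct.len_le_one {H : Bool → Subgroup G} (hH : IsFreeProduct H) {i : Bool} {x : G}
    (hx : x ∈ H i) : len H x ≤ 1 := by
  by_cases h : x = 1
  · rw [h, hH.len_one]; exact zero_le_one
  · have := hH.len_eq (i := i) (l := [x]) ⟨⟨hx, h⟩, trivial⟩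
    simp only [List.prod_singleton, List.length_singleton] at this
    exact this.le

/-- The sum of the lengths of the partial products, starting from `p`. -/
noncomputable def height (H : Bool → Subgroup G) : G → List (ℕ × G) → ℕ
  | _, [] => 0
  | p, r :: l => len H (p * r.2) + height H (p * r.2) l

theorem height_append (H : Bool → Subgroup G) (p : G) (l l' : List (ℕ × G)) :
    height H p (l ++ l') = height H p l + height H (p * (l.map Prod.snd).prod) l' := by
  induction l generalizing p with
  | nil => simp [height]
  | cons r l ih => simp [height, ih, mul_assoc, add_assoc]

theorem exists_peak (H : Bool → Subgroup G) {p : G} {r : ℕ × G} {l : List (ℕ × G)} (hl : l ≠ [])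
    (h1 : len H p < len H (p * r.2))
    (h2 : len H (p * r.2 * (l.map Prod.snd).prod) ≤ len H (p * r.2)) :
    ∃ l₁ r₁ r₂ l₂, r :: l = l₁ ++ r₁ :: r₂ :: l₂ ∧
      len H (p * (l₁.map Prod.snd).prod) < len H (p * (l₁.map Prod.snd).prod * r₁.2) ∧
      len H (p * (l₁.map Prod.snd).prod * r₁.2 * r₂.2) ≤
        len H (p * (l₁.map Prod.snd).prod * r₁.2) := by
  induction l generalizing p r with
  | nil => exact absurd rfl hl
  | cons r' l ih =>
    by_cases h : len H (p * r.2 * r'.2) ≤ len H (p * r.2)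
    · exact ⟨[], r, r', l, rfl, by simpa using h1, by simpa using h⟩
    · rw [not_le] at h
      rw [List.map_cons, List.prod_cons, ← mul_assoc] at h2
      have hl' : l ≠ [] := by
        rintro rfl
        simp only [List.map_nil, List.prod_nil, mul_one] at h2
        omega
      obtain ⟨l₁, r₁, r₂, l₂, e, k1, k2⟩ := ih hl' h (by omega)
      refine ⟨r :: l₁, r₁, r₂, l₂, by rw [e]; rfl, ?_, ?_⟩
      · simpa [mul_assoc] using k1
      · simpa [mul_assoc] using k2

section
variable {H : Bool → Subgroup G} {L : ℕ} {X : ZMod L → G} {τ : ZMod L → Bool} {rank : ZMod L → ℕ}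

theorem ConjProd.of_good [NeZero L] {l : List (ℕ × G)} (hl : ∀ p ∈ l, Good X τ rank p.1 p.2) :
    ConjProd (rot X 0) (l.map Prod.fst).sum (l.map Prod.snd).prod := by
  induction l with
  | nil => exact ConjProd.one
  | cons p l ih =>
    rw [List.map_cons, List.sum_cons, List.map_cons, List.prod_cons]
    exact (hl p (by simp)).conjProd.mul' (ih fun q hq => hl q (by simp [hq]))

theorem eq_one_of_good [NeZero L] (hH : IsFreeProduct H) (hR : Relator H X τ rank) {i : Bool}
    {x : G} (hx : x ∈ H i) {V : ℕ} (hmin : ∀ n < V, ¬ConjProd (rot X 0) n x) (m k : ℕ) :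
    ∀ l : List (ℕ × G), l.length = m → height H 1 l = k → (∀ p ∈ l, Good X τ rank p.1 p.2) →
      (l.map Prod.fst).sum = V → (l.map Prod.snd).prod = x → x = 1 := by
  induction m using Nat.strong_induction_on generalizing k with
  | _ m ihm =>
  induction k using Nat.strong_induction_on with
  | _ k ihk =>
  intro l hm hk hl hV hxl
  match l, hm, hk, hl, hV, hxl with
  | [], _, _, _, _, hxl => simpa using hxl.symm
  | [r], _, _, hl, _, hxl =>
    by_contra hne
    have h := (hl r (by simp)).hyperbolic hH hR
    have e : r.2 = x := by simpa using hxl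
    rw [e, hH.gp_self_inv_eq] at h
    have h1 := hH.len_le_one (mul_mem hx hx)
    have h2 := hH.len_eq (i := i) (l := [x]) ⟨⟨hx, hne⟩, trivial⟩
    simp only [List.prod_singleton, List.length_singleton] at h2
    omega
  | r :: r' :: l, hm, hk, hl, hV, hxl =>
    have hr := (hl r (by simp)).hyperbolic hH hR
    have hr0 := hH.gp_nonneg r.2 r.2⁻¹
    have hx1 := hH.len_le_one hx
    obtain ⟨l₁, r₁, r₂, l₂, e, k1, k2⟩ := exists_peak H (p := 1) (r := r) (l := r' :: l) (by simp)
      (by rw [hH.len_one, one_mul]; omega)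
      (by
        rw [List.map_cons, List.prod_cons] at hxl
        rw [one_mul, hxl]; omega)
    rw [e] at hm hk hl hV hxl
    obtain ⟨v₁, R₁⟩ := r₁
    obtain ⟨v₂, R₂⟩ := r₂
    have g1 : Good X τ rank v₁ R₁ := hl (v₁, R₁) (by simp)
    have g2 : Good X τ rank v₂ R₂ := hl (v₂, R₂) (by simp)
    have hl1 : ∀ p ∈ l₁, Good X τ rank p.1 p.2 := fun p hp => hl p (by simp [hp])
    have hl2 : ∀ p ∈ l₂, Good X τ rank p.1 p.2 := fun p hp => hl p (by simp [hp])
    rw [one_mul] at k1 k2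
    simp only at k1 k2
    rw [height_append] at hk
    simp only [height, one_mul] at hk
    simp only [List.map_append, List.map_cons, List.prod_append, List.prod_cons, List.sum_append,
      List.sum_cons] at hV hxl
    set P := (l₁.map Prod.snd).prod with hP
    have hS : gp H R₁⁻¹ R₁⁻¹⁻¹ < len H R₁⁻¹ := by
      rw [inv_inv, hH.gp_comm, hH.len_inv]
      exact g1.hyperbolic hH hR
    have q1 : len H (R₁⁻¹⁻¹ * (P * R₁)⁻¹) = len H P := by
      rw [← hH.len_inv P]; congr 1; group
    have q2 : len H (R₂⁻¹ * (P * R₁)⁻¹) = len H (P * R₁ * R₂) := by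
      rw [← hH.len_inv (P * R₁ * R₂)]; congr 1; group
    have q3 : len H (R₁⁻¹⁻¹ * (R₂⁻¹ * (P * R₁)⁻¹)) = len H (P * (R₁ * R₂ * R₁⁻¹)) := by
      rw [← hH.len_inv (P * _)]; congr 1; group
    have q4 : len H (R₂⁻¹ * (R₁⁻¹⁻¹ * (P * R₁)⁻¹)) = len H (P * R₂) := by
      rw [← hH.len_inv (P * R₂)]; congr 1; group
    have hz := hH.hurwitz (N := (P * R₁)⁻¹) hS (g2.hyperbolic hH hR)
      (by rw [q1, hH.len_inv]; exact k1) (by rw [q2, hH.len_inv]; exact k2)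
    rw [q3, q4, hH.len_inv] at hz
    rcases hz with hz | hz | ⟨h, z1, z2, z3, z4, z5⟩
    · have e1 : P * (R₁ * R₂ * R₁⁻¹) * R₁ = P * R₁ * R₂ := by group
      refine ihk _ ?_ (l₁ ++ (v₂, R₁ * R₂ * R₁⁻¹) :: (v₁, R₁) :: l₂) ?_ rfl ?_ ?_ ?_
      · rw [height_append]
        simp only [height, one_mul]
        rw [← hP, e1]
        omega
      · simpa using hm
      · intro p hp
        simp only [List.mem_append, List.mem_cons] at hp
        rcases hp with hp | rfl | rfl | hp
        · exact hl1 p hp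
        · simpa using g2.conj R₁⁻¹
        · exact g1
        · exact hl2 p hp
      · simp; omega
      · simp only [List.map_append, List.map_cons, List.prod_append, List.prod_cons]
        rw [← hxl, ← hP]; group
    · have e1 : P * R₂ * (R₂⁻¹ * R₁ * R₂) = P * R₁ * R₂ := by group
      refine ihk _ ?_ (l₁ ++ (v₂, R₂) :: (v₁, R₂⁻¹ * R₁ * R₂) :: l₂) ?_ rfl ?_ ?_ ?_
      · rw [height_append]
        simp only [height, one_mul]
        rw [← hP, e1]
        omega
      · simpa using hm
      · intro p hp
        simp only [List.mem_append, List.mem_cons] at hp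
        rcases hp with hp | rfl | rfl | hp
        · exact hl1 p hp
        · exact g2
        · exact g1.conj R₂
        · exact hl2 p hp
      · simp; omega
      · simp only [List.map_append, List.map_cons, List.prod_append, List.prod_cons]
        rw [← hxl, ← hP]; group
    · have e1 : h⁻¹ * R₁⁻¹ * h = (h⁻¹ * R₁ * h)⁻¹ := by group
      rw [e1, inv_inv, hH.gp_comm] at z1
      rw [e1, hH.len_inv] at z2
      rw [e1] at z5
      rcases g1.merge hH hR g2 z1 z2 z3 z5 with ⟨n, h1, h2⟩ | h1
      · refine absurd (((ConjProd.of_good hl1).mul' h2).mul' (ConjProd.of_good hl2)) ?_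
        rw [← hP, mul_assoc, mul_assoc, hxl]
        exact hmin _ (by omega)
      · refine ihm _ ?_ _ (l₁ ++ (v₁ + v₂, R₁ * R₂) :: l₂) rfl rfl ?_ ?_ ?_
        · rw [← hm]; simp
        · intro p hp
          simp only [List.mem_append, List.mem_cons] at hp
          rcases hp with hp | rfl | hp
          · exact hl1 p hp
          · exact h1
          · exact hl2 p hp
        · simp; omega
        · simp only [List.map_append, List.map_cons, List.prod_append, List.prod_cons]
          rw [← hxl, ← hP]; group

/-- The factors embed into the quotient by the relator. -/
theorem freiheitssatz [NeZero L] (hH : IsFreeProduct H) (hR : Relator H X τ rank) {i : Bool}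
    {x : G} (hx : x ∈ H i) (hx' : x ∈ Subgroup.normalClosure {rot X 0}) : x = 1 := by
  classical
  have hex := ConjProd.exists_of_mem hx'
  obtain ⟨l, h1, h2, h3⟩ := (Nat.find_spec hex).exists_good hR
  exact eq_one_of_good hH hR hx (fun n hn => Nat.find_min hex hn) _ _ l rfl rfl h1 h2 h3

end

end

section

variable {G : Type*} [Group G]

theorem IsFreeProduct.exists_cyclically_reduced {H : Bool → Subgroup G} (hH : IsFreeProduct H)
    (u : G) (hu : ∀ i g, g * u * g⁻¹ ∉ H i) : ∃ (i : Bool) (l : List G) (g : G), Red H i l ∧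
      l.length.bodd = false ∧ l ≠ [] ∧ u = g * l.prod * g⁻¹ := by
  induction hn : len H u using Nat.strong_induction_on generalizing u with
  | _ n ih =>
  subst hn
  have hr := hH.red_nf u
  have hp := hH.prod_nf u
  have hl : len H u = (nf H u).length := rfl
  generalize nf H u = l at *
  generalize fst H u = i at *
  by_cases he : l.length.bodd = false
  · refine ⟨i, l, 1, hr, he, ?_, by simp [hp]⟩
    rintro rfl
    refine hu true 1 ?_
    simp [← hp]
  · match l, hr, hp, hl, he with
    | [], _, _, _, he => simp at he
    | x :: l', hr, hp, hl, he =>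
      rcases List.eq_nil_or_concat l' with rfl | ⟨s, y, rfl⟩
      · refine absurd ?_ (hu i 1)
        simpa [← hp] using hr.1.1
      · rw [List.concat_eq_append] at *
        have hs : s.length.bodd = true := by simpa using he
        rw [Red, alt_cons, alt_append, hs] at hr
        have hy : Letter H i y := by simpa using hr.2.2.1
        have e : x⁻¹ * u * x = s.prod * (y * x) := by
          rw [← hp]; simp [mul_assoc]
        have hlt : len H (x⁻¹ * u * x) < len H u := by
          rw [e, hl]
          by_cases hyx : y * x = 1
          · rw [hyx, mul_one, hH.len_eq hr.2.1]
            simp only [List.length_cons, List.length_append]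
            omega
          · have : Red H (!i) (s ++ [y * x]) := by
              rw [Red, alt_append, hs]
              exact ⟨hr.2.1, by simpa using ⟨mul_mem hy.1 hr.1.1, hyx⟩⟩
            have := hH.len_eq this
            simp only [List.prod_append, List.prod_singleton, List.length_append,
              List.length_singleton] at this
            rw [this]
            simp
        obtain ⟨i', l'', g, h1, h2, h3, h4⟩ := ih _ hlt _ (fun j g => by
          have := hu j (g * x⁻¹)
          simpa [mul_assoc] using this) rfl
        refine ⟨i', l'', x * g, h1, h2, h3, ?_⟩
        rw [mul_inv_rev, show x * g * l''.prod * (g⁻¹ * x⁻¹) = x * (g * l''.prod * g⁻¹) * x⁻¹ by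
          group, ← h4]
        group

theorem Alt.getElem {α : Type*} {p : Bool → α → Prop} {i : Bool} {l : List α} (h : Alt p i l)
    (n : ℕ) (hn : n < l.length) : p (i ^^ n.bodd) l[n] := by
  induction l generalizing i n with
  | nil => simp at hn
  | cons x xs ih =>
    cases n with
    | zero => simpa using h.1
    | succ n =>
      have := ih h.2 n (by simpa using hn)
      simpa [Nat.bodd_succ] using this

section
variable {L : ℕ} (X : ZMod L → G)

theorem seg_add (t : ZMod L) (m n : ℕ) : seg X t (m + n) = seg X t m * seg X (t + m) n := by
  induction n with
  | zero => simp [seg]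
  | succ n ih => rw [← add_assoc, seg_succ, ih, seg_succ]; push_cast; simp [mul_assoc, add_assoc]

theorem seg_mul {d : ℕ} (hd : ∀ t, X (t + d) = X t) (n : ℕ) : seg X 0 (d * n) = seg X 0 d ^ n := by
  have h : ∀ (n : ℕ) (t : ZMod L), X (t + (d * n : ℕ)) = X t := by
    intro n
    induction n with
    | zero => simp
    | succ n ih =>
      intro t
      rw [mul_add, Nat.cast_add, ← add_assoc, mul_one, hd, ih]
  induction n with
  | zero => simp [seg]
  | succ n ih =>
    rw [mul_add, mul_one, seg_add, ih, pow_succ]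
    congr 1
    simp only [seg]
    congr 1
    refine List.map_congr_left fun r _ => ?_
    have := h n (0 + r)
    rwa [add_right_comm] at this

theorem shift_eq_zero [NeZero L] (hpow : ¬∃ (v : G) (j : ℕ), 2 ≤ j ∧ rot X 0 = v ^ j) (s : ZMod L)
    (hs : ∀ t, X (t + s) = X t) : s = 0 := by
  by_contra hne
  have hmul : ∀ (n : ℕ) (t : ZMod L), X (t + n * s) = X t := by
    intro n
    induction n with
    | zero => simp
    | succ n ih =>
      intro t
      rw [Nat.cast_succ, add_mul, one_mul, ← add_assoc, hs, ih]
  have hd : ∀ t, X (t + (Nat.gcd s.val L : ℕ)) = X t := by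
    intro t
    have h := Nat.gcd_eq_gcd_ab s.val L
    have h' := congrArg (Int.cast : ℤ → ZMod L) h
    push_cast at h'
    rw [ZMod.natCast_zmod_val, ZMod.natCast_self, zero_mul, add_zero, mul_comm] at h'
    have h2 := hmul ((Nat.gcdA s.val L : ZMod L)).val t
    rw [ZMod.natCast_zmod_val, ← h'] at h2
    exact h2
  have hpos : 0 < s.val := Nat.pos_of_ne_zero fun h => hne ((ZMod.val_eq_zero s).1 h)
  have hle := Nat.le_of_dvd hpos (Nat.gcd_dvd_left s.val L)
  have hlt := s.val_lt
  obtain ⟨n, hn⟩ := Nat.gcd_dvd_right s.val L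
  refine hpow ⟨seg X 0 (Nat.gcd s.val L), n, ?_, ?_⟩
  · by_contra h
    have : n = 0 ∨ n = 1 := by omega
    rcases this with h | h
    · rw [h, mul_zero] at hn
      exact NeZero.ne L hn
    · rw [h, mul_one] at hn
      omega
  · rw [← seg_mul X hd n, ← hn, rot]

end

theorem exists_relator {H : Bool → Subgroup G} {Pos : Bool → G → Prop} (hP : Cone H Pos)
    {i : Bool} {l : List G} (hl : Red H i l) (he : l.length.bodd = false) (hne : l ≠ [])
    (hpow : ¬∃ (v : G) (j : ℕ), 2 ≤ j ∧ l.prod = v ^ j) :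
    ∃ (L : ℕ) (_ : NeZero L) (X : ZMod L → G) (τ : ZMod L → Bool) (rank : ZMod L → ℕ),
      Relator H X τ rank ∧ rot X 0 = l.prod := by
  have hn : NeZero l.length := ⟨by simpa using hne⟩
  have hL : Even l.length := by
    rw [Nat.even_iff, Nat.mod_two_of_bodd, he]
    rfl
  set X : ZMod l.length → G := fun t => l[t.val]'t.val_lt with hX
  have hrot : rot X 0 = l.prod := by
    rw [rot, seg]
    congr 1
    refine List.ext_getElem (by simp) fun n h1 h2 => ?_
    simp [hX, ZMod.val_natCast, Nat.mod_eq_of_lt h2]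
  have hτ : ∀ t : ZMod l.length, (i ^^ (t + 1).val.bodd) = !(i ^^ t.val.bodd) := by
    intro t
    rcases Nat.lt_or_ge (t.val + 1) l.length with h | h
    · have : 1 < l.length := by omega
      have h1 : (1 : ZMod l.length).val = 1 := by
        have : Fact (1 < l.length) := ⟨this⟩
        exact ZMod.val_one _
      rw [ZMod.val_add_of_lt (by rw [h1]; exact h), h1]
      simp
    · have h2 : t.val + 1 = l.length := le_antisymm t.val_lt h
      have h3 : t + 1 = 0 := by
        rw [← ZMod.natCast_zmod_val t, ← Nat.cast_succ, Nat.succ_eq_add_one, h2]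
        simp
      rw [h3, ZMod.val_zero]
      have h4 : (t.val + 1).bodd = false := by rw [h2, he]
      rw [Nat.bodd_succ] at h4
      cases i <;> simp_all
  have hlet : ∀ t : ZMod l.length, Letter H (i ^^ t.val.bodd) (X t) :=
    fun t => Alt.getElem hl _ _
  obtain ⟨rank, h1, h2⟩ := exists_rank hP hL X (fun t => i ^^ t.val.bodd) hτ hlet
    (shift_eq_zero X (by rwa [hrot]))
  exact ⟨l.length, hn, X, _, rank, ⟨hL, hτ, hlet, h1, h2⟩, hrot⟩

/-- The normal closure of an element that is neither a proper power nor conjugate into a factor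
meets the factors trivially. -/
theorem eq_one_of_mem_factor {H : Bool → Subgroup G} (hH : IsFreeProduct H)
    {Pos : Bool → G → Prop} (hP : Cone H Pos) {i : Bool} {l : List G} {g u : G} (h1 : Red H i l)
    (h2 : l.length.bodd = false) (h3 : l ≠ []) (h4 : u = g * l.prod * g⁻¹)
    (hpow : ¬∃ (v : G) (j : ℤ), 2 ≤ j ∧ u = v ^ j) (j : Bool) (x : G) (hx : x ∈ H j)
    (hxu : x ∈ Subgroup.normalClosure {u}) : x = 1 := by
  have hpow' : ¬∃ (v : G) (j : ℕ), 2 ≤ j ∧ l.prod = v ^ j := by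
    rintro ⟨v, j, hj, hv⟩
    refine hpow ⟨g * v * g⁻¹, j, by exact_mod_cast hj, ?_⟩
    rw [zpow_natCast, conj_pow, ← hv, h4]
  obtain ⟨L, _, X, τ, rank, hR, hrot⟩ := exists_relator hP h1 h2 h3 hpow'
  refine freiheitssatz hH hR hx ?_
  rw [hrot]
  refine Subgroup.normalClosure_le_normal ?_ hxu
  rw [Set.singleton_subset_iff, h4]
  exact Subgroup.normalClosure_normal.conj_mem _
    (Subgroup.subset_normalClosure (Set.mem_singleton _)) g

section Coprod
open Monoid
variable {A B : Type*} [Group A] [Group B]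

theorem exists_positive (hA : IsRightOrderable A) : ∃ P : A → Prop,
    (∀ x y, P x → P y → P (x * y)) ∧ (∀ x, x ≠ 1 → P x ∨ P x⁻¹) ∧ ∀ x, P x → ¬P x⁻¹ := by
  obtain ⟨lt, ho, h⟩ := hA
  have hinv : ∀ x, lt x 1 → lt 1 x⁻¹ := fun x hx => by simpa using h _ _ x⁻¹ hx
  refine ⟨fun x => lt 1 x, fun x y hx hy => ?_, fun x hx => ?_, fun x hx hx' => ?_⟩
  · exact _root_.trans hy (by simpa using h _ _ y hx)
  · rcases trichotomous_of lt 1 x with h1 | h1 | h1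
    · exact Or.inl h1
    · exact absurd h1.symm hx
    · exact Or.inr (hinv x h1)
  · have : lt x 1 := by simpa using h _ _ x hx'
    exact irrefl_of lt 1 (_root_.trans hx this)

theorem exists_cone (hA : IsRightOrderable A) (hB : IsRightOrderable B) :
    ∃ Pos, Cone (factor A B) Pos := by
  obtain ⟨P, p1, p2, p3⟩ := exists_positive hA
  obtain ⟨Q, q1, q2, q3⟩ := exists_positive hB
  refine ⟨fun i x => match i with
    | true => ∃ a, P a ∧ (Coprod.inl a : Coprod A B) = x
    | false => ∃ b, Q b ∧ (Coprod.inr b : Coprod A B) = x, ⟨?_, ?_, ?_⟩⟩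
  · rintro (_ | _) x y ⟨a, ha, rfl⟩ ⟨b, hb, rfl⟩
    · exact ⟨_, q1 _ _ ha hb, map_mul _ _ _⟩
    · exact ⟨_, p1 _ _ ha hb, map_mul _ _ _⟩
  · rintro (_ | _) x ⟨⟨a, rfl⟩, hx⟩
    · exact (q2 a fun h => hx (by rw [h, map_one])).imp (fun h => ⟨_, h, rfl⟩)
        fun h => ⟨_, h, map_inv _ _⟩
    · exact (p2 a fun h => hx (by rw [h, map_one])).imp (fun h => ⟨_, h, rfl⟩)
        fun h => ⟨_, h, map_inv _ _⟩
  · rintro (_ | _) x ⟨a, ha, rfl⟩ ⟨b, hb, hab⟩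
    · rw [← map_inv] at hab
      exact q3 a ha (by rwa [← Coprod.inr_injective hab])
    · rw [← map_inv] at hab
      exact p3 a ha (by rwa [← Coprod.inl_injective hab])

end Coprod

end

section

variable {G : Type*} [Group G]

/-- Actions of a free product on `Q × M` over the left translation action on `Q`: the first
factor preserves the second coordinate and the second factor twists it by the coboundary
of `δ`. -/
theorem exists_twisted_action {A B Q M : Type*} [Group A] [Group B] [Group Q] [AddCommGroup M]
    (ψ : Monoid.Coprod A B →* Q) (δ : Q → M) : ∃ φ : Monoid.Coprod A B →* Equiv.Perm (Q × M),
      (∀ x ∈ factor A B true, ∀ q m, φ x (q, m) = (ψ x * q, m)) ∧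
      ∀ x ∈ factor A B false, ∀ q m, φ x (q, m) = (ψ x * q, m - δ q + δ (ψ x * q)) := by
  let f : A →* Function.End (Q × M) :=
    { toFun := fun a x => (ψ (Monoid.Coprod.inl a) * x.1, x.2)
      map_one' := funext fun x => by
        change (ψ (Monoid.Coprod.inl 1) * x.1, x.2) = x
        simp
      map_mul' := fun a b => funext fun x => by
        change _ = (ψ (Monoid.Coprod.inl a) * (ψ (Monoid.Coprod.inl b) * x.1), x.2)
        simp [mul_assoc] }
  let t : B → Q × M → Q × M := fun b x =>
    (ψ (Monoid.Coprod.inr b) * x.1, x.2 - δ x.1 + δ (ψ (Monoid.Coprod.inr b) * x.1))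
  let g : B →* Function.End (Q × M) :=
    { toFun := t
      map_one' := funext fun x => by
        change t 1 x = x
        simp [t]
      map_mul' := fun a b => funext fun x => by
        change t (a * b) x = t a (t b x)
        simp [t, mul_assoc] }
  refine ⟨Monoid.Coprod.lift (MonoidHom.toHomPerm f) (MonoidHom.toHomPerm g), ?_, ?_⟩
  · rintro x ⟨a, rfl⟩ q m
    rw [Monoid.Coprod.lift_apply_inl]
    rfl
  · rintro x ⟨b, rfl⟩ q m
    rw [Monoid.Coprod.lift_apply_inr]
    rfl

section
variable {H : Bool → Subgroup G} {Q M : Type*} [Group Q] [AddCommGroup M] {ψ : G →* Q} {δ : Q → M}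
  {φ : G →* Equiv.Perm (Q × M)}

theorem exists_cocycle (hH : IsFreeProduct H)
    (hA : ∀ x ∈ H true, ∀ q m, φ x (q, m) = (ψ x * q, m))
    (hB : ∀ x ∈ H false, ∀ q m, φ x (q, m) = (ψ x * q, m - δ q + δ (ψ x * q))) (g : G) (q : Q) :
    ∃ c : M, ∀ m, φ g (q, m) = (ψ g * q, m + c) := by
  obtain ⟨i, l, hl, rfl⟩ := hH.exists_red g
  induction l generalizing i with
  | nil => exact ⟨0, by simp⟩
  | cons x l ih =>
    obtain ⟨c, hc⟩ := ih _ hl.2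
    cases i with
    | true =>
      refine ⟨c, fun m => ?_⟩
      rw [List.prod_cons, map_mul, map_mul, Equiv.Perm.mul_apply, hc, hA x hl.1.1, mul_assoc]
    | false =>
      refine ⟨c - δ (ψ l.prod * q) + δ (ψ x * (ψ l.prod * q)), fun m => ?_⟩
      rw [List.prod_cons, map_mul, map_mul, Equiv.Perm.mul_apply, hc, hB x hl.1.1, mul_assoc]
      congr 1
      abel

theorem pow_apply_eq_self (hH : IsFreeProduct H)
    (hA : ∀ x ∈ H true, ∀ q m, φ x (q, m) = (ψ x * q, m))
    (hB : ∀ x ∈ H false, ∀ q m, φ x (q, m) = (ψ x * q, m - δ q + δ (ψ x * q))) {e : ℕ}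
    (he : ∀ m : M, e • m = 0) {y : G} (hy : ψ y = 1) : φ (y ^ e) = 1 := by
  refine Equiv.ext fun ⟨q, m⟩ => ?_
  obtain ⟨c, hc⟩ := exists_cocycle hH hA hB y q
  have h : ∀ n : ℕ, φ (y ^ n) (q, m) = (q, m + n • c) := by
    intro n
    induction n with
    | zero => simp
    | succ n ih =>
      rw [pow_succ', map_mul, Equiv.Perm.mul_apply, ih, hc, hy, one_mul, succ_nsmul, add_assoc]
  rw [h, he]
  simp

theorem apply_eq_of_ne_one (hA : ∀ x ∈ H true, ∀ q m, φ x (q, m) = (ψ x * q, m))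
    (hB : ∀ x ∈ H false, ∀ q m, φ x (q, m) = (ψ x * q, m - δ q + δ (ψ x * q)))
    (hδ : ∀ q, q ≠ 1 → δ q = 0) {i : Bool} {l : List G} (hl : Red H i l) {q : Q}
    (hq : ∀ l', l' <:+ l → ψ l'.prod * q ≠ 1) (m : M) : φ l.prod (q, m) = (ψ l.prod * q, m) := by
  induction l generalizing i with
  | nil => simp
  | cons x l ih =>
    have h1 := hq l (List.suffix_cons _ _)
    have h2 := hq _ List.suffix_rfl
    rw [List.prod_cons, map_mul, mul_assoc] at h2
    rw [List.prod_cons, map_mul, map_mul, Equiv.Perm.mul_apply,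
      ih hl.2 fun l' h => hq l' (h.trans (List.suffix_cons _ _)), mul_assoc]
    cases i with
    | true => rw [hA x hl.1.1]
    | false => rw [hB x hl.1.1, hδ _ h1, hδ _ h2, sub_zero, add_zero]

theorem eq_one_of_apply_eq_one (hH : IsFreeProduct H)
    (hA : ∀ x ∈ H true, ∀ q m, φ x (q, m) = (ψ x * q, m))
    (hB : ∀ x ∈ H false, ∀ q m, φ x (q, m) = (ψ x * q, m - δ q + δ (ψ x * q)))
    (hδ : ∀ q, q ≠ 1 → δ q = 0) (hδ1 : δ 1 ≠ 0) (hψ : ∀ i, ∀ x ∈ H i, ψ x = 1 → x = 1)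
    (hφ : ∀ w, ψ w = 1 → φ w = 1) (w : G) (hw : ψ w = 1) : w = 1 := by
  induction hn : len H w using Nat.strong_induction_on generalizing w with
  | _ n ih =>
  subst hn
  have hr := hH.red_nf w
  have hp := hH.prod_nf w
  have hl : len H w = (nf H w).length := rfl
  generalize nf H w = l at *
  generalize fst H w = i at *
  match l, hr, hp, hl with
  | [], _, hp, _ => simpa using hp.symm
  | [x], hr, hp, _ =>
    have hp : x = w := by simpa using hp
    subst hp
    exact hψ i _ hr.1.1 hw
  | x :: y :: l, hr, hp, hl =>
    exfalso
    have hx : Letter H i x := hr.1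
    have hy : Letter H (!i) y := hr.2.1
    have hl2 : Red H i l := by simpa using hr.2.2
    set q : Q := ψ (y * l.prod)⁻¹ with hq
    have hyq : ψ y * (ψ l.prod * q) = 1 := by
      rw [hq, map_inv, map_mul, ← mul_assoc, mul_inv_cancel]
    have hyne : ψ l.prod * q ≠ 1 := by
      intro h
      rw [h, mul_one] at hyq
      exact hy.2 (hψ _ _ hy.1 hyq)
    have hxne : ψ x * 1 ≠ 1 := by
      rw [mul_one]
      exact fun h => hx.2 (hψ _ _ hx.1 h)
    have hsuf : ∀ l', l' <:+ l → ψ l'.prod * q ≠ 1 := by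
      rintro l' ⟨s, rfl⟩ h
      have hred : Red H (!i) (y :: s) := by
        have := hr.2
        rw [show y :: (s ++ l') = (y :: s) ++ l' from rfl, alt_append] at this
        exact this.1
      have h1 : ψ (y :: s).prod = 1 := by
        rw [List.prod_append, map_mul, mul_assoc, h, mul_one] at hyq
        rw [List.prod_cons, map_mul, hyq]
      have h2 := hH.len_eq hred
      refine absurd (ih _ ?_ _ h1 rfl) ?_
      · rw [h2, hl]
        simp only [List.length_cons, List.length_append]
        omega
      · intro h3
        rw [h3, hH.len_one] at h2
        simp at h2
    have h1 := congrArg (fun f => (f (q, (0 : M))).2) (hφ w hw)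
    rw [← hp] at h1
    simp only [List.prod_cons, map_mul, Equiv.Perm.mul_apply, Equiv.Perm.one_apply] at h1
    rw [apply_eq_of_ne_one hA hB hδ hl2 hsuf] at h1
    cases i with
    | true =>
      rw [hB y hy.1, hyq, hA x hx.1, hδ _ hyne] at h1
      simp at h1
      exact hδ1 h1
    | false =>
      rw [hA y hy.1, hyq, hB x hx.1, hδ _ hxne] at h1
      simp at h1
      exact hδ1 h1

end

/-- A normal subgroup meeting the factors trivially is not normally generated by a proper power
of one of its nontrivial elements. -/
theorem eq_one_of_normalClosure_pow {A B : Type*} [Group A] [Group B]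
    {N : Subgroup (Monoid.Coprod A B)} [N.Normal]
    (hN : ∀ i, ∀ x ∈ factor A B i, x ∈ N → x = 1) {y : Monoid.Coprod A B} (hy : y ∈ N) {e : ℕ}
    (he : 2 ≤ e) (hle : N ≤ Subgroup.normalClosure {y ^ e}) : y = 1 := by
  classical
  have hH := isFreeProduct_factor (A := A) (B := B)
  have : Fact (1 < e) := ⟨he⟩
  set ψ := QuotientGroup.mk' N with hψ
  have hmem : ∀ x, ψ x = 1 ↔ x ∈ N := fun x => by
    rw [hψ, QuotientGroup.mk'_apply, QuotientGroup.eq_one_iff]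
  set δ : Monoid.Coprod A B ⧸ N → ZMod e := fun q => if q = 1 then 1 else 0 with hδ
  obtain ⟨φ, hA, hB⟩ := exists_twisted_action ψ δ
  have h1 : φ (y ^ e) = 1 :=
    pow_apply_eq_self hH hA hB (fun m => by simp) ((hmem y).2 hy)
  refine eq_one_of_apply_eq_one hH hA hB (fun q hq => by simp [hδ, hq]) (by simp [hδ])
    (fun i x hx h => hN i x hx ((hmem x).1 h)) (fun w hw => ?_) y ((hmem y).2 hy)
  have h2 : Subgroup.normalClosure {y ^ e} ≤ φ.ker :=
    Subgroup.normalClosure_le_normal (by simpa [MonoidHom.mem_ker] using h1)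
  exact h2 (hle ((hmem w).1 hw))

end

section

variable {G : Type*} [Group G]

theorem IsFreeProduct.pow_prod_ne_one {H : Bool → Subgroup G} (hH : IsFreeProduct H) {i : Bool}
    {l : List G} (hl : Red H i l) (he : l.length.bodd = false) (hne : l ≠ []) {n : ℕ}
    (hn : n ≠ 0) : l.prod ^ n ≠ 1 := by
  have h : ∀ n : ℕ, ∃ l', Red H i l' ∧ l'.prod = l.prod ^ n ∧ l'.length = n * l.length := by
    intro n
    induction n with
    | zero => exact ⟨[], trivial, by simp, by simp⟩
    | succ n ih =>
      obtain ⟨l', h1, h2, h3⟩ := ih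
      refine ⟨l ++ l', ?_, by simp [h2, pow_succ'], by simp [h3]; ring⟩
      rw [Red, alt_append, he]
      exact ⟨hl, by simpa using h1⟩
  obtain ⟨l', h1, h2, h3⟩ := h n
  intro h4
  have h5 := hH.len_eq h1
  rw [h2, h4, hH.len_one, h3] at h5
  rcases Nat.mul_eq_zero.1 h5.symm with h6 | h6
  · exact hn h6
  · exact hne (List.length_eq_zero_iff.1 h6)

end

end FreeProductPower

/-- If `A` and `B` are right-orderable, `u ∈ A ∗ B` has no conjugate in the image of `A`
or of `B`, and `u` is not a proper power, then for every `k ≥ 2` the image of `u` in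
`(A ∗ B)/⟪uᵏ⟫` has order exactly `k`; equivalently, `uᵐ ∈ ⟪uᵏ⟫` iff `k ∣ m`. -/
theorem order_of_u_in_quotient_by_power
    {A B : Type*} [Group A] [Group B]
    (hA : IsRightOrderable A) (hB : IsRightOrderable B)
    (u : Monoid.Coprod A B)
    (huA : ∀ g : Monoid.Coprod A B,
      g * u * g⁻¹ ∉ (Monoid.Coprod.inl : A →* Monoid.Coprod A B).range)
    (huB : ∀ g : Monoid.Coprod A B,
      g * u * g⁻¹ ∉ (Monoid.Coprod.inr : B →* Monoid.Coprod A B).range)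
    (hpow : ¬ ∃ (v : Monoid.Coprod A B) (j : ℤ), 2 ≤ j ∧ u = v ^ j)
    (k : ℕ) (hk : 2 ≤ k) :
    orderOf (QuotientGroup.mk u :
        Monoid.Coprod A B ⧸ Subgroup.normalClosure {u ^ k}) = k ∧
    ∀ m : ℤ, u ^ m ∈ Subgroup.normalClosure {u ^ k} ↔ (k : ℤ) ∣ m := by
  classical
  have hu : ∀ i g, g * u * g⁻¹ ∉ FreeProductPower.factor A B i := by
    rintro (_ | _) g
    · exact huB g
    · exact huA g
  have hH := FreeProductPower.isFreeProduct_factor (A := A) (B := B)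
  obtain ⟨Pos, hP⟩ := FreeProductPower.exists_cone hA hB
  obtain ⟨i, l, g, h1, h2, h3, h4⟩ := hH.exists_cyclically_reduced u hu
  have hle : Subgroup.normalClosure {u ^ k} ≤ Subgroup.normalClosure {u} :=
    Subgroup.normalClosure_le_normal (Set.singleton_subset_iff.2
      (pow_mem (Subgroup.subset_normalClosure (Set.mem_singleton u)) k))
  have hN : ∀ j, ∀ x ∈ FreeProductPower.factor A B j,
      x ∈ Subgroup.normalClosure {u ^ k} → x = 1 := fun j x hx hxN =>
    FreeProductPower.eq_one_of_mem_factor hH hP h1 h2 h3 h4 hpow j x hx (hle hxN)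
  have huk : u ^ k ∈ Subgroup.normalClosure {u ^ k} :=
    Subgroup.subset_normalClosure (Set.mem_singleton _)
  have key : ∀ m : ℤ, u ^ m ∈ Subgroup.normalClosure {u ^ k} ↔ (k : ℤ) ∣ m := by
    intro m
    constructor
    · intro hm
      have hd : u ^ Int.gcd m k ∈ Subgroup.normalClosure {u ^ k} := by
        have e : u ^ Int.gcd m k = (u ^ m) ^ Int.gcdA m k * (u ^ k) ^ Int.gcdB m k := by
          rw [← zpow_natCast u (Int.gcd m k), Int.gcd_eq_gcd_ab, zpow_add, zpow_mul, zpow_mul,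
            zpow_natCast]
        rw [e]
        exact mul_mem (zpow_mem hm _) (zpow_mem huk _)
      obtain ⟨e, he⟩ : Int.gcd m k ∣ k := Int.natCast_dvd_natCast.1 (Int.gcd_dvd_right _ _)
      have he2 : ¬2 ≤ e := by
        intro he2
        have h5 := FreeProductPower.eq_one_of_normalClosure_pow hN hd he2
          (by rw [← pow_mul, ← he])
        rw [h4, conj_pow, conj_eq_one_iff] at h5
        refine hH.pow_prod_ne_one h1 h2 h3 ?_ h5
        intro h6
        rw [h6, zero_mul] at he
        omega
      have he1 : e = 1 := by
        rcases Nat.eq_zero_or_pos e with h | h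
        · rw [h, mul_zero] at he
          omega
        · omega
      rw [he1, mul_one] at he
      rw [he]
      exact Int.gcd_dvd_left _ _
    · rintro ⟨c, rfl⟩
      rw [zpow_mul, zpow_natCast]
      exact zpow_mem huk c
  refine ⟨?_, key⟩
  have hord : ∀ n : ℕ, orderOf (QuotientGroup.mk u :
      Monoid.Coprod A B ⧸ Subgroup.normalClosure {u ^ k}) ∣ n ↔ k ∣ n := by
    intro n
    have h := key n
    rw [zpow_natCast, Int.natCast_dvd_natCast] at h
    rw [orderOf_dvd_iff_pow_eq_one, ← QuotientGroup.mk_pow, QuotientGroup.eq_one_iff]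
    exact h
  exact Nat.dvd_antisymm ((hord k).2 dvd_rfl) ((hord _).1 dvd_rfl)
end

section
/- Let A and B be countable right-orderable groups, G = A ∗ B, and let w = a₁b₁⋯aₙbₙ ∈ G be a cyclically reduced word of length 2n with n ≥ 1. If there exists a relative stacking of w, then there exists a relative stacking (σ′, x′) of w in which the homomorphism σ′ from G to the group of order-preserving bijections of ℝ is injective (i.e., the action is faithful). -/
/-- A right action of `G` on `ℝ` by orientation-preserving homeomorphisms, i.e. a map
to order-preserving bijections of `ℝ` satisfying `x·σ(gh) = (x·σ(g))·σ(h)`. -/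
def IsRightAction {G : Type*} [Group G] (σ : G → (ℝ ≃o ℝ)) : Prop :=
  ∀ g h : G, σ (g * h) = (σ g).trans (σ h)

/-- The list of letters `a₁, b₁, …, aₙ, bₙ` of the word `w = a₁b₁⋯aₙbₙ` in `A ∗ B`. -/
def wordLetters {A B : Type*} [Group A] [Group B] {n : ℕ}
    (a : Fin n → A) (b : Fin n → B) : List (Monoid.Coprod A B) :=
  (List.finRange n).flatMap fun i => [Monoid.Coprod.inl (a i), Monoid.Coprod.inr (b i)]

/-- A relative stacking of the cyclically reduced word `w = a₁b₁⋯aₙbₙ`: a right action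
`σ` of `A ∗ B` on `ℝ` and `x ∈ ℝ` with `x·σ(w) = x` and the `2n` points `x·σ(u)`, for
`u` a nonempty prefix of `w`, pairwise distinct. -/
def IsRelativeStacking {A B : Type*} [Group A] [Group B] {n : ℕ}
    (a : Fin n → A) (b : Fin n → B)
    (σ : Monoid.Coprod A B → (ℝ ≃o ℝ)) (x : ℝ) : Prop :=
  IsRightAction σ ∧
  σ ((wordLetters a b).prod) x = x ∧
  ∀ m₁ m₂ : ℕ, 1 ≤ m₁ → m₁ ≤ 2 * n → 1 ≤ m₂ → m₂ ≤ 2 * n →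
    σ (((wordLetters a b).take m₁).prod) x = σ (((wordLetters a b).take m₂).prod) x →
    m₁ = m₂

open Order Monoid

/-- Every nonempty open interval contains points whose label avoids a prescribed finite set. -/
def LabelsDense {β K : Type*} [LT β] (o : β → K) : Prop :=
  ∀ l u : β, l < u → ∀ F : Finset K, ∃ z, l < z ∧ z < u ∧ o z ∉ F

theorem labelsDense_snd (α : Type*) [LinearOrder α] :
    LabelsDense fun x : α ×ₗ ℚ => (ofLex x).2 := by
  intro l u hlu F
  rcases Prod.Lex.lt_iff.1 hlu with h | ⟨h, h'⟩
  · obtain ⟨q, hq, hqF⟩ := (Set.Ioi_infinite (ofLex l).2).exists_notMem_finset F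
    exact ⟨toLex ((ofLex l).1, q), Prod.Lex.lt_iff.2 (Or.inr ⟨rfl, hq⟩),
      Prod.Lex.lt_iff.2 (Or.inl h), hqF⟩
  · obtain ⟨q, hq, hqF⟩ := (Set.Ioo_infinite h').exists_notMem_finset F
    exact ⟨toLex ((ofLex l).1, q), Prod.Lex.lt_iff.2 (Or.inr ⟨rfl, hq.1⟩),
      Prod.Lex.lt_iff.2 (Or.inr ⟨h, hq.2⟩), hqF⟩

section PartialIso

variable {α β K : Type*} [LinearOrder α] [LinearOrder β]

theorem Order.PartialIso.mem_comm (p : PartialIso α β) (x : α) (z : β) :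
    (z, x) ∈ p.comm.val ↔ (x, z) ∈ p.val := by
  change (z, x) ∈ p.val.image _ ↔ _
  simp

theorem Order.PartialIso.exists_insert_left [DenselyOrdered β] [NoMinOrder β] [NoMaxOrder β]
    [Nonempty β] {o : β → K} (ho : LabelsDense o) (f : PartialIso α β) (a : α)
    (ha : ∀ b, (a, b) ∉ f.val) (F : Finset K) :
    ∃ (q : PartialIso α β) (b : β), o b ∉ F ∧
      ∀ y, y ∈ q.val ↔ y = (a, b) ∨ y ∈ f.val := by
  obtain ⟨b₁, hb₁⟩ := f.exists_across a
  obtain ⟨b₂, h₁, h₂⟩ := exists_between_finsets {b₁} {x ∈ f.val.image Prod.snd | b₁ < x}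
    (by simp)
  obtain ⟨z, hz₁, hz₂, hzF⟩ := ho b₁ b₂ (h₁ b₁ (by simp)) F
  have key : ∀ p ∈ f.val, cmp p.1 a = cmp p.2 z := by
    intro p hp
    rcases lt_trichotomy p.2 b₁ with h | h | h
    · rw [hb₁ p hp, (cmp_eq_lt_iff _ _).2 h, (cmp_eq_lt_iff _ _).2 (h.trans hz₁)]
    · have h' := hb₁ p hp
      rw [(cmp_eq_eq_iff _ _).2 h, cmp_eq_eq_iff] at h'
      exact absurd (h' ▸ hp : (a, p.2) ∈ f.val) (ha p.2)
    · have h' : b₂ < p.2 := h₂ p.2 (by simpa [h] using ⟨p.1, hp⟩)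
      rw [hb₁ p hp, (cmp_eq_gt_iff _ _).2 h, (cmp_eq_gt_iff _ _).2 (hz₂.trans h')]
  classical
  refine ⟨⟨insert (a, z) f.val, fun p hp q hq ↦ ?_⟩, z, hzF, fun y => by simp⟩
  rw [Finset.mem_insert] at hp hq
  rcases hp with (rfl | pf) <;> rcases hq with (rfl | qf)
  · simp only [cmp_self_eq_eq]
  · rw [cmp_eq_cmp_symm]
    exact key _ qf
  · exact key _ pf
  · exact f.prop _ pf _ qf

theorem Order.PartialIso.exists_insert_right [DenselyOrdered α] [NoMinOrder α] [NoMaxOrder α]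
    [Nonempty α] {o : α → K} (ho : LabelsDense o) (f : PartialIso α β) (b : β)
    (hb : ∀ a, (a, b) ∉ f.val) (F : Finset K) :
    ∃ (q : PartialIso α β) (a : α), o a ∉ F ∧
      ∀ y, y ∈ q.val ↔ y = (a, b) ∨ y ∈ f.val := by
  obtain ⟨q, a, haF, hq⟩ := f.comm.exists_insert_left ho b
    (fun a h => hb a ((f.mem_comm a b).1 h)) F
  refine ⟨q.comm, a, haF, fun ⟨y, z⟩ => ?_⟩
  rw [PartialIso.mem_comm, hq, PartialIso.mem_comm]
  simp [and_comm]

/-- A finite partial isomorphism is contained in the graph of an order isomorphism. -/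
def Order.PartialIso.ExtendsTo (p : PartialIso α β) (φ : α ≃o β) : Prop :=
  ∀ y ∈ p.val, φ y.1 = y.2

theorem Order.PartialIso.ExtendsTo.apply_eq {p : PartialIso α β} {φ : α ≃o β}
    (h : p.ExtendsTo φ) {x : α} {z : β} (hx : (x, z) ∈ p.val) : φ x = z :=
  h _ hx

/-- An order isomorphism between countable dense orders that is generic for a countable family of
cofinal sets of finite partial isomorphisms. -/
theorem exists_generic_orderIso [Countable α] [DenselyOrdered α] [NoMinOrder α] [NoMaxOrder α]
    [Nonempty α] [Countable β] [DenselyOrdered β] [NoMinOrder β] [NoMaxOrder β] [Nonempty β]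
    {ι : Type*} [Countable ι] (D : ι → Cofinal (PartialIso α β)) :
    ∃ φ : α ≃o β, ∀ i, ∃ p ∈ D i, p.ExtendsTo φ := by
  cases nonempty_encodable α
  cases nonempty_encodable β
  cases nonempty_encodable ι
  let C : (α ⊕ β) ⊕ ι → Cofinal (PartialIso α β) :=
    Sum.elim (Sum.elim (PartialIso.definedAtLeft β) (PartialIso.definedAtRight α)) D
  let I : Ideal (PartialIso α β) := idealOfCofinals default C
  let F a := PartialIso.funOfIdeal a I (cofinal_meets_idealOfCofinals _ C (.inl (.inl a)))
  let G b := PartialIso.invOfIdeal b I (cofinal_meets_idealOfCofinals _ C (.inl (.inr b)))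
  refine ⟨OrderIso.ofCmpEqCmp (fun a ↦ (F a).val) (fun b ↦ (G b).val) fun a b ↦ ?_, fun i => ?_⟩
  · rcases (F a).prop with ⟨f, hf, ha⟩
    rcases (G b).prop with ⟨g, hg, hb⟩
    rcases I.directed _ hf _ hg with ⟨m, _, fm, gm⟩
    exact m.prop (a, _) (fm ha) (_, b) (gm hb)
  · obtain ⟨p, hp, hpI⟩ := cofinal_meets_idealOfCofinals default C (.inr i)
    refine ⟨p, hp, fun y hy => ?_⟩
    rcases (F y.1).prop with ⟨f, hf, ha⟩
    rcases I.directed _ hf _ hpI with ⟨m, _, fm, pm⟩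
    have := m.prop _ (fm ha) _ (pm hy)
    exact (cmp_eq_eq_iff _ _).1 (this ▸ (cmp_eq_eq_iff _ _).2 rfl)

end PartialIso

section FreeProduct

variable {A B : Type*} [Group A] [Group B]

/-- The nontrivial alternating products of nontrivial elements of `A` and `B`; the index tells
whether the first letter lies in `A`. -/
inductive IsAlternating : Bool → Coprod A B → Prop
  | inl (a : A) (ha : a ≠ 1) : IsAlternating true (Coprod.inl a)
  | inr (b : B) (hb : b ≠ 1) : IsAlternating false (Coprod.inr b)
  | inl_mul (a : A) (ha : a ≠ 1) (g : Coprod A B) (hg : IsAlternating false g) :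
      IsAlternating true (Coprod.inl a * g)
  | inr_mul (b : B) (hb : b ≠ 1) (g : Coprod A B) (hg : IsAlternating true g) :
      IsAlternating false (Coprod.inr b * g)

theorem eq_one_or_isAlternating (g : Coprod A B) : g = 1 ∨ ∃ s, IsAlternating s g := by
  induction g using Coprod.induction_on' with
  | one => exact Or.inl rfl
  | inl_mul a x ih =>
    by_cases ha : a = 1
    · simpa [ha] using ih
    rcases ih with rfl | ⟨_, ⟨a', ha'⟩ | ⟨b, hb⟩ | ⟨a', ha', g, hg⟩ | ⟨b, hb, g, hg⟩⟩
    · exact Or.inr ⟨_, by simpa using .inl a ha⟩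
    · by_cases h : a * a' = 1
      · exact Or.inl (by rw [← map_mul, h, map_one])
      · exact Or.inr ⟨true, map_mul (Coprod.inl (N := B)) a a' ▸ IsAlternating.inl _ h⟩
    · exact Or.inr ⟨_, .inl_mul a ha _ (.inr b hb)⟩
    · rw [← mul_assoc, ← map_mul]
      by_cases h : a * a' = 1
      · exact Or.inr ⟨_, by simpa [h] using hg⟩
      · exact Or.inr ⟨_, .inl_mul _ h _ hg⟩
    · exact Or.inr ⟨_, .inl_mul a ha _ (.inr_mul b hb g hg)⟩
  | inr_mul b x ih =>
    by_cases hb : b = 1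
    · simpa [hb] using ih
    rcases ih with rfl | ⟨_, ⟨a, ha⟩ | ⟨b', hb'⟩ | ⟨a, ha, g, hg⟩ | ⟨b', hb', g, hg⟩⟩
    · exact Or.inr ⟨_, by simpa using .inr b hb⟩
    · exact Or.inr ⟨_, .inr_mul b hb _ (.inl a ha)⟩
    · by_cases h : b * b' = 1
      · exact Or.inl (by rw [← map_mul, h, map_one])
      · exact Or.inr ⟨false, map_mul (Coprod.inr (M := A)) b b' ▸ IsAlternating.inr _ h⟩
    · exact Or.inr ⟨_, .inr_mul b hb _ (.inl_mul a ha g hg)⟩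
    · rw [← mul_assoc, ← map_mul]
      by_cases h : b * b' = 1
      · exact Or.inr ⟨_, by simpa [h] using hg⟩
      · exact Or.inr ⟨_, .inr_mul _ h _ hg⟩

variable {α β : Type*} [LinearOrder α] [LinearOrder β]

/-- The right action of `A ∗ B` on `α` that extends `ρ` and the action of `B` transported from `β`
along `φ`. -/
def glueAction (ρ : A →* (α ≃o α)ᵐᵒᵖ) (τ : B →* (β ≃o β)ᵐᵒᵖ) (φ : α ≃o β) :
    Coprod A B →* (α ≃o α)ᵐᵒᵖ :=
  Coprod.lift ρ
    { toFun := fun b => .op ((φ.trans (τ b).unop).trans φ.symm)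
      map_one' := by
        rw [map_one]
        congr 1
        ext x
        simp
      map_mul' := fun b c => by
        rw [map_mul, ← MulOpposite.op_mul]
        congr 1
        ext x
        simp }

theorem glueAction_inl_mul (ρ : A →* (α ≃o α)ᵐᵒᵖ) (τ : B →* (β ≃o β)ᵐᵒᵖ) (φ : α ≃o β)
    (a : A) (g : Coprod A B) (x : α) :
    (glueAction ρ τ φ (Coprod.inl a * g)).unop x = (glueAction ρ τ φ g).unop ((ρ a).unop x) := by
  rw [map_mul]
  simp [glueAction]

theorem glueAction_inr_mul (ρ : A →* (α ≃o α)ᵐᵒᵖ) (τ : B →* (β ≃o β)ᵐᵒᵖ) (φ : α ≃o β)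
    (b : B) (g : Coprod A B) (x : α) :
    (glueAction ρ τ φ (Coprod.inr b * g)).unop x =
      (glueAction ρ τ φ g).unop (φ.symm ((τ b).unop (φ x))) := by
  rw [map_mul]
  simp [glueAction]

variable {K L : Type*} {ρ : A →* (α ≃o α)ᵐᵒᵖ} {τ : B →* (β ≃o β)ᵐᵒᵖ} {o : α → K} {o' : β → L}

theorem Order.PartialIso.exists_insert_left_of_free [DenselyOrdered β] [NoMinOrder β]
    [NoMaxOrder β] [Nonempty β] (ho' : LabelsDense o')
    (hτ : ∀ b x, o' ((τ b).unop x) = o' x) (hτf : ∀ b x, (τ b).unop x = x → b = 1)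
    (p : PartialIso α β) (x : α) (hx : ∀ y, (x, y) ∉ p.val) :
    ∃ (q : PartialIso α β) (z : β), p ≤ q ∧ (x, z) ∈ q.val ∧
      ∀ b, b ≠ 1 → ∀ y, (y, (τ b).unop z) ∉ q.val := by
  classical
  obtain ⟨q, z, hz, hq⟩ := p.exists_insert_left ho' x hx (p.val.image fun y => o' y.2)
  refine ⟨q, z, fun y hy => (hq y).2 (Or.inr hy), (hq _).2 (Or.inl rfl), fun b hb y h => ?_⟩
  rcases (hq _).1 h with h | h
  · exact hb (hτf b z (Prod.ext_iff.1 h).2)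
  · exact hz (Finset.mem_image.2 ⟨_, h, hτ b z⟩)

theorem Order.PartialIso.exists_insert_right_of_free [DenselyOrdered α] [NoMinOrder α]
    [NoMaxOrder α] [Nonempty α] (ho : LabelsDense o)
    (hρ : ∀ a x, o ((ρ a).unop x) = o x) (hρf : ∀ a x, (ρ a).unop x = x → a = 1)
    (p : PartialIso α β) (z : β) (hz : ∀ y, (y, z) ∉ p.val) :
    ∃ (q : PartialIso α β) (x : α), p ≤ q ∧ (x, z) ∈ q.val ∧ (∀ y, (x, y) ∉ p.val) ∧
      ∀ a, a ≠ 1 → ∀ y, ((ρ a).unop x, y) ∉ q.val := by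
  classical
  obtain ⟨q, x, hx, hq⟩ := p.exists_insert_right ho z hz (p.val.image fun y => o y.1)
  refine ⟨q, x, fun y hy => (hq y).2 (Or.inr hy), (hq _).2 (Or.inl rfl),
    fun y hy => hx (Finset.mem_image.2 ⟨_, hy, rfl⟩), fun a ha y h => ?_⟩
  rcases (hq _).1 h with h | h
  · exact ha (hρf a x (Prod.ext_iff.1 h).1)
  · exact hx (Finset.mem_image.2 ⟨_, h, hρ a x⟩)

/-- Starting from a finite partial isomorphism, one can prescribe finitely many more values that
force an alternating product to move a point away from any given point of the domain. -/
theorem IsAlternating.exists_extension [DenselyOrdered α] [NoMinOrder α] [NoMaxOrder α]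
    [Nonempty α] [DenselyOrdered β] [NoMinOrder β] [NoMaxOrder β] [Nonempty β]
    (ho : LabelsDense o) (ho' : LabelsDense o')
    (hρ : ∀ a x, o ((ρ a).unop x) = o x) (hτ : ∀ b x, o' ((τ b).unop x) = o' x)
    (hρf : ∀ a x, (ρ a).unop x = x → a = 1) (hτf : ∀ b x, (τ b).unop x = x → b = 1)
    {s : Bool} {g : Coprod A B} (hg : IsAlternating s g) :
    ∀ (p : PartialIso α β) (x : α) (z : β), (x, z) ∈ p.val →
      (s = true → ∀ a, a ≠ 1 → ∀ y, ((ρ a).unop x, y) ∉ p.val) →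
      (s = false → ∀ b, b ≠ 1 → ∀ y, (y, (τ b).unop z) ∉ p.val) →
      ∀ x₀ z₀, (x₀, z₀) ∈ p.val → ∃ q : PartialIso α β, p ≤ q ∧ ∃ y, y ≠ x₀ ∧
        ∀ φ : α ≃o β, q.ExtendsTo φ → (glueAction ρ τ φ g).unop x = y := by
  induction hg with
  | inl a ha =>
    intro p x z hxz h₁ _ x₀ z₀ h₀
    refine ⟨p, le_rfl, (ρ a).unop x, fun h => h₁ rfl a ha z₀ (by rwa [h]), fun φ _ => ?_⟩
    simpa using glueAction_inl_mul ρ τ φ a 1 x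
  | inr b hb =>
    intro p x z hxz _ h₂ x₀ z₀ h₀
    obtain ⟨q, y, hpq, hy, hyp, -⟩ := p.exists_insert_right_of_free ho hρ hρf _ (h₂ rfl b hb)
    refine ⟨q, hpq, y, fun h => hyp z₀ (h ▸ h₀), fun φ hφ => ?_⟩
    have h := glueAction_inr_mul ρ τ φ b 1 x
    rw [hφ.apply_eq (hpq hxz), ← hφ.apply_eq hy] at h
    simpa using h
  | inl_mul a ha g _ ih =>
    intro p x z hxz h₁ _ x₀ z₀ h₀
    obtain ⟨q, z', hpq, hz', hf⟩ := p.exists_insert_left_of_free ho' hτ hτf _ (h₁ rfl a ha)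
    obtain ⟨r, hqr, y, hy, hr⟩ := ih q _ z' hz' (by simp) (fun _ => hf) x₀ z₀ (hpq h₀)
    exact ⟨r, hpq.trans hqr, y, hy, fun φ hφ => by rw [glueAction_inl_mul, hr φ hφ]⟩
  | inr_mul b hb g _ ih =>
    intro p x z hxz _ h₂ x₀ z₀ h₀
    obtain ⟨q, x', hpq, hx', -, hf⟩ := p.exists_insert_right_of_free ho hρ hρf _ (h₂ rfl b hb)
    obtain ⟨r, hqr, y, hy, hr⟩ := ih q x' _ hx' (fun _ => hf) (by simp) x₀ z₀ (hpq h₀)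
    refine ⟨r, hpq.trans hqr, y, hy, fun φ hφ => ?_⟩
    rw [glueAction_inr_mul, hφ.apply_eq (hqr (hpq hxz)), ← hφ.apply_eq (hqr hx'),
      φ.symm_apply_apply, hr φ hφ]


/-- If `A` and `B` act freely on countable dense orders, then gluing the two actions along a
generic order isomorphism gives a faithful action of `A ∗ B`. -/
theorem exists_injective_glueAction [Countable A] [Countable B] [Countable α] [DenselyOrdered α]
    [NoMinOrder α] [NoMaxOrder α] [Nonempty α] [Countable β] [DenselyOrdered β] [NoMinOrder β]
    [NoMaxOrder β] [Nonempty β] (ho : LabelsDense o) (ho' : LabelsDense o')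
    (hρ : ∀ a x, o ((ρ a).unop x) = o x) (hτ : ∀ b x, o' ((τ b).unop x) = o' x)
    (hρf : ∀ a x, (ρ a).unop x = x → a = 1) (hτf : ∀ b x, (τ b).unop x = x → b = 1) :
    ∃ φ : α ≃o β, Function.Injective (glueAction ρ τ φ) := by
  classical
  have hc : ∀ g : {g : Coprod A B // g ≠ 1}, IsCofinal {q : PartialIso α β |
      ∃ x y, y ≠ x ∧ ∀ φ : α ≃o β, q.ExtendsTo φ → (glueAction ρ τ φ g.1).unop x = y} := by
    rintro ⟨g, hg⟩ p
    obtain ⟨s, hs⟩ := (eq_one_or_isAlternating g).resolve_left hg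
    obtain ⟨q, x, z, hpq, hxz, h₁, h₂⟩ : ∃ (q : PartialIso α β) (x : α) (z : β), p ≤ q ∧
        (x, z) ∈ q.val ∧ (s = true → ∀ a, a ≠ 1 → ∀ y, ((ρ a).unop x, y) ∉ q.val) ∧
        (s = false → ∀ b, b ≠ 1 → ∀ y, (y, (τ b).unop z) ∉ q.val) := by
      cases s
      · have := NoMaxOrder.infinite (α := α)
        obtain ⟨x, hx⟩ := Infinite.exists_notMem_finset (p.val.image Prod.fst)
        obtain ⟨q, z, hpq, hxz, h⟩ := p.exists_insert_left_of_free ho' hτ hτf x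
          fun y hy => hx (Finset.mem_image_of_mem _ hy)
        exact ⟨q, x, z, hpq, hxz, by simp, fun _ => h⟩
      · have := NoMaxOrder.infinite (α := β)
        obtain ⟨z, hz⟩ := Infinite.exists_notMem_finset (p.val.image Prod.snd)
        obtain ⟨q, x, hpq, hxz, -, h⟩ := p.exists_insert_right_of_free ho hρ hρf z
          fun y hy => hz (Finset.mem_image_of_mem _ hy)
        exact ⟨q, x, z, hpq, hxz, fun _ => h, by simp⟩
    obtain ⟨r, hqr, y, hy, hr⟩ :=
      hs.exists_extension ho ho' hρ hτ hρf hτf q x z hxz h₁ h₂ x z hxz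
    exact ⟨r, ⟨x, y, hy, hr⟩, hpq.trans hqr⟩
  have : Countable (Coprod A B) := Coprod.mk_surjective.countable
  obtain ⟨φ, hφ⟩ := exists_generic_orderIso fun g => (⟨_, hc g⟩ : Cofinal (PartialIso α β))
  refine ⟨φ, (injective_iff_map_eq_one _).2 fun g hg => ?_⟩
  by_contra h
  obtain ⟨p, ⟨x, y, hxy, hp⟩, hpφ⟩ := hφ ⟨g, h⟩
  exact hxy (by simpa [hg] using (hp φ hpφ).symm)

end FreeProduct

/-- A countable right-orderable group `H` acts freely on `H ×ₗ ℚ`, for a suitable linear order on `H`,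
preserving the second coordinate. -/
theorem IsRightOrderable.exists_free_action {H : Type*} [Group H] [Countable H]
    (hH : IsRightOrderable H) :
    ∃ (_ : LinearOrder H) (ρ : H →* ((H ×ₗ ℚ) ≃o (H ×ₗ ℚ))ᵐᵒᵖ),
      (∀ a x, (ofLex ((ρ a).unop x)).2 = (ofLex x).2) ∧ ∀ a x, (ρ a).unop x = x → a = 1 := by
  classical
  obtain ⟨lt, hlt, hmul⟩ := hH
  let _ : LinearOrder H := linearOrderOfSTO lt
  have hmono : ∀ h : H, StrictMono (· * h) := fun h f g hfg => hmul f g h hfg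
  let R (h : H) : H ≃o H := ⟨Equiv.mulRight h, (hmono h).le_iff_le⟩
  refine ⟨inferInstance,
    { toFun := fun h => .op (Prod.Lex.prodLexCongr (R h) (.refl ℚ))
      map_one' := ?_
      map_mul' := fun f g => ?_ }, fun a x => rfl, fun a x h => ?_⟩
  · rw [← MulOpposite.op_one]
    congr 1
    exact OrderIso.ext (funext fun x => Prod.ext (mul_one (ofLex x).1) rfl)
  · rw [← MulOpposite.op_mul]
    congr 1
    exact OrderIso.ext (funext fun x => Prod.ext (mul_assoc (ofLex x).1 f g).symm rfl)
  · have h' : (ofLex x).1 * a = (ofLex x).1 := congrArg (fun y => (ofLex y).1) h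
    simpa using h'

/-- The free product of two countable right-orderable groups acts faithfully on a countable linear
order. -/
theorem exists_faithful_action_coprod {A : Type*} {B : Type*} [Group A] [Group B] [Countable A]
    [Countable B] (hA : IsRightOrderable A) (hB : IsRightOrderable B) :
    ∃ (_ : LinearOrder A) (ρ : Coprod A B →* ((A ×ₗ ℚ) ≃o (A ×ₗ ℚ))ᵐᵒᵖ),
      Function.Injective ρ := by
  obtain ⟨_, ρ, hρ, hρf⟩ := hA.exists_free_action
  obtain ⟨_, τ, hτ, hτf⟩ := hB.exists_free_action
  have : Countable (A ×ₗ ℚ) := inferInstanceAs (Countable (A × ℚ))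
  have : Countable (B ×ₗ ℚ) := inferInstanceAs (Countable (B × ℚ))
  have : Nonempty (A ×ₗ ℚ) := ⟨toLex (1, 0)⟩
  have : Nonempty (B ×ₗ ℚ) := ⟨toLex (1, 0)⟩
  obtain ⟨φ, hφ⟩ := exists_injective_glueAction (labelsDense_snd A) (labelsDense_snd B)
    hρ hτ hρf hτf
  exact ⟨_, _, hφ⟩

section RealExtension

variable {D : Type*} [LinearOrder D] {u : D → ℝ}

theorem exists_cut_image (hu : StrictMono u) (hd : ∀ x y : ℝ, x < y → ∃ t, x < u t ∧ u t < y)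
    (f : D ≃o D) (x : ℝ) : ∃ y, ∀ t, u t < x ↔ u (f t) < y := by
  obtain ⟨t₀, ht₀, -⟩ := hd x (x + 1) (by linarith)
  have hb : BddAbove {r | ∃ t, u t < x ∧ u (f t) = r} := by
    refine ⟨u (f t₀), ?_⟩
    rintro _ ⟨t, ht, rfl⟩
    exact hu.monotone (f.monotone (hu.lt_iff_lt.1 (ht.trans ht₀)).le)
  obtain ⟨t₁, -, ht₁⟩ := hd (x - 1) x (by linarith)
  have hne : {r | ∃ t, u t < x ∧ u (f t) = r}.Nonempty := ⟨_, t₁, ht₁, rfl⟩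
  refine ⟨sSup {r | ∃ t, u t < x ∧ u (f t) = r}, fun t => ⟨fun ht => ?_, fun ht => ?_⟩⟩
  · obtain ⟨s, hs, hsx⟩ := hd _ _ ht
    exact (hu (f.strictMono (hu.lt_iff_lt.1 hs))).trans_le (le_csSup hb ⟨s, hsx, rfl⟩)
  · obtain ⟨_, ⟨s, hs, rfl⟩, hts⟩ := exists_lt_of_lt_csSup hne ht
    exact (hu (f.lt_iff_lt.1 (hu.lt_iff_lt.1 hts))).trans hs

theorem le_of_forall_cut (hd : ∀ x y : ℝ, x < y → ∃ t, x < u t ∧ u t < y) (f : D ≃o D) {x y : ℝ}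
    (h : ∀ t, u (f t) < x → u (f t) < y) : x ≤ y := by
  by_contra! hlt
  obtain ⟨t, ht, ht'⟩ := hd _ _ hlt
  have := h (f.symm t)
  rw [f.apply_symm_apply] at this
  exact (this ht').not_gt ht

theorem eq_of_forall_cut (hd : ∀ x y : ℝ, x < y → ∃ t, x < u t ∧ u t < y) (f : D ≃o D) {x y : ℝ}
    (h : ∀ t, u (f t) < x ↔ u (f t) < y) : x = y :=
  (le_of_forall_cut hd f fun t => (h t).1).antisymm (le_of_forall_cut hd f fun t => (h t).2)

/-- Order automorphisms of a dense subset of `ℝ` extend to `ℝ`, compatibly with composition. -/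
theorem exists_real_extension_of_dense (hu : StrictMono u)
    (hd : ∀ x y : ℝ, x < y → ∃ t, x < u t ∧ u t < y) :
    ∃ E : (D ≃o D) → (ℝ ≃o ℝ), (∀ f g, E (f.trans g) = (E f).trans (E g)) ∧
      ∀ f t, E f (u t) = u (f t) := by
  choose F hF using exists_cut_image hu hd
  have hcomp : ∀ f g x, F (f.trans g) x = F g (F f x) := fun f g x =>
    eq_of_forall_cut hd (f.trans g) fun t => by
      rw [← hF (f.trans g) x t, hF f x t, hF g (F f x) (f t)]
      rfl
  have hrefl : ∀ x, F (.refl D) x = x := fun x =>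
    eq_of_forall_cut hd (.refl D) fun t => (hF (.refl D) x t).symm
  have hmono : ∀ f, Monotone (F f) := fun f x y hxy =>
    le_of_forall_cut hd f fun t ht => (hF f y t).1 (((hF f x t).2 ht).trans_le hxy)
  have hl : ∀ f x, F f.symm (F f x) = x := fun f x => by rw [← hcomp, f.self_trans_symm, hrefl]
  have hr : ∀ f x, F f (F f.symm x) = x := fun f x => by rw [← hcomp, f.symm_trans_self, hrefl]
  refine ⟨fun f =>
    { toFun := F f
      invFun := F f.symm
      left_inv := hl f
      right_inv := hr f
      map_rel_iff' := fun {x y} =>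
        ⟨fun h => by simpa only [Equiv.coe_fn_mk, hl] using hmono f.symm h, fun h => hmono f h⟩ },
    fun f g => OrderIso.ext (funext (hcomp f g)), fun f t => ?_⟩
  exact eq_of_forall_cut hd f fun s => by
    rw [hu.lt_iff_lt, f.lt_iff_lt, ← hu.lt_iff_lt]
    exact (hF f (u t) s).symm

end RealExtension

/-- The automorphism group of a nonempty countable linear order acts on `ℝ`, extending its action
on an embedded copy of that order. -/
theorem exists_real_extension (T : Type*) [LinearOrder T] [Countable T] [Nonempty T] :
    ∃ (E : (T ≃o T) → (ℝ ≃o ℝ)) (ι : T → ℝ), Function.Injective ι ∧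
      (∀ f g, E (f.trans g) = (E f).trans (E g)) ∧ ∀ f t, E f (ι t) = ι (f t) := by
  have : Countable (T ×ₗ ℚ) := inferInstanceAs (Countable (T × ℚ))
  have : Nonempty (T ×ₗ ℚ) := inferInstanceAs (Nonempty (T × ℚ))
  obtain ⟨e⟩ := iso_of_countable_dense (T ×ₗ ℚ) ℚ
  have hu : StrictMono fun t => (e t : ℝ) := fun s t h => Rat.cast_lt.2 (e.strictMono h)
  obtain ⟨E, hE, hEu⟩ := exists_real_extension_of_dense hu fun x y hxy => by
    obtain ⟨q, hq⟩ := exists_rat_btwn hxy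
    exact ⟨e.symm q, by simpa using hq⟩
  refine ⟨fun f => E (Prod.Lex.prodLexCongr f (.refl ℚ)), fun t => e (toLex (t, 0)),
    fun s t h => congrArg (fun y => (ofLex y).1) (hu.injective h), fun f g => ?_,
    fun f t => hEu _ _⟩
  rw [← hE]
  rfl

/-- A right action on `ℝ` restricts to a right action on each of its orbits. -/
theorem IsRightAction.exists_orbit_action {G : Type*} [Group G] {σ : G → (ℝ ≃o ℝ)}
    (hσ : IsRightAction σ) (x : ℝ) :
    ∃ α : G → (Set.range (fun g => σ g x) ≃o Set.range (fun g => σ g x)),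
      (∀ g h, α (g * h) = (α g).trans (α h)) ∧ ∀ g s, (α g s : ℝ) = σ g s := by
  have key : ∀ g y, σ g y ∈ Set.range (fun g => σ g x) ↔ y ∈ Set.range (fun g => σ g x) := by
    refine fun g y => ⟨?_, ?_⟩
    · rintro ⟨h, hh⟩
      refine ⟨h * g⁻¹, (σ g).injective ?_⟩
      change (σ (h * g⁻¹)).trans (σ g) x = _
      rw [← hσ, inv_mul_cancel_right]
      exact hh
    · rintro ⟨h, rfl⟩
      exact ⟨h * g, by simp [hσ h g]⟩
  refine ⟨fun g =>
    { toEquiv := (σ g).toEquiv.subtypeEquiv fun y => (key g y).symm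
      map_rel_iff' := (σ g).le_iff_le }, fun g h => ?_, fun g s => rfl⟩
  ext s
  exact DFunLike.congr_fun (hσ g h) _

/-- If a cyclically reduced word `w = a₁b₁⋯aₙbₙ` in a free product of countable
right-orderable groups admits a relative stacking, then it admits a relative stacking
`(σ′, x′)` whose underlying action `σ′` is faithful (i.e. injective). -/
theorem exists_faithful_relativeStacking
    {A B : Type*} [Group A] [Group B] [Countable A] [Countable B]
    (hA : IsRightOrderable A) (hB : IsRightOrderable B)
    {n : ℕ} (hn : 1 ≤ n) (a : Fin n → A) (b : Fin n → B)
    (ha : ∀ i, a i ≠ 1) (hb : ∀ i, b i ≠ 1)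
    (hst : ∃ (σ : Monoid.Coprod A B → (ℝ ≃o ℝ)) (x : ℝ), IsRelativeStacking a b σ x) :
    ∃ (σ' : Monoid.Coprod A B → (ℝ ≃o ℝ)) (x' : ℝ),
      IsRelativeStacking a b σ' x' ∧ Function.Injective σ' := by
  obtain ⟨σ, x, hσ, hfix, hinj⟩ := hst
  obtain ⟨_, ρ, hρ⟩ := exists_faithful_action_coprod hA hB
  obtain ⟨α, hα, hασ⟩ := hσ.exists_orbit_action x
  have : Countable (Coprod A B) := Coprod.mk_surjective.countable
  have : Countable (A ×ₗ ℚ) := inferInstanceAs (Countable (A × ℚ))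
  have : Countable (Set.range fun g => σ g x) := (Set.countable_range _).to_subtype
  let S : Set ℝ := Set.range fun g => σ g x
  let x₀ : S := ⟨σ 1 x, 1, rfl⟩
  have hx₀ : (x₀ : ℝ) = x := (σ 1).injective (by
    change (σ 1).trans (σ 1) x = σ 1 x
    rw [← hσ, mul_one])
  have : Countable (S ⊕ₗ (A ×ₗ ℚ)) := inferInstanceAs (Countable (S ⊕ (A ×ₗ ℚ)))
  have : Nonempty (S ⊕ₗ (A ×ₗ ℚ)) := ⟨Sum.inlₗ x₀⟩
  obtain ⟨E, ι, hι, hE, hEι⟩ := exists_real_extension (S ⊕ₗ (A ×ₗ ℚ))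
  let γ (g : Coprod A B) : S ⊕ₗ (A ×ₗ ℚ) ≃o S ⊕ₗ (A ×ₗ ℚ) :=
    OrderIso.sumLexCongr (α g) (ρ g).unop
  have hγl : ∀ g s, γ g (Sum.inlₗ s) = Sum.inlₗ (α g s) := fun g s => rfl
  have hγr : ∀ g t, γ g (Sum.inrₗ t) = Sum.inrₗ ((ρ g).unop t) := fun g t => rfl
  have hinl : ∀ s t : S, (Sum.inlₗ s : S ⊕ₗ (A ×ₗ ℚ)) = Sum.inlₗ t ↔ (s : ℝ) = t := fun s t => by
    rw [← Subtype.ext_iff]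
    exact Sum.inl.inj_iff
  have hval : ∀ g, E (γ g) (ι (Sum.inlₗ x₀)) = ι (Sum.inlₗ (α g x₀)) := fun g => by
    rw [hEι, hγl]
  refine ⟨fun g => E (γ g), ι (Sum.inlₗ x₀), ⟨fun g h => ?_, ?_, fun m₁ m₂ h₁ h₁' h₂ h₂' h => ?_⟩,
    fun g h hgh => hρ (MulOpposite.unop_injective ?_)⟩
  · change E (γ (g * h)) = _
    rw [← hE]
    congr 1
    refine OrderIso.ext (funext fun t => ?_)
    rcases t with s | t
    · change Sum.inlₗ (α (g * h) s) = Sum.inlₗ (α h (α g s))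
      rw [hα]
      rfl
    · change Sum.inrₗ ((ρ (g * h)).unop t) = Sum.inrₗ ((ρ h).unop ((ρ g).unop t))
      rw [map_mul]
      rfl
  · rw [hval, hι.eq_iff, hinl, hασ, hx₀]
    exact hfix
  · rw [hval, hval, hι.eq_iff, hinl, hασ, hασ, hx₀] at h
    exact hinj m₁ m₂ h₁ h₁' h₂ h₂' h
  · refine OrderIso.ext (funext fun t => ?_)
    have h : E (γ g) (ι (Sum.inrₗ t)) = E (γ h) (ι (Sum.inrₗ t)) := DFunLike.congr_fun hgh _
    rw [hEι, hEι, hι.eq_iff, hγr, hγr] at h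
    exact Sum.inr.inj h
end
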